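/- arXiv:2405.05222 — 2 statements merged into one kernel-verified Lean document; each statement's English description precedes it below -/
import Mathlib

section
/- Let (D,F) be a valid pair, where F = (f₁,…,f_s) is a sequence of functions fᵢ : V(D) → ℕ². Then D is F-dicolourable if and only if (D,F) is not a hard pair. -/
open scoped Classical

/-- A finite digraph with vertex set a `Finset ℕ` and no loops.
Both arcs `(u,v)` and `(v,u)` may be present (a digon). -/
structure Digraph' where
  verts : Finset ℕ
  arcs : Finset (ℕ × ℕ)
  mem_fst : ∀ a ∈ arcs, a.1 ∈ verts
  mem_snd : ∀ a ∈ arcs, a.2 ∈ verts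
  no_loops : ∀ a ∈ arcs, a.1 ≠ a.2

namespace Digraph'

/-- In-degree of `v`. -/
def inDeg (D : Digraph') (v : ℕ) : ℕ := (D.arcs.filter fun a => a.2 = v).card

/-- Out-degree of `v`. -/
def outDeg (D : Digraph') (v : ℕ) : ℕ := (D.arcs.filter fun a => a.1 = v).card

/-- In-neighbourhood of `v`. -/
def inNbrs (D : Digraph') (v : ℕ) : Finset ℕ := (D.arcs.filter fun a => a.2 = v).image Prod.fst

/-- Out-neighbourhood of `v`. -/
def outNbrs (D : Digraph') (v : ℕ) : Finset ℕ := (D.arcs.filter fun a => a.1 = v).image Prod.snd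

/-- Neighbourhood of `v` in the underlying graph. -/
def ugNbrs (D : Digraph') (v : ℕ) : Finset ℕ := D.inNbrs v ∪ D.outNbrs v

/-- `H` is a subdigraph of `D`. -/
def IsSubdigraph (H D : Digraph') : Prop := H.verts ⊆ D.verts ∧ H.arcs ⊆ D.arcs

/-- The subdigraph of `D` induced by the vertex set `X`. -/
def induce (D : Digraph') (X : Finset ℕ) : Digraph' where
  verts := D.verts ∩ X
  arcs := D.arcs.filter fun a => a.1 ∈ X ∧ a.2 ∈ X
  mem_fst := fun a ha => by
    simp only [Finset.mem_filter] at ha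
    exact Finset.mem_inter.mpr ⟨D.mem_fst a ha.1, ha.2.1⟩
  mem_snd := fun a ha => by
    simp only [Finset.mem_filter] at ha
    exact Finset.mem_inter.mpr ⟨D.mem_snd a ha.1, ha.2.2⟩
  no_loops := fun a ha => by
    simp only [Finset.mem_filter] at ha
    exact D.no_loops a ha.1

/-- `D − X`, the digraph obtained from `D` by deleting the vertices of `X`. -/
def del (D : Digraph') (X : Finset ℕ) : Digraph' := D.induce (D.verts \ X)

/-- Adjacency in the underlying graph of `D`. -/
def ugAdj (D : Digraph') (u v : ℕ) : Prop :=
  u ∈ D.verts ∧ v ∈ D.verts ∧ ((u, v) ∈ D.arcs ∨ (v, u) ∈ D.arcs)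

/-- `D` is connected, i.e. its underlying graph is connected. -/
def Connected (D : Digraph') : Prop :=
  D.verts.Nonempty ∧ ∀ u ∈ D.verts, ∀ v ∈ D.verts, Relation.ReflTransGen D.ugAdj u v

/-- `D` is biconnected: it has at least two vertices, is connected, and stays
connected after the deletion of any vertex. -/
def Biconnected (D : Digraph') : Prop :=
  2 ≤ D.verts.card ∧ D.Connected ∧ ∀ x ∈ D.verts, (D.del {x}).Connected

/-- Every arc of `D` lies in a digon. -/
def Bidirected (D : Digraph') : Prop := ∀ a ∈ D.arcs, (a.2, a.1) ∈ D.arcs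

/-- The underlying graph of `D` is a cycle. -/
def IsCycleUG (D : Digraph') : Prop :=
  D.Connected ∧ ∀ v ∈ D.verts, (D.ugNbrs v).card = 2

/-- `D` is a bidirected odd cycle. -/
def BidirectedOddCycle (D : Digraph') : Prop :=
  D.Bidirected ∧ D.IsCycleUG ∧ Odd D.verts.card

/-- `D` is a bidirected complete graph. -/
def BidirectedComplete (D : Digraph') : Prop :=
  ∀ u ∈ D.verts, ∀ v ∈ D.verts, u ≠ v → (u, v) ∈ D.arcs

/-- `D` is strictly-`f`-bidegenerate: every nonempty subdigraph `H` of `D` contains a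
vertex `v` with `d⁻_H(v) < f⁻(v)` or `d⁺_H(v) < f⁺(v)`. -/
def StrictlyBidegenerate (D : Digraph') (f : ℕ → ℕ × ℕ) : Prop :=
  ∀ H : Digraph', H.IsSubdigraph D → H.verts.Nonempty →
    ∃ v ∈ H.verts, H.inDeg v < (f v).1 ∨ H.outDeg v < (f v).2

/-- `α` is an `F`-dicolouring of `D`: for each colour `i`, the subdigraph induced by the
vertices coloured `i` is strictly-`Fᵢ`-bidegenerate. -/
def IsDicolouring (D : Digraph') (s : ℕ) (F : Fin s → ℕ → ℕ × ℕ) (α : ℕ → Fin s) : Prop :=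
  ∀ i : Fin s, (D.induce (D.verts.filter fun v => α v = i)).StrictlyBidegenerate (F i)

/-- `D` is `F`-dicolourable. -/
def Dicolourable (D : Digraph') (s : ℕ) (F : Fin s → ℕ → ℕ × ℕ) : Prop :=
  ∃ α : ℕ → Fin s, D.IsDicolouring s F α

/-- `(D,F)` is a valid pair: `D` is connected and the colour budget dominates the
in- and out-degrees at every vertex. -/
def ValidPair (D : Digraph') (s : ℕ) (F : Fin s → ℕ → ℕ × ℕ) : Prop :=
  D.Connected ∧ ∀ v ∈ D.verts,
    D.inDeg v ≤ ∑ i, (F i v).1 ∧ D.outDeg v ≤ ∑ i, (F i v).2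

/-- `(D,F)` is tight: both budget inequalities are equalities at every vertex. -/
def Tight (D : Digraph') (s : ℕ) (F : Fin s → ℕ → ℕ × ℕ) : Prop :=
  ∀ v ∈ D.verts, ∑ i, (F i v).1 = D.inDeg v ∧ ∑ i, (F i v).2 = D.outDeg v

/-- Hard pairs, defined inductively: monochromatic, bicycle, complete, and join hard pairs. -/
inductive IsHardPair : (s : ℕ) → Digraph' → (Fin s → ℕ → ℕ × ℕ) → Prop
  | mono {s : ℕ} {D : Digraph'} {F : Fin s → ℕ → ℕ × ℕ} (i : Fin s)
      (hbi : D.Biconnected)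
      (hi : ∀ v ∈ D.verts, F i v = (D.inDeg v, D.outDeg v))
      (hk : ∀ k : Fin s, k ≠ i → ∀ v ∈ D.verts, F k v = (0, 0)) :
      IsHardPair s D F
  | bicycle {s : ℕ} {D : Digraph'} {F : Fin s → ℕ → ℕ × ℕ} (i j : Fin s) (hij : i ≠ j)
      (hD : D.BidirectedOddCycle)
      (hi : ∀ v ∈ D.verts, F i v = (1, 1))
      (hj : ∀ v ∈ D.verts, F j v = (1, 1))
      (hk : ∀ k : Fin s, k ≠ i → k ≠ j → ∀ v ∈ D.verts, F k v = (0, 0)) :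
      IsHardPair s D F
  | complete {s : ℕ} {D : Digraph'} {F : Fin s → ℕ → ℕ × ℕ}
      (hD : D.BidirectedComplete)
      (hconst : ∀ k : Fin s, ∀ u ∈ D.verts, ∀ v ∈ D.verts, F k u = F k v)
      (hsym : ∀ k : Fin s, ∀ v ∈ D.verts, (F k v).1 = (F k v).2)
      (hsum : ∀ v ∈ D.verts, ∑ k, (F k v).2 = D.verts.card - 1) :
      IsHardPair s D F
  | join {s : ℕ} {D : Digraph'} {F : Fin s → ℕ → ℕ × ℕ}
      (D₁ D₂ : Digraph') (F₁ F₂ : Fin s → ℕ → ℕ × ℕ) (x : ℕ)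
      (h₁ : IsHardPair s D₁ F₁) (h₂ : IsHardPair s D₂ F₂)
      (hx : D₁.verts ∩ D₂.verts = {x})
      (hV : D.verts = D₁.verts ∪ D₂.verts)
      (hA : D.arcs = D₁.arcs ∪ D₂.arcs)
      (hF₁ : ∀ k : Fin s, ∀ v ∈ D₁.verts, v ≠ x → F k v = F₁ k v)
      (hF₂ : ∀ k : Fin s, ∀ v ∈ D₂.verts, v ≠ x → F k v = F₂ k v)
      (hFx : ∀ k : Fin s, F k x = ((F₁ k x).1 + (F₂ k x).1, (F₁ k x).2 + (F₂ k x).2)) :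
      IsHardPair s D F

/-- The sequence of functions of the pair reduced from `(D,F)` by a colouring `α` of
`X ⊆ V(D)`: the budget of colour `i` at `u` decreases by the number of in- and out-neighbours
of `u` inside `X` coloured `i` (truncated at `0`). -/
def reduceF (D : Digraph') {s : ℕ} (F : Fin s → ℕ → ℕ × ℕ) (X : Finset ℕ) (α : ℕ → Fin s) :
    Fin s → ℕ → ℕ × ℕ :=
  fun i u =>
    ((F i u).1 - ((D.inNbrs u ∩ X).filter fun w => α w = i).card,
     (F i u).2 - ((D.outNbrs u ∩ X).filter fun w => α w = i).card)

/-- `B` is a block of `D`: a maximal biconnected subdigraph. -/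
def IsBlock (B D : Digraph') : Prop :=
  B.IsSubdigraph D ∧ B.Biconnected ∧
    ∀ B' : Digraph', B'.IsSubdigraph D → B'.Biconnected → B.IsSubdigraph B' → B' = B

/-- `x` is a cut-vertex of `D`: `D − x` is disconnected. -/
def CutVertex (D : Digraph') (x : ℕ) : Prop :=
  x ∈ D.verts ∧ (D.del {x}).verts.Nonempty ∧ ¬ (D.del {x}).Connected

/-- `B` is an end-block of `D` whose unique cut-vertex (of `D`) in `B` is `x`. -/
def IsEndBlockAt (B D : Digraph') (x : ℕ) : Prop :=
  IsBlock B D ∧ x ∈ B.verts ∧ D.CutVertex x ∧ ∀ y ∈ B.verts, D.CutVertex y → y = x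

/-- `B` is a monochromatic hard end-block with cut-vertex `x`, for colour `c`. -/
def MonoHardEndBlock {s : ℕ} (F : Fin s → ℕ → ℕ × ℕ) (B : Digraph') (x : ℕ) (c : Fin s) : Prop :=
  B.inDeg x ≤ (F c x).1 ∧ B.outDeg x ≤ (F c x).2 ∧
    ∀ v ∈ B.verts, v ≠ x →
      F c v = (B.inDeg v, B.outDeg v) ∧ ∀ k : Fin s, k ≠ c → F k v = (0, 0)

/-- `B` is a bicycle hard end-block with cut-vertex `x`. -/
def BicycleHardEndBlock {s : ℕ} (F : Fin s → ℕ → ℕ × ℕ) (B : Digraph') (x : ℕ) : Prop :=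
  B.BidirectedOddCycle ∧
    ∃ i j : Fin s, i ≠ j ∧
      1 ≤ (F i x).1 ∧ 1 ≤ (F i x).2 ∧ 1 ≤ (F j x).1 ∧ 1 ≤ (F j x).2 ∧
      ∀ v ∈ B.verts, v ≠ x →
        F i v = (1, 1) ∧ F j v = (1, 1) ∧ ∀ k : Fin s, k ≠ i → k ≠ j → F k v = (0, 0)

/-- `B` is a complete hard end-block with cut-vertex `x`. -/
def CompleteHardEndBlock {s : ℕ} (F : Fin s → ℕ → ℕ × ℕ) (B : Digraph') (x : ℕ) : Prop :=
  B.BidirectedComplete ∧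
    (∀ k : Fin s, ∀ u ∈ B.verts, u ≠ x → ∀ v ∈ B.verts, v ≠ x → F k u = F k v) ∧
    (∀ k : Fin s, ∀ v ∈ B.verts, v ≠ x → (F k v).1 = (F k v).2) ∧
    (∀ k : Fin s, ∀ u ∈ B.verts, u ≠ x → (F k u).1 ≤ (F k x).1 ∧ (F k u).2 ≤ (F k x).2)

/-- `B` is a hard end-block with cut-vertex `x`. -/
def HardEndBlock {s : ℕ} (F : Fin s → ℕ → ℕ × ℕ) (B : Digraph') (x : ℕ) : Prop :=
  (∃ c : Fin s, MonoHardEndBlock F B x c) ∨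
    BicycleHardEndBlock F B x ∨ CompleteHardEndBlock F B x

/-- `(D',F')` is the contraction of `(D,F)` with respect to the hard end-block `B` with
cut-vertex `x`, where `u` is a vertex of `B` other than `x`. -/
def IsContraction (D : Digraph') {s : ℕ} (F : Fin s → ℕ → ℕ × ℕ) (B : Digraph') (x u : ℕ)
    (D' : Digraph') (F' : Fin s → ℕ → ℕ × ℕ) : Prop :=
  D' = D.del (B.verts \ {x}) ∧
  (∀ k : Fin s, ∀ v ∈ D'.verts, v ≠ x → F' k v = F k v) ∧
  ((∃ c : Fin s, MonoHardEndBlock F B x c ∧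
      F' c x = ((F c x).1 - B.inDeg x, (F c x).2 - B.outDeg x) ∧
      ∀ k : Fin s, k ≠ c → F' k x = F k x) ∨
   ((¬ ∃ c : Fin s, MonoHardEndBlock F B x c) ∧
      ∀ k : Fin s, F' k x = ((F k x).1 - (F k u).1, (F k x).2 - (F k u).2)))

/-- Property (E): all the functions exceed `1` in the relevant coordinate at every vertex
having an in-(resp. out-)neighbour. -/
def PropE (D : Digraph') {s : ℕ} (F : Fin s → ℕ → ℕ × ℕ) : Prop :=
  ∀ x ∈ D.verts, ∀ c : Fin s,
    (0 < D.inDeg x → 1 ≤ (F c x).1) ∧ (0 < D.outDeg x → 1 ≤ (F c x).2)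

/-- `C` is a directed cycle: connected, and every vertex has in- and out-degree one. -/
def IsDirectedCycle (C : Digraph') : Prop :=
  C.Connected ∧ ∀ v ∈ C.verts, C.inDeg v = 1 ∧ C.outDeg v = 1

/-- `D` is acyclic: it contains no directed cycle. -/
def AcyclicD (D : Digraph') : Prop :=
  ¬ ∃ C : Digraph', C.IsSubdigraph D ∧ C.IsDirectedCycle

/-- `α` is a `k`-dicolouring of `D`: every colour class induces an acyclic subdigraph. -/
def IsKDicolouring (D : Digraph') (k : ℕ) (α : ℕ → Fin k) : Prop :=
  ∀ i : Fin k, AcyclicD (D.induce (D.verts.filter fun v => α v = i))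

/-- The dichromatic number of `D`. -/
noncomputable def dichromatic (D : Digraph') : ℕ :=
  sInf {k : ℕ | ∃ α : ℕ → Fin k, D.IsKDicolouring k α}

end Digraph'

open Digraph'

namespace Dicolouring

/-- `t true u v` and `t false u v` are the multiplicities in a digraph of the arcs `uv` and `vu`. -/
structure ArcWeight (t : Bool → ℕ → ℕ → ℕ) : Prop where
  le_one : ∀ e u v, t e u v ≤ 1
  flip : ∀ e u v, t (!e) v u = t e u v
  irrefl : ∀ e v, t e v v = 0

/-- Adjacency in the underlying graph. -/
def Adj (t : Bool → ℕ → ℕ → ℕ) (u v : ℕ) : Prop := ∃ e, t e u v ≠ 0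

/-- In-degree (`e = true`) or out-degree (`e = false`) of `v` towards the set `S`. -/
def deg (t : Bool → ℕ → ℕ → ℕ) (S : Finset ℕ) (e : Bool) (v : ℕ) : ℕ := ∑ u ∈ S, t e u v

/-- `S` induces a subgraph without a nontrivial partition into two nonadjacent parts. -/
def Conn (t : Bool → ℕ → ℕ → ℕ) (S : Finset ℕ) : Prop :=
  ∀ T ⊆ S, T.Nonempty → T ≠ S → ∃ u ∈ T, ∃ v ∈ S, v ∉ T ∧ Adj t u v

/-- `S` induces a biconnected subgraph. -/
def Bicon (t : Bool → ℕ → ℕ → ℕ) (S : Finset ℕ) : Prop :=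
  2 ≤ S.card ∧ Conn t S ∧ ∀ x ∈ S, Conn t (S.erase x)

/-- Every nonempty subset of `S` has a vertex of small in- or out-degree. -/
def Bideg (t : Bool → ℕ → ℕ → ℕ) (S : Finset ℕ) (f : Bool → ℕ → ℕ) : Prop :=
  ∀ T ⊆ S, T.Nonempty → ∃ v ∈ T, ∃ e, deg t T e v < f e v

/-- `α` is a dicolouring of the subdigraph induced by `S`. -/
def Col {ι : Type} (t : Bool → ℕ → ℕ → ℕ) (S : Finset ℕ) (F : ι → Bool → ℕ → ℕ)
    (α : ℕ → ι) : Prop :=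
  ∀ i, ∀ T ⊆ S, T.Nonempty → (∀ v ∈ T, α v = i) → ∃ v ∈ T, ∃ e, deg t T e v < F i e v

/-- A valid pair that is not dicolourable. -/
structure Bad {ι : Type} [Fintype ι] (t : Bool → ℕ → ℕ → ℕ) (S : Finset ℕ)
    (F : ι → Bool → ℕ → ℕ) : Prop where
  conn : Conn t S
  valid : ∀ v ∈ S, ∀ e, deg t S e v ≤ ∑ k, F k e v
  not_col : ∀ α, ¬ Col t S F α

variable {t : Bool → ℕ → ℕ → ℕ} {S T : Finset ℕ} {x v : ℕ} {e : Bool}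
variable {ι : Type} {F : ι → Bool → ℕ → ℕ}

theorem ArcWeight.adj_symm (ht : ArcWeight t) {u v : ℕ} (h : Adj t u v) : Adj t v u := by
  obtain ⟨e, he⟩ := h
  exact ⟨!e, by rwa [ht.flip]⟩

theorem ArcWeight.ne_of_adj (ht : ArcWeight t) {u v : ℕ} (h : Adj t u v) : u ≠ v := by
  rintro rfl
  obtain ⟨e, he⟩ := h
  exact he (ht.irrefl e u)

theorem ArcWeight.eq_one (ht : ArcWeight t) {e : Bool} {u v : ℕ} (h : t e u v ≠ 0) :
    t e u v = 1 := by
  have := ht.le_one e u v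
  omega

theorem deg_mono (h : T ⊆ S) (e : Bool) (v : ℕ) : deg t T e v ≤ deg t S e v :=
  Finset.sum_le_sum_of_subset h

theorem deg_insert (h : x ∉ S) (e : Bool) (v : ℕ) :
    deg t (insert x S) e v = t e x v + deg t S e v :=
  Finset.sum_insert h

theorem deg_erase_add (h : x ∈ S) (e : Bool) (v : ℕ) :
    deg t (S.erase x) e v + t e x v = deg t S e v :=
  Finset.sum_erase_add _ _ h

theorem ArcWeight.deg_erase_self (ht : ArcWeight t) (S : Finset ℕ) (e : Bool) (v : ℕ) :
    deg t (S.erase v) e v = deg t S e v :=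
  Finset.sum_erase _ (ht.irrefl e v)

theorem deg_lt_of_adj {u w : ℕ} (h : T ⊆ S) (hu : u ∈ S) (huT : u ∉ T) (he : t e u w ≠ 0) :
    deg t T e w < deg t S e w := by
  have h1 : insert u T ⊆ S := Finset.insert_subset hu h
  have h2 := deg_mono (t := t) h1 e w
  rw [deg_insert huT] at h2
  omega

theorem deg_union_of_disjoint {L M : Finset ℕ} (h : Disjoint L M) (e : Bool) (v : ℕ) :
    deg t (L ∪ M) e v = deg t L e v + deg t M e v :=
  Finset.sum_union h

theorem deg_eq_zero (h : ∀ u ∈ S, ¬ Adj t u v) (e : Bool) : deg t S e v = 0 :=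
  Finset.sum_eq_zero fun u hu => by
    by_contra h0
    exact h u hu ⟨e, h0⟩

theorem deg_class_sum [Fintype ι] [DecidableEq ι] (S : Finset ℕ) (α : ℕ → ι) (e : Bool) (v : ℕ) :
    ∑ k, deg t (S.filter fun u => α u = k) e v = deg t S e v := by
  unfold deg
  exact Finset.sum_fiberwise S α fun u => t e u v

theorem Col.subset (h : T ⊆ S) {α : ℕ → ι} (hα : Col t S F α) : Col t T F α :=
  fun i U hU => hα i U (hU.trans h)

/-- A dicolouring extends to a vertex `x` whenever some colour is still available at `x`. -/
theorem Col.insert [DecidableEq ι] (ht : ArcWeight t) {α : ℕ → ι} (hα : Col t S F α) {k : ι}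
    (h : deg t (S.filter fun u => α u = k) e x < F k e x) :
    Col t (insert x S) F (Function.update α x k) := by
  intro i U hU hne hc
  by_cases hxU : x ∈ U
  · have hi : k = i := by simpa using hc x hxU
    subst hi
    refine ⟨x, hxU, e, lt_of_le_of_lt ?_ h⟩
    rw [← ht.deg_erase_self]
    refine deg_mono ?_ e x
    intro u hu
    obtain ⟨hux, huU⟩ := Finset.mem_erase.1 hu
    have := hc u huU
    rw [Function.update_of_ne hux] at this
    exact Finset.mem_filter.2 ⟨(Finset.mem_insert.1 (hU huU)).resolve_left hux, this⟩
  · have hne' : ∀ u ∈ U, u ≠ x := fun u hu h => hxU (h ▸ hu)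
    refine hα i U (fun u hu => (Finset.mem_insert.1 (hU hu)).resolve_left (hne' u hu)) hne ?_
    intro u hu
    rw [← hc u hu, Function.update_of_ne (hne' u hu)]

section Reduction

variable [Fintype ι] [DecidableEq ι]

/-- Greedy colouring with the colours in `I`. -/
theorem exists_col_of_bideg (ht : ArcWeight t) (i₀ : ι) (I : Finset ι) (S : Finset ℕ)
    (h : Bideg t S fun e v => ∑ k ∈ I, F k e v) :
    ∃ α : ℕ → ι, (∀ v ∈ S, α v ∈ I) ∧ Col t S F α := by
  induction hn : S.card generalizing S with
  | zero =>
    obtain rfl := Finset.card_eq_zero.1 hn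
    refine ⟨fun _ => i₀, by simp, fun i U hU hne => ?_⟩
    obtain ⟨u, hu⟩ := hne
    exact absurd (hU hu) (by simp)
  | succ n ih =>
    have hS : S.Nonempty := Finset.card_pos.1 (by omega)
    obtain ⟨v, hv, e, he⟩ := h S subset_rfl hS
    obtain ⟨α, hαI, hα⟩ := ih (S.erase v) (fun U hU => h U (hU.trans (Finset.erase_subset _ _)))
      (by rw [Finset.card_erase_of_mem hv]; omega)
    have hk : ∃ k ∈ I, deg t ((S.erase v).filter fun u => α u = k) e v < F k e v := by
      by_contra! hcon
      have h1 := Finset.sum_le_sum hcon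
      have h2 : ∑ k ∈ I, deg t ((S.erase v).filter fun u => α u = k) e v ≤
          ∑ k, deg t ((S.erase v).filter fun u => α u = k) e v :=
        Finset.sum_le_sum_of_subset (Finset.subset_univ I)
      rw [deg_class_sum, ht.deg_erase_self] at h2
      simp only at he
      omega
    obtain ⟨k, hkI, hk⟩ := hk
    refine ⟨Function.update α v k, fun u hu => ?_, ?_⟩
    · by_cases huv : u = v
      · subst huv; simpa using hkI
      · rw [Function.update_of_ne huv]
        exact hαI u (Finset.mem_erase.2 ⟨huv, hu⟩)
    · have := hα.insert ht hk
      rwa [Finset.insert_erase hv] at this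

theorem exists_low_of_ssubset (ht : ArcWeight t) (hS : Conn t S) {f : Bool → ℕ → ℕ}
    (hval : ∀ v ∈ S, ∀ e, deg t S e v ≤ f e v) (hTS : T ⊆ S) (hne : T.Nonempty) (h : T ≠ S) :
    ∃ v ∈ T, ∃ e, deg t T e v < f e v := by
  obtain ⟨u, hu, w, hw, hwT, huw⟩ := hS T hTS hne h
  obtain ⟨e, he⟩ := ht.adj_symm huw
  exact ⟨u, hu, e, (deg_lt_of_adj hTS hw hwT he).trans_le (hval u (hTS hu) e)⟩

/-- Uncolourable valid pairs are tight. -/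
theorem Bad.tight [Nonempty ι] (ht : ArcWeight t) (h : Bad t S F) (hv : v ∈ S) (e : Bool) :
    ∑ k, F k e v = deg t S e v := by
  by_contra hne
  have hlt := lt_of_le_of_ne (h.valid v hv e) (Ne.symm hne)
  obtain ⟨α, -, hα⟩ := exists_col_of_bideg (F := F) ht (Classical.arbitrary ι) Finset.univ S (by
    intro U hU hUne
    by_cases hUS : U = S
    · subst hUS
      exact ⟨v, hv, e, hlt⟩
    · exact exists_low_of_ssubset ht h.conn h.valid hU hUne hUS)
  exact h.not_col α hα

theorem Bad.exists_col_of_notMem [Nonempty ι] (ht : ArcWeight t) (h : Bad t S F) (hTS : T ⊆ S)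
    (hx : x ∈ S) (hxT : x ∉ T) : ∃ α, Col t T F α := by
  obtain ⟨α, -, hα⟩ := exists_col_of_bideg (F := F) ht (Classical.arbitrary ι) Finset.univ T (by
    intro U hU hUne
    exact exists_low_of_ssubset ht h.conn h.valid (hU.trans hTS) hUne
      fun hUS => hxT (hU (hUS ▸ hx)))
  exact ⟨α, hα⟩

/-- In a dicolouring of all vertices but `x`, every colour is saturated at `x`. -/
theorem Bad.deg_class_eq (ht : ArcWeight t) (h : Bad t S F) (hx : x ∈ S)
    {α : ℕ → ι} (hα : Col t (S.erase x) F α) (k : ι) (e : Bool) :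
    deg t ((S.erase x).filter fun u => α u = k) e x = F k e x := by
  have hle : ∀ k ∈ Finset.univ,
      F k e x ≤ deg t ((S.erase x).filter fun u => α u = k) e x := by
    intro k _
    by_contra! hlt
    have := hα.insert ht hlt
    rw [Finset.insert_erase hx] at this
    exact h.not_col _ this
  have hsum : ∑ k, F k e x = ∑ k, deg t ((S.erase x).filter fun u => α u = k) e x := by
    refine le_antisymm (Finset.sum_le_sum hle) ?_
    rw [deg_class_sum, ht.deg_erase_self]
    exact h.valid x hx e
  exact ((Finset.sum_eq_sum_iff_of_le hle).1 hsum k (Finset.mem_univ k)).symm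

/-- The budgets left after giving colour `c` to the vertex `x`. -/
def reduceAt (t : Bool → ℕ → ℕ → ℕ) (F : ι → Bool → ℕ → ℕ) (x : ℕ) (c : ι) :
    ι → Bool → ℕ → ℕ :=
  fun k e v => if k = c then F k e v - t e x v else F k e v

theorem sum_reduceAt (F : ι → Bool → ℕ → ℕ) (x : ℕ) (c : ι) (e : Bool) (v : ℕ) :
    ∑ k, reduceAt t F x c k e v + F c e v = ∑ k, F k e v + (F c e v - t e x v) := by
  have h1 := Finset.add_sum_erase Finset.univ (fun k => F k e v) (Finset.mem_univ c)
  have h2 := Finset.add_sum_erase Finset.univ (fun k => reduceAt t F x c k e v)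
    (Finset.mem_univ c)
  have h3 : ∑ k ∈ Finset.univ.erase c, reduceAt t F x c k e v =
      ∑ k ∈ Finset.univ.erase c, F k e v :=
    Finset.sum_congr rfl fun k hk => by simp [reduceAt, Finset.ne_of_mem_erase hk]
  have h4 : reduceAt t F x c c e v = F c e v - t e x v := by simp [reduceAt]
  omega

theorem Bad.reduceAt (ht : ArcWeight t) (h : Bad t S F) (hx : x ∈ S)
    (hconn : Conn t (S.erase x)) {c : ι} (hc : ∃ e, F c e x ≠ 0) :
    Bad t (S.erase x) (reduceAt t F x c) := by
  refine ⟨hconn, ?_, ?_⟩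
  · intro v hv e
    have h1 := h.valid v (Finset.mem_of_mem_erase hv) e
    have h2 := deg_erase_add (t := t) hx e v
    have h3 := sum_reduceAt (t := t) F x c e v
    omega
  · intro α hα
    refine h.not_col (Function.update α x c) ?_
    intro i U hU hne hcol
    by_cases hU0 : (U.erase x).Nonempty
    · obtain ⟨v, hv, e, he⟩ := hα i (U.erase x) (Finset.erase_subset_erase x hU) hU0 (by
        intro u hu
        obtain ⟨hux, huU⟩ := Finset.mem_erase.1 hu
        rw [← hcol u huU, Function.update_of_ne hux])
      refine ⟨v, Finset.mem_of_mem_erase hv, e, ?_⟩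
      by_cases hxU : x ∈ U
      · have hi : c = i := by simpa using hcol x hxU
        subst hi
        have h2 := deg_erase_add (t := t) hxU e v
        simp only [Dicolouring.reduceAt, if_true] at he
        omega
      · rw [Finset.erase_eq_of_notMem hxU] at he
        refine he.trans_le ?_
        unfold Dicolouring.reduceAt
        split_ifs <;> omega
    · rw [Finset.not_nonempty_iff_eq_empty, Finset.erase_eq_empty_iff] at hU0
      rcases hU0 with rfl | rfl
      · simp at hne
      · have hi : c = i := by simpa using hcol x (by simp)
        subst hi
        obtain ⟨e, he⟩ := hc
        exact ⟨x, by simp, e, by simp [deg, ht.irrefl]; omega⟩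

theorem Bad.le_of_reduceAt (ht : ArcWeight t) (h : Bad t S F) (hx : x ∈ S)
    (hconn : Conn t (S.erase x)) {c : ι} (hc : ∃ e, F c e x ≠ 0) (hv : v ∈ S) (e : Bool) :
    t e x v ≤ F c e v := by
  have : Nonempty ι := ⟨c⟩
  by_cases hvx : v = x
  · subst hvx; simp [ht.irrefl]
  have h1 := (h.reduceAt ht hx hconn hc).tight ht (Finset.mem_erase.2 ⟨hvx, hv⟩) e
  have h2 := h.tight ht hv e
  have h3 := deg_erase_add (t := t) hx e v
  have h4 := sum_reduceAt (t := t) F x c e v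
  omega

end Reduction

/-- `b` separates `M` from the nonempty rest of `G`. -/
structure Sep (t : Bool → ℕ → ℕ → ℕ) (G : Finset ℕ) (b : ℕ) (M : Finset ℕ) : Prop where
  mem : b ∈ G
  sub : M ⊆ G
  notMem : b ∉ M
  nonempty : M.Nonempty
  rest : ∃ w ∈ G, w ≠ b ∧ w ∉ M
  not_adj : ∀ u ∈ M, ∀ w ∈ G, w ≠ b → w ∉ M → ¬ Adj t u w

theorem Sep.compl (ht : ArcWeight t) {G M : Finset ℕ} {b : ℕ} (h : Sep t G b M) :
    Sep t G b ((G.erase b) \ M) := by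
  obtain ⟨u, hu⟩ := h.nonempty
  obtain ⟨w, hw, hwb, hwM⟩ := h.rest
  refine ⟨h.mem, fun y hy => ?_, by simp, ⟨w, by simp [*]⟩,
    ⟨u, h.sub hu, fun hub => h.notMem (hub ▸ hu), by simp [hu]⟩, ?_⟩
  · exact Finset.mem_of_mem_erase (Finset.mem_sdiff.1 hy).1
  · intro y hy z hz hzb hzM hyz
    simp only [Finset.mem_sdiff, Finset.mem_erase] at hy hzM
    exact h.not_adj z (by tauto) y hy.1.2 hy.1.1 hy.2 (ht.adj_symm hyz)

theorem exists_sep_of_not_conn {G : Finset ℕ} {b : ℕ} (hb : b ∈ G)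
    (h : ¬ Conn t (G.erase b)) : ∃ M, Sep t G b M := by
  unfold Conn at h
  push Not at h
  obtain ⟨M, hM, hne, hneq, hadj⟩ := h
  refine ⟨M, hb, hM.trans (Finset.erase_subset _ _), fun h => by simpa using hM h, hne, ?_,
    fun u hu w hw hwb hwM => hadj u hu w (by simp [*]) hwM⟩
  by_contra! hcon
  refine hneq (Finset.Subset.antisymm hM fun w hw => ?_)
  exact hcon w (Finset.mem_of_mem_erase hw) (Finset.ne_of_mem_erase hw)

theorem exists_sep_of_not_bicon {G : Finset ℕ} (hconn : Conn t G) (hcard : 2 ≤ G.card)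
    (h : ¬ Bicon t G) : ∃ b M, Sep t G b M := by
  have : ∃ b ∈ G, ¬ Conn t (G.erase b) := by
    by_contra! hcon
    exact h ⟨hcard, hconn, hcon⟩
  obtain ⟨b, hb, hnc⟩ := this
  exact ⟨b, exists_sep_of_not_conn hb hnc⟩

theorem Sep.conn_insert (ht : ArcWeight t) {G M : Finset ℕ} {b : ℕ} (hG : Conn t G)
    (h : Sep t G b M) : Conn t (insert b M) := by
  have key : ∀ U ⊆ M, U.Nonempty → ∃ u ∈ U, ∃ w ∈ insert b M, w ∉ U ∧ Adj t u w := by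
    intro U hU hne
    obtain ⟨u, hu, w, hw, hwU, huw⟩ := hG U (hU.trans h.sub) hne
      (fun hUG => h.notMem (hU (hUG ▸ h.mem)))
    refine ⟨u, hu, w, ?_, hwU, huw⟩
    by_contra hcon
    simp only [Finset.mem_insert, not_or] at hcon
    exact h.not_adj u (hU hu) w hw hcon.1 hcon.2 huw
  intro U hU hne hneq
  by_cases hbU : b ∈ U
  · obtain ⟨u, hu, w, hw, hwU, huw⟩ := key (M \ U) Finset.sdiff_subset (by
      rw [Finset.sdiff_nonempty]
      intro hMU
      exact hneq (Finset.Subset.antisymm hU (Finset.insert_subset hbU hMU)))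
    rw [Finset.mem_sdiff] at hu
    refine ⟨w, ?_, u, Finset.mem_insert_of_mem hu.1, hu.2, ht.adj_symm huw⟩
    simp only [Finset.mem_insert, Finset.mem_sdiff, not_and, not_not] at hw hwU
    rcases hw with rfl | hw
    · exact hbU
    · exact hwU hw
  · exact key U (fun u hu => (Finset.mem_insert.1 (hU hu)).resolve_left
      fun h => hbU (h ▸ hu)) hne

/-- Every side of a separation contains an end-block minus its cut-vertex. -/
theorem Sep.exists_leaf (ht : ArcWeight t) {G M : Finset ℕ} {b : ℕ} (hG : Conn t G)
    (h : Sep t G b M) : ∃ b' L, L ⊆ M ∧ Sep t G b' L ∧ Bicon t (insert b' L) := by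
  induction hn : M.card using Nat.strong_induction_on generalizing M b with
  | _ n ih =>
    by_cases hbi : Bicon t (insert b M)
    · exact ⟨b, M, subset_rfl, h, hbi⟩
    have hcard : 2 ≤ (insert b M).card := by
      rw [Finset.card_insert_of_notMem h.notMem]
      have := Finset.card_pos.2 h.nonempty
      omega
    obtain ⟨y, N, hN⟩ := exists_sep_of_not_bicon (h.conn_insert ht hG) hcard hbi
    have hex : ∃ N', Sep t (insert b M) y N' ∧ b ∉ N' := by
      by_cases hbN : b ∈ N
      · exact ⟨_, hN.compl ht, by simp [hbN]⟩
      · exact ⟨N, hN, hbN⟩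
    obtain ⟨N', hN', hbN'⟩ := hex
    have hN'M : N' ⊆ M := fun u hu =>
      (Finset.mem_insert.1 (hN'.sub hu)).resolve_left fun h => hbN' (h ▸ hu)
    have hyG : y ∈ G := Finset.insert_subset h.mem h.sub hN'.mem
    have hproper : N' ⊂ M := by
      refine Finset.ssubset_iff_subset_ne.2 ⟨hN'M, ?_⟩
      rintro rfl
      obtain ⟨w, hw, hwy, hwN⟩ := hN'.rest
      rcases Finset.mem_insert.1 hN'.mem with rfl | hy
      · exact (Finset.mem_insert.1 hw).elim hwy hwN
      · exact hN'.notMem hy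
    have hsep : Sep t G y N' := by
      obtain ⟨w, hw, hwb, hwM⟩ := h.rest
      refine ⟨hyG, hN'M.trans h.sub, hN'.notMem, hN'.nonempty,
        ⟨w, hw, ?_, fun h => hwM (hN'M h)⟩, ?_⟩
      · rintro rfl
        exact (Finset.mem_insert.1 hN'.mem).elim hwb hwM
      · intro u hu z hz hzy hzN
        by_cases hzM : z ∈ insert b M
        · exact hN'.not_adj u hu z hzM hzy hzN
        · simp only [Finset.mem_insert, not_or] at hzM
          exact h.not_adj u (hN'M hu) z hz hzM.1 hzM.2
    obtain ⟨b', L, hLN, hL⟩ := ih N'.card (hn ▸ Finset.card_lt_card hproper) hsep rfl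
    exact ⟨b', L, hLN.trans hN'M, hL⟩

/-- Replace the budgets at the vertex `b` by `N`. -/
def setAt (F : ι → Bool → ℕ → ℕ) (b : ℕ) (N : ι → Bool → ℕ) : ι → Bool → ℕ → ℕ :=
  fun k e v => if v = b then N k e else F k e v

section Join

variable [Fintype ι] [DecidableEq ι]

/-- One side of the splitting of an uncolourable pair at a cut-vertex. -/
theorem Bad.side (ht : ArcWeight t) (h : Bad t S F) {b : ℕ} {M : Finset ℕ}
    (hs : Sep t S b M) {N : ι → Bool → ℕ} {β : ℕ → ι}
    (hβ : Col t ((S.erase b) \ M) F β)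
    (hN : ∀ k e, N k e + deg t (((S.erase b) \ M).filter fun u => β u = k) e b = F k e b) :
    Bad t (insert b M) (setAt F b N) := by
  have hdisj : Disjoint (insert b M) ((S.erase b) \ M) := by
    rw [Finset.disjoint_left]
    intro u hu hu'
    simp only [Finset.mem_sdiff, Finset.mem_erase, Finset.mem_insert] at hu hu'
    tauto
  have hunion : insert b M ∪ ((S.erase b) \ M) = S := by
    ext u
    simp only [Finset.mem_sdiff, Finset.mem_erase, Finset.mem_insert, Finset.mem_union]
    have h1 := @hs.sub u
    have h2 := hs.mem
    constructor
    · rintro ((rfl | h) | h) <;> tauto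
    · tauto
  have hdeg : ∀ e v, deg t S e v =
      deg t (insert b M) e v + deg t ((S.erase b) \ M) e v := by
    intro e v
    rw [← deg_union_of_disjoint hdisj, hunion]
  have hbM : ∀ v ∈ M, v ≠ b := fun v hv hvb => hs.notMem (hvb ▸ hv)
  refine ⟨hs.conn_insert ht h.conn, ?_, ?_⟩
  · intro v hv e
    rcases Finset.mem_insert.1 hv with rfl | hv
    · have h1 := h.valid v hs.mem e
      have h2 : ∑ k, F k e v = ∑ k, N k e +
          ∑ k, deg t (((S.erase v) \ M).filter fun u => β u = k) e v := by
        rw [← Finset.sum_add_distrib]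
        exact Finset.sum_congr rfl fun k _ => (hN k e).symm
      rw [deg_class_sum] at h2
      have h3 := hdeg e v
      simp only [setAt, if_true]
      omega
    · have h1 := h.valid v (hs.sub hv) e
      simp only [setAt, hbM v hv, if_false]
      exact (deg_mono (Finset.insert_subset hs.mem hs.sub) e v).trans h1
  · intro α hα
    refine h.not_col (fun v => if v ∈ insert b M then α v else β v) ?_
    intro i U hU hne hcol
    beta_reduce at hcol
    by_cases hne1 : (U ∩ insert b M).Nonempty
    · obtain ⟨v, hv, e, he⟩ := hα i (U ∩ insert b M) Finset.inter_subset_right hne1 (by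
        intro u hu
        rw [Finset.mem_inter] at hu
        have := hcol u hu.1
        rwa [if_pos hu.2] at this)
      rw [Finset.mem_inter] at hv
      refine ⟨v, hv.1, e, ?_⟩
      have hsplit : deg t U e v =
          deg t (U ∩ insert b M) e v + deg t (U \ insert b M) e v := by
        rw [← deg_union_of_disjoint (Finset.disjoint_sdiff_inter _ _).symm,
          Finset.union_comm, Finset.sdiff_union_inter]
      rw [hsplit]
      rcases Finset.mem_insert.1 hv.2 with rfl | hvM
      · simp only [setAt, if_true] at he
        have : deg t (U \ insert v M) e v ≤
            deg t (((S.erase v) \ M).filter fun u => β u = i) e v := by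
          refine deg_mono ?_ e v
          intro u hu
          rw [Finset.mem_sdiff] at hu
          have hc := hcol u hu.1
          rw [if_neg hu.2] at hc
          simp only [Finset.mem_insert, not_or] at hu
          simp only [Finset.mem_filter, Finset.mem_sdiff, Finset.mem_erase]
          exact ⟨⟨⟨hu.2.1, hU hu.1⟩, hu.2.2⟩, hc⟩
        have := hN i e
        omega
      · simp only [setAt, hbM v hvM, if_false] at he
        rw [deg_eq_zero (S := U \ insert b M)]
        · simpa using he
        · intro u hu huv
          simp only [Finset.mem_sdiff, Finset.mem_insert, not_or] at hu
          exact hs.not_adj v hvM u (hU hu.1) hu.2.1 hu.2.2 (ht.adj_symm huv)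
    · rw [Finset.not_nonempty_iff_eq_empty] at hne1
      have hnot : ∀ u ∈ U, u ∉ insert b M := fun u hu hu' => by
        have : u ∈ U ∩ insert b M := Finset.mem_inter.2 ⟨hu, hu'⟩
        simp [hne1] at this
      refine hβ i U (fun u hu => ?_) hne fun u hu => ?_
      · have := hnot u hu
        simp only [Finset.mem_insert, not_or] at this
        simp [this, hU hu]
      · have := hcol u hu
        rwa [if_neg (hnot u hu)] at this

/-- An uncolourable pair splits at a cut-vertex into two uncolourable pairs. -/
theorem Bad.split [Nonempty ι] (ht : ArcWeight t) (h : Bad t S F) {b : ℕ} {M : Finset ℕ}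
    (hs : Sep t S b M) :
    ∃ N N' : ι → Bool → ℕ, (∀ k e, N k e + N' k e = F k e b) ∧
      Bad t (insert b M) (setAt F b N) ∧
      Bad t (insert b ((S.erase b) \ M)) (setAt F b N') := by
  obtain ⟨α, hα⟩ := h.exists_col_of_notMem ht (T := S.erase b) (Finset.erase_subset _ _)
    hs.mem (Finset.notMem_erase b S)
  have hMS : M ⊆ S.erase b := fun u hu =>
    Finset.mem_erase.2 ⟨fun hub => hs.notMem (hub ▸ hu), hs.sub hu⟩
  have hsum : ∀ k e, deg t (M.filter fun u => α u = k) e b +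
      deg t (((S.erase b) \ M).filter fun u => α u = k) e b = F k e b := by
    intro k e
    rw [← h.deg_class_eq ht hs.mem hα k e, ← deg_union_of_disjoint
      (Finset.disjoint_filter_filter Finset.disjoint_sdiff), ← Finset.filter_union,
      Finset.union_sdiff_of_subset hMS]
  have hcc : (S.erase b) \ ((S.erase b) \ M) = M := by
    rw [Finset.sdiff_sdiff_eq_self hMS]
  refine ⟨fun k e => deg t (M.filter fun u => α u = k) e b,
    fun k e => deg t (((S.erase b) \ M).filter fun u => α u = k) e b, hsum, ?_, ?_⟩
  · exact h.side ht hs (hα.subset Finset.sdiff_subset) hsum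
  · refine h.side ht (hs.compl ht) (β := α) ?_ ?_
    · rw [hcc]
      exact hα.subset hMS
    · rw [hcc]
      intro k e
      rw [add_comm]
      exact hsum k e

end Join

/-- All arcs inside `P` lie in digons. -/
def Bidir (t : Bool → ℕ → ℕ → ℕ) (P : Finset ℕ) : Prop :=
  ∀ u ∈ P, ∀ v ∈ P, ∀ e, t e u v = t (!e) u v

/-- Only one of two colours has a nonzero budget. -/
def Mono (P : Finset ℕ) (F : Bool → Bool → ℕ → ℕ) : Prop :=
  ∃ i, ∀ v ∈ P, ∀ e, F (!i) e v = 0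

/-- Constant symmetric positive budgets on a bidirected digraph. -/
def Regular (t : Bool → ℕ → ℕ → ℕ) (P : Finset ℕ) (F : Bool → Bool → ℕ → ℕ) : Prop :=
  Bidir t P ∧ ∃ p : Bool → ℕ, (∀ i, p i ≠ 0) ∧ ∀ v ∈ P, ∀ i e, F i e v = p i

/-- The classification to be proved by induction, for digraphs with fewer than `n` vertices. -/
def ClassifiedBelow (t : Bool → ℕ → ℕ → ℕ) (n : ℕ) : Prop :=
  ∀ (P : Finset ℕ) (F : Bool → Bool → ℕ → ℕ), P.card < n → Bicon t P → Bad t P F →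
    Mono P F ∨ Regular t P F

/-- `P` is an end-block of `G`, or `G` itself, and `L` consists of its vertices that are not
cut-vertices; uncolourable pairs on `G` restrict to uncolourable pairs on `P`. -/
structure Leaf (t : Bool → ℕ → ℕ → ℕ) (G L P : Finset ℕ) : Prop where
  sub : P ⊆ G
  sub' : L ⊆ P
  bicon : Bicon t P
  restrict : ∀ F : Bool → Bool → ℕ → ℕ, Bad t G F →
    ∃ F' : Bool → Bool → ℕ → ℕ, (∀ v ∈ L, ∀ i e, F' i e v = F i e v) ∧ Bad t P F'

theorem Leaf.of_bicon {G : Finset ℕ} (h : Bicon t G) : Leaf t G G G :=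
  ⟨subset_rfl, subset_rfl, h, fun F hF => ⟨F, fun _ _ _ _ => rfl, hF⟩⟩

theorem Leaf.of_sep (ht : ArcWeight t) {G L : Finset ℕ} {b : ℕ} (hs : Sep t G b L)
    (h : Bicon t (insert b L)) : Leaf t G L (insert b L) := by
  refine ⟨Finset.insert_subset hs.mem hs.sub, Finset.subset_insert _ _, h, fun F hF => ?_⟩
  obtain ⟨N, -, -, hN, -⟩ := hF.split ht hs
  refine ⟨_, fun v hv i e => ?_, hN⟩
  have : v ≠ b := fun hvb => hs.notMem (hvb ▸ hv)
  simp [setAt, this]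

/-- An uncolourable pair with two colours on a biconnected digraph, in which both colours are
available everywhere. -/
structure Rich (t : Bool → ℕ → ℕ → ℕ) (S : Finset ℕ) (F : Bool → Bool → ℕ → ℕ) : Prop where
  bicon : Bicon t S
  bad : Bad t S F
  pos : ∀ i, ∀ v ∈ S, ∃ e, F i e v ≠ 0
  le : ∀ i e, ∀ u ∈ S, ∀ v ∈ S, t e u v ≤ F i e v

section TwoColours

variable {F : Bool → Bool → ℕ → ℕ}

theorem Rich.of_not_mono (ht : ArcWeight t) (hS : Bicon t S) (h : Bad t S F)
    (hm : ¬ Mono S F) : Rich t S F := by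
  have key : ∀ i e, ∀ u ∈ S, (∃ e, F i e u ≠ 0) → ∀ v ∈ S, t e u v ≤ F i e v :=
    fun i e u hu hpos v hv => h.le_of_reduceAt ht hu (hS.2.2 u hu) hpos hv e
  have hpos : ∀ i, ∀ v ∈ S, ∃ e, F i e v ≠ 0 := by
    intro i
    by_contra! hcon
    obtain ⟨w, hw, hw0⟩ := hcon
    have hne : (S.filter fun v => ∃ e, F i e v ≠ 0).Nonempty := by
      by_contra hemp
      rw [Finset.not_nonempty_iff_eq_empty, Finset.filter_eq_empty_iff] at hemp
      refine hm ⟨!i, fun v hv e => ?_⟩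
      have := hemp hv
      push Not at this
      simpa using this e
    obtain ⟨u, hu, v, hv, hvT, e, he⟩ := hS.2.1 _ (Finset.filter_subset _ _) hne (by
      intro heq
      rw [← heq, Finset.mem_filter] at hw
      obtain ⟨e, he⟩ := hw.2
      exact he (hw0 e))
    rw [Finset.mem_filter] at hu
    have := key i e u hu.1 hu.2 v hv
    refine hvT (Finset.mem_filter.2 ⟨hv, e, ?_⟩)
    omega
  exact ⟨hS, h, hpos, fun i e u hu v hv => key i e u hu (hpos i u hu) v hv⟩

theorem Rich.tight (ht : ArcWeight t) (h : Rich t S F) (hv : v ∈ S) (i e : Bool) :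
    F i e v + F (!i) e v = deg t S e v := by
  have := h.bad.tight ht hv e
  rw [Fintype.sum_bool] at this
  cases i <;> simp only [Bool.not_true, Bool.not_false] <;> omega

theorem Rich.three_le_card (ht : ArcWeight t) (h : Rich t S F) : 3 ≤ S.card := by
  by_contra hlt
  have hcard : S.card = 2 := by have := h.bicon.1; omega
  obtain ⟨a, b, hab, rfl⟩ := Finset.card_eq_two.1 hcard
  have ha : a ∈ ({a, b} : Finset ℕ) := by simp
  obtain ⟨e, he⟩ := h.pos true a ha
  have h1 := h.tight ht ha true e
  have h2 : deg t {a, b} e a = t e b a := by simp [deg, Finset.sum_pair hab, ht.irrefl]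
  have h3 := h.le true e b (by simp) a ha
  have h4 := h.le false e b (by simp) a ha
  have h5 := ht.le_one e b a
  simp only [Bool.not_true] at h1
  omega

/-- The two possible structures around a leaf of `S.erase x`. -/
theorem Rich.leaf_cases (ht : ArcWeight t) (h : Rich t S F) (ih : ClassifiedBelow t S.card)
    (hx : x ∈ S) {L P : Finset ℕ} (hL : Leaf t (S.erase x) L P)
    (hadj : ∃ v ∈ L, Adj t x v) :
    (∀ v ∈ L, ∀ i e, F i e v = t e x v ∧ deg t P e v = t e x v) ∨
    (Bidir t P ∧ (∀ v ∈ L, ∀ e, t e x v = 1) ∧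
      ∃ p : Bool → ℕ, ∀ v ∈ L, ∀ i e, F i e v = p i) := by
  have hLS : L ⊆ S := (hL.sub'.trans hL.sub).trans (Finset.erase_subset _ _)
  have hcard : P.card < S.card :=
    (Finset.card_le_card hL.sub).trans_lt (Finset.card_erase_lt_of_mem hx)
  obtain ⟨v₀, hv₀, e₀, he₀⟩ := hadj
  have key : ∀ i, (∀ v ∈ L, ∀ e, F i e v = t e x v ∧ F (!i) e v = deg t P e v) ∨
      (Bidir t P ∧ ∃ p : Bool → ℕ, (∀ j, p j ≠ 0) ∧
        ∀ v ∈ L, ∀ e, F i e v = p i + t e x v ∧ F (!i) e v = p (!i)) := by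
    intro i
    obtain ⟨F', hF', hbad⟩ := hL.restrict _
      (h.bad.reduceAt ht hx (h.bicon.2.2 x hx) (h.pos i x hx))
    have h1 : ∀ v ∈ L, ∀ e, F' i e v + t e x v = F i e v := by
      intro v hv e
      have h2 := h.le i e x hx v (hLS hv)
      rw [hF' v hv]
      simp only [reduceAt, if_true]
      omega
    have h2 : ∀ v ∈ L, ∀ e, F' (!i) e v = F (!i) e v := by
      intro v hv e
      rw [hF' v hv]
      simp [reduceAt]
    rcases ih P F' hcard hL.bicon hbad with ⟨j, hj⟩ | ⟨hbi, p, hp, hF⟩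
    · left
      by_cases hij : j = i
      · subst hij
        obtain ⟨e, he⟩ := h.pos (!j) v₀ (hLS hv₀)
        rw [← h2 v₀ hv₀, hj v₀ (hL.sub' hv₀)] at he
        exact absurd rfl he
      · have hji : (!j) = i := by cases i <;> cases j <;> simp_all
        rw [hji] at hj
        intro v hv e
        have h3 := hbad.tight ht (hL.sub' hv) e
        rw [Fintype.sum_bool] at h3
        have h4 := hj v (hL.sub' hv) e
        have h5 := h1 v hv e
        have h6 := h2 v hv e
        refine ⟨by omega, ?_⟩
        cases i <;> simp only [Bool.not_true, Bool.not_false] at * <;> omega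
    · right
      refine ⟨hbi, p, hp, fun v hv e => ⟨?_, ?_⟩⟩
      · rw [← h1 v hv e, hF v (hL.sub' hv)]
      · rw [← h2 v hv e, hF v (hL.sub' hv)]
  have mixed : ∀ i, (∀ v ∈ L, ∀ e, F i e v = t e x v ∧ F (!i) e v = deg t P e v) →
      (Bidir t P ∧ ∃ p : Bool → ℕ, (∀ j, p j ≠ 0) ∧
        ∀ v ∈ L, ∀ e, F (!i) e v = p (!i) + t e x v ∧ F i e v = p i) →
      (Bidir t P ∧ (∀ v ∈ L, ∀ e, t e x v = 1) ∧
        ∃ p : Bool → ℕ, ∀ v ∈ L, ∀ i e, F i e v = p i) := by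
    rintro i h1 ⟨hbi, p, hp, h2⟩
    have ht1 : ∀ v ∈ L, ∀ e, t e x v = 1 := by
      intro v hv e
      have h3 := h1 v hv e
      have h4 := h2 v hv e
      exact ht.eq_one fun h0 => hp i (by omega)
    refine ⟨hbi, ht1, fun j => if j = i then p i else p (!i) + 1, fun v hv j e => ?_⟩
    have h4 := h2 v hv e
    have h5 := ht1 v hv e
    by_cases hij : j = i
    · subst hij
      simp only [if_true]
      omega
    · have hji : j = !i := by cases i <;> cases j <;> simp_all
      simp only [if_neg hij]
      subst hji
      omega
  rcases key true with h1 | ⟨hbi, p, hp, h1⟩ <;> rcases key false with h2 | ⟨hbi', q, hq, h2⟩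
  · left
    intro v hv i e
    have h3 := h1 v hv e
    have h4 := h2 v hv e
    cases i <;> simp only [Bool.not_true, Bool.not_false] at * <;> omega
  · right
    exact mixed true h1 ⟨hbi', q, hq, fun v hv e => h2 v hv e⟩
  · right
    exact mixed false h2 ⟨hbi, p, hp, fun v hv e => h1 v hv e⟩
  · right
    simp only [Bool.not_true, Bool.not_false] at h1 h2
    have hconst : ∀ v ∈ L, ∀ e, t e x v = 1 := by
      intro v hv e
      have h3 := h1 v hv e
      have h4 := h2 v hv e
      have h5 := h1 v₀ hv₀ e₀
      have h6 := h2 v₀ hv₀ e₀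
      exact ht.eq_one (by omega)
    refine ⟨hbi, hconst, fun i => if i then q true else p false, fun v hv i e => ?_⟩
    have h3 := h1 v hv e
    have h4 := h2 v hv e
    cases i
    · simpa using h3.2
    · simpa using h4.2

theorem Rich.adj_of_leaf (ht : ArcWeight t) (h : Rich t S F) (ih : ClassifiedBelow t S.card)
    (hx : x ∈ S) {L P : Finset ℕ} (hL : Leaf t (S.erase x) L P)
    (hadj : ∃ v ∈ L, Adj t x v) (hv : v ∈ L) : Adj t x v := by
  have hvS : v ∈ S := Finset.mem_of_mem_erase (hL.sub (hL.sub' hv))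
  rcases h.leaf_cases ht ih hx hL hadj with h1 | ⟨-, h1, -⟩
  · obtain ⟨e, he⟩ := h.pos true v hvS
    exact ⟨e, by rw [← (h1 v hv true e).1]; exact he⟩
  · exact ⟨true, by rw [h1 v hv]; exact one_ne_zero⟩

theorem Rich.exists_adj (h : Rich t S F) (hx : x ∈ S) :
    ∃ v ∈ S.erase x, Adj t x v := by
  obtain ⟨u, hu, w, hw, hwx, hadj⟩ := h.bicon.2.1 {x} (by simpa using hx) (by simp) (by
    intro heq
    have := h.bicon.1
    rw [← heq] at this
    simp at this)
  rw [Finset.mem_singleton] at hu hwx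
  subst hu
  exact ⟨w, Finset.mem_erase.2 ⟨hwx, hw⟩, hadj⟩

theorem Rich.adj_of_bicon_erase (ht : ArcWeight t) (h : Rich t S F)
    (ih : ClassifiedBelow t S.card) (hx : x ∈ S) (hbi : Bicon t (S.erase x)) (hv : v ∈ S)
    (hvx : v ≠ x) : Adj t x v :=
  h.adj_of_leaf ht ih hx (Leaf.of_bicon hbi) (h.exists_adj hx) (Finset.mem_erase.2 ⟨hvx, hv⟩)

/-- In a biconnected digraph, each side of a separation of `S.erase x` has a neighbour of `x`. -/
theorem Sep.exists_adj (hS : Bicon t S) {b : ℕ} {M : Finset ℕ}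
    (hs : Sep t (S.erase x) b M) (ht : ArcWeight t) : ∃ v ∈ M, Adj t x v := by
  have hbS : b ∈ S := Finset.mem_of_mem_erase hs.mem
  obtain ⟨u, hu, w, hw, hwM, hadj⟩ := hS.2.2 b hbS M (fun u hu => Finset.mem_erase.2
    ⟨fun hub => hs.notMem (hub ▸ hu), Finset.mem_of_mem_erase (hs.sub hu)⟩) hs.nonempty (by
      intro heq
      obtain ⟨w, hw, hwb, hwM⟩ := hs.rest
      exact hwM (heq ▸ Finset.mem_erase.2 ⟨hwb, Finset.mem_of_mem_erase hw⟩))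
  rw [Finset.mem_erase] at hw
  by_cases hwx : w = x
  · subst hwx
    exact ⟨u, hu, ht.adj_symm hadj⟩
  · exact absurd hadj (hs.not_adj u hu w (Finset.mem_erase.2 ⟨hwx, hw.2⟩) hw.1 hwM)

theorem Sep.exists_side_notMem (ht : ArcWeight t) {G M : Finset ℕ} {b : ℕ}
    (hs : Sep t G b M) (z : ℕ) : ∃ N, Sep t G b N ∧ z ∉ N := by
  by_cases hz : z ∈ M
  · exact ⟨_, hs.compl ht, by simp [hz]⟩
  · exact ⟨M, hs, hz⟩

theorem Sep.disjoint_of_conn {G N Q : Finset ℕ} {b z : ℕ}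
    (hs : Sep t G b N) (hQ : Conn t Q) (hQG : Q ⊆ G) (hbQ : b ∉ Q) (hz : z ∈ Q) (hzN : z ∉ N) :
    ∀ u ∈ Q, u ∉ N := by
  intro u hu huN
  obtain ⟨u', hu', w, hw, hwN, hadj⟩ := hQ (Q ∩ N) Finset.inter_subset_left
    ⟨u, Finset.mem_inter.2 ⟨hu, huN⟩⟩ (fun heq => hzN (by
      rw [← heq] at hz; exact (Finset.mem_inter.1 hz).2))
  exact hs.not_adj u' (Finset.mem_inter.1 hu').2 w (hQG hw) (fun h => hbQ (h ▸ hw))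
    (fun h => hwN (Finset.mem_inter.2 ⟨hw, h⟩)) hadj

/-- If all vertices of a nontrivial leaf `L` of `S.erase x` are adjacent to `x`, then deleting a
vertex of `L` keeps `S` biconnected. -/
theorem Sep.bicon_erase (ht : ArcWeight t) (hS : Bicon t S) (hx : x ∈ S) {b : ℕ} {L : Finset ℕ}
    (hs : Sep t (S.erase x) b L) (hbi : Bicon t (insert b L)) (hadj : ∀ u ∈ L, Adj t x u)
    (hcard : 2 ≤ L.card) (hv : v ∈ L) : Bicon t (S.erase v) := by
  have hvS : v ∈ S := Finset.mem_of_mem_erase (hs.sub hv)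
  have hvx : v ≠ x := Finset.ne_of_mem_erase (hs.sub hv)
  have hbv : b ≠ v := fun h => hs.notMem (h ▸ hv)
  have hG := hS.2.2 x hx
  have hcard' : 2 ≤ (S.erase v).card := by
    have h1 := Finset.card_le_card (Finset.insert_subset hs.mem hs.sub)
    rw [Finset.card_insert_of_notMem hs.notMem, Finset.card_erase_of_mem hx] at h1
    rw [Finset.card_erase_of_mem hvS]
    omega
  by_contra hnot
  obtain ⟨y, M, hM⟩ := exists_sep_of_not_bicon (hS.2.2 v hvS) hcard' hnot
  have hyv := Finset.ne_of_mem_erase hM.mem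
  have hyS := Finset.mem_of_mem_erase hM.mem
  have hconnv : Conn t ((insert b L).erase v) := hbi.2.2 v (Finset.mem_insert_of_mem hv)
  have hbmem : b ∈ (insert b L).erase v := by simp [hbv]
  by_cases hyx : y = x
  · subst hyx
    obtain ⟨N, hN, hbN⟩ := hM.exists_side_notMem ht b
    have hdisj := hN.disjoint_of_conn hconnv
      (Finset.erase_subset_erase v ((Finset.insert_subset hs.mem hs.sub).trans
        (Finset.erase_subset _ _))) (by
          intro hy
          rcases Finset.mem_insert.1 (Finset.mem_of_mem_erase hy) with rfl | hy
          · exact Finset.notMem_erase _ _ hs.mem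
          · exact Finset.notMem_erase _ _ (hs.sub hy)) hbmem hbN
    obtain ⟨u, hu, w, hw, hwN, huw⟩ := hG N (fun u hu => Finset.mem_erase.2
      ⟨fun h => hN.notMem (h ▸ hu), Finset.mem_of_mem_erase (hN.sub hu)⟩) hN.nonempty
      (fun heq => hbN (heq ▸ hs.mem))
    obtain ⟨hwy, hwS⟩ := Finset.mem_erase.1 hw
    by_cases hwv : w = v
    · subst hwv
      have huS := Finset.mem_erase.1 (hN.sub hu)
      refine hs.not_adj w hv u (Finset.mem_erase.2 ⟨fun h => hN.notMem (h ▸ hu), huS.2⟩)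
        (fun h => hbN (h ▸ hu)) (fun huL => ?_) (ht.adj_symm huw)
      exact hdisj u (by simp [huS.1, huL]) hu
    · exact hN.not_adj u hu w (Finset.mem_erase.2 ⟨hwv, hwS⟩) hwy hwN huw
  · obtain ⟨N, hN, hxN⟩ := hM.exists_side_notMem ht x
    have hxv : x ∈ S.erase v := Finset.mem_erase.2 ⟨hvx.symm, hx⟩
    have hNx : ∀ u ∈ N, ¬ Adj t x u := fun u hu hxu =>
      hN.not_adj u hu x hxv (Ne.symm hyx) hxN (ht.adj_symm hxu)
    have hLN : ∀ u ∈ L, u ∉ N := fun u hu huN => hNx u huN (hadj u hu)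
    by_cases hbN : b ∈ N
    · have hyb : y ≠ b := fun h => hN.notMem (h ▸ hbN)
      obtain ⟨b', hb', w, hw, hwb, hbw⟩ := hconnv {b} (by simpa using hbv) (by simp) (by
        intro heq
        have := congrArg Finset.card heq
        rw [Finset.card_erase_of_mem (Finset.mem_insert_of_mem hv),
          Finset.card_insert_of_notMem hs.notMem] at this
        simp at this
        omega)
      rw [Finset.mem_singleton] at hb' hwb
      subst hb'
      obtain ⟨hwv, hw⟩ := Finset.mem_erase.1 hw
      have hwL : w ∈ L := (Finset.mem_insert.1 hw).resolve_left hwb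
      have hwy : w = y := by
        by_contra hwy
        exact hN.not_adj b' hbN w (Finset.mem_erase.2
          ⟨hwv, Finset.mem_of_mem_erase (hs.sub hwL)⟩) hwy (hLN w hwL) hbw
      subst hwy
      obtain ⟨r, hr, hxr⟩ := (hs.compl ht).exists_adj hS ht
      simp only [Finset.mem_sdiff, Finset.mem_erase] at hr
      obtain ⟨u, hu, z, hz, hzW, huz⟩ := hG ((S.erase x) \ (L ∪ N)) Finset.sdiff_subset
        ⟨r, by simp [hr, show r ∉ N from fun h => hNx r h hxr]⟩ (by
          intro heq
          have := hs.mem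
          rw [← heq] at this
          simp [hbN] at this)
      simp only [Finset.mem_sdiff, Finset.mem_union, not_or] at hu
      have hzLN : z ∈ L ∨ z ∈ N := by
        by_contra hcon
        exact hzW (Finset.mem_sdiff.2 ⟨hz, by simpa using hcon⟩)
      rcases hzLN with hzL | hzN
      · exact hs.not_adj z hzL u hu.1 (fun h => hu.2.2 (h ▸ hbN)) hu.2.1 (ht.adj_symm huz)
      · exact hN.not_adj z hzN u (Finset.mem_erase.2
          ⟨fun h => hu.2.1 (h ▸ hv), Finset.mem_of_mem_erase hu.1⟩)
          (fun h => hu.2.1 (h ▸ hwL)) hu.2.2 (ht.adj_symm huz)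
    · obtain ⟨u, hu, w, hw, hwN, huw⟩ := hS.2.2 y hyS N (fun u hu => Finset.mem_erase.2
        ⟨fun h => hN.notMem (h ▸ hu), Finset.mem_of_mem_erase (hN.sub hu)⟩) hN.nonempty
        (fun heq => hxN (heq ▸ Finset.mem_erase.2 ⟨Ne.symm hyx, hx⟩))
      obtain ⟨hwy, hwS⟩ := Finset.mem_erase.1 hw
      by_cases hwv : w = v
      · subst hwv
        exact hs.not_adj w hv u (Finset.mem_erase.2
          ⟨fun h => hxN (h ▸ hu), Finset.mem_of_mem_erase (hN.sub hu)⟩)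
          (fun h => hbN (h ▸ hu)) (fun huL => hLN u huL hu) (ht.adj_symm huw)
      · exact hN.not_adj u hu w (Finset.mem_erase.2 ⟨hwv, hwS⟩) hwy hwN huw

/-- `v` has exactly the two neighbours `x` and `b` in `S`, joined to `v` in the same way, and its
budgets are those of one neighbour. -/
structure DegTwo (t : Bool → ℕ → ℕ → ℕ) (S : Finset ℕ) (F : Bool → Bool → ℕ → ℕ)
    (v x b : ℕ) : Prop where
  left_mem : x ∈ S
  right_mem : b ∈ S
  left_ne_right : x ≠ b
  of_adj : ∀ u ∈ S, Adj t u v → u = x ∨ u = b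
  left_eq : ∀ i e, F i e v = t e x v
  right_eq : ∀ i e, F i e v = t e b v

theorem Rich.exists_degTwo (ht : ArcWeight t) (h : Rich t S F) (ih : ClassifiedBelow t S.card)
    (hx : x ∈ S) {b : ℕ} {M : Finset ℕ} (hs : Sep t (S.erase x) b M) :
    ∃ v ∈ M, ∃ b', DegTwo t S F v x b' := by
  obtain ⟨c, L, hLM, hL, hbi⟩ := hs.exists_leaf ht (h.bicon.2.2 x hx)
  have hleaf := Leaf.of_sep ht hL hbi
  have hadj := hL.exists_adj h.bicon ht
  have hadj' : ∀ u ∈ L, Adj t x u := fun u hu => h.adj_of_leaf ht ih hx hleaf hadj hu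
  have hcard : L.card = 1 := by
    by_contra hne
    have hpos := Finset.card_pos.2 hL.nonempty
    obtain ⟨v, hv⟩ := hL.nonempty
    have hvS := hL.sub hv
    have hbe := hL.bicon_erase ht h.bicon hx hbi hadj' (by omega) hv
    obtain ⟨w, hw, hwc, hwL⟩ := hL.rest
    refine hL.not_adj v hv w hw hwc hwL ?_
    exact h.adj_of_bicon_erase ht ih (Finset.mem_of_mem_erase hvS) hbe
      (Finset.mem_of_mem_erase hw) (fun h => hwL (h ▸ hv))
  obtain ⟨v, rfl⟩ := Finset.card_eq_one.1 hcard
  have hvL : v ∈ ({v} : Finset ℕ) := by simp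
  have hvG := Finset.mem_erase.1 (hL.sub hvL)
  have hcG := Finset.mem_erase.1 hL.mem
  have hcv : c ≠ v := by simpa using hL.notMem
  have hof : ∀ u ∈ S, Adj t u v → u = x ∨ u = c := by
    intro u hu huv
    by_contra! hcon
    exact hL.not_adj v hvL u (Finset.mem_erase.2 ⟨hcon.1, hu⟩) hcon.2
      (by simpa using ht.ne_of_adj huv) (ht.adj_symm huv)
  have hdegS : ∀ e, deg t S e v = t e x v + t e c v := by
    intro e
    rw [← deg_erase_add hx, ← deg_erase_add hL.mem, deg_eq_zero, zero_add, add_comm]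
    intro u hu huv
    simp only [Finset.mem_erase] at hu
    rcases hof u hu.2.2 huv with rfl | rfl <;> simp at hu
  have hdegP : ∀ e, deg t (insert c {v}) e v = t e c v := by
    intro e
    rw [deg_insert (by simpa using hcv)]
    simp [deg, ht.irrefl]
  have key : ∀ i e, F i e v = t e x v ∧ F i e v = t e c v := by
    intro i e
    rcases h.leaf_cases ht ih hx hleaf hadj with h1 | ⟨-, h1, p, hp⟩
    · have h2 := h1 v hvL i e
      rw [hdegP] at h2
      omega
    · have hp0 : ∀ j, p j ≠ 0 := by
        intro j
        obtain ⟨e', he'⟩ := h.pos j v hvG.2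
        rwa [hp v hvL j e'] at he'
      have h2 := h.tight ht hvG.2 i e
      rw [hdegS, hp v hvL, hp v hvL, h1 v hvL] at h2
      have h3 := hp0 i
      have h4 := hp0 !i
      have h5 := ht.le_one e c v
      rw [hp v hvL, h1 v hvL]
      omega
  exact ⟨v, hLM hvL, c, hx, hcG.2, hcG.1.symm, hof, fun i e => (key i e).1,
    fun i e => (key i e).2⟩

theorem Rich.forall_degTwo (ht : ArcWeight t) (h : Rich t S F) (ih : ClassifiedBelow t S.card)
    (hx : x ∈ S) (hnb : ¬ Bicon t (S.erase x)) : ∀ v ∈ S, ∃ y b, DegTwo t S F v y b := by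
  have hsep : ∀ y ∈ S, ¬ Bicon t (S.erase y) → ∃ b M, Sep t (S.erase y) b M := by
    intro y hy
    refine exists_sep_of_not_bicon (h.bicon.2.2 y hy) ?_
    rw [Finset.card_erase_of_mem hy]
    have := h.three_le_card ht
    omega
  obtain ⟨b, M, hs⟩ := hsep x hx hnb
  have hcard : 4 ≤ S.card := by
    obtain ⟨u, hu⟩ := hs.nonempty
    obtain ⟨w, hw, hwb, hwM⟩ := hs.rest
    have hub : u ≠ b := fun h => hs.notMem (h ▸ hu)
    have huw : u ≠ w := fun h => hwM (h ▸ hu)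
    have hsub : ({u, b, w} : Finset ℕ) ⊆ S.erase x := by
      intro z hz
      simp only [Finset.mem_insert, Finset.mem_singleton] at hz
      rcases hz with rfl | rfl | rfl
      exacts [hs.sub hu, hs.mem, hw]
    have h1 := Finset.card_le_card hsub
    rw [Finset.card_eq_three.2 ⟨u, b, w, hub, huw, hwb.symm, rfl⟩,
      Finset.card_erase_of_mem hx] at h1
    omega
  obtain ⟨v₀, hv₀, b₀, hd₀⟩ := h.exists_degTwo ht ih hx hs
  have hv₀S : v₀ ∈ S := Finset.mem_of_mem_erase (hs.sub hv₀)
  have hstep : ∀ v ∈ S, ∀ y c, DegTwo t S F v y c →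
      ∀ w ∈ S, Adj t v w → ∃ y b, DegTwo t S F w y b := by
    intro v hv y c hd w hw hvw
    have hnb' : ¬ Bicon t (S.erase v) := by
      intro hbi
      have hsub : S ⊆ {v, y, c} := by
        intro z hz
        by_cases hzv : z = v
        · simp [hzv]
        · rcases hd.of_adj z hz (ht.adj_symm
            (h.adj_of_bicon_erase ht ih hv hbi hz hzv)) with rfl | rfl <;> simp
      have h1 := (Finset.card_le_card hsub).trans Finset.card_le_three
      omega
    obtain ⟨c', M', hs'⟩ := hsep v hv hnb'
    obtain ⟨u₁, hu₁, b₁, hd₁⟩ := h.exists_degTwo ht ih hv hs'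
    obtain ⟨u₂, hu₂, b₂, hd₂⟩ := h.exists_degTwo ht ih hv (hs'.compl ht)
    have hne : u₁ ≠ u₂ := by
      rintro rfl
      exact (Finset.mem_sdiff.1 hu₂).2 hu₁
    have hadj : ∀ u ∈ S, ∀ b, DegTwo t S F u v b → u = y ∨ u = c := by
      intro u hu b hb
      obtain ⟨e, he⟩ := h.pos true u hu
      rw [hb.left_eq] at he
      exact hd.of_adj u hu (ht.adj_symm ⟨e, he⟩)
    have h1 := hadj u₁ (Finset.mem_of_mem_erase (hs'.sub hu₁)) b₁ hd₁
    have h2 := hadj u₂ (Finset.mem_of_mem_erase ((hs'.compl ht).sub hu₂)) b₂ hd₂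
    have h3 := hd.of_adj w hw (ht.adj_symm hvw)
    have h4 : w = u₁ ∨ w = u₂ := by
      rcases h1 with rfl | rfl <;> rcases h2 with rfl | rfl <;> tauto
    rcases h4 with rfl | rfl
    exacts [⟨_, _, hd₁⟩, ⟨_, _, hd₂⟩]
  by_contra! hcon
  obtain ⟨w₀, hw₀, hw₀'⟩ := hcon
  obtain ⟨u, hu, w, hw, hwT, huw⟩ := h.bicon.2.1
    (S.filter fun v => ∃ y b, DegTwo t S F v y b) (Finset.filter_subset _ _)
    ⟨v₀, Finset.mem_filter.2 ⟨hv₀S, x, b₀, hd₀⟩⟩ (by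
      intro heq
      rw [← heq, Finset.mem_filter] at hw₀
      obtain ⟨y, b, hyb⟩ := hw₀.2
      exact hw₀' y b hyb)
  obtain ⟨huS, y, c, hd⟩ := Finset.mem_filter.1 hu
  exact hwT (Finset.mem_filter.2 ⟨hw, hstep u huS y c hd w hw huw⟩)

/-- `S` induces a bidirected odd cycle. -/
def OddCycle (t : Bool → ℕ → ℕ → ℕ) (S : Finset ℕ) : Prop :=
  Bidir t S ∧ (∀ v ∈ S, (S.filter fun u => Adj t u v).card = 2) ∧ Odd S.card

theorem Rich.eq_one_of_forall_degTwo (ht : ArcWeight t) (h : Rich t S F)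
    (hd : ∀ v ∈ S, ∃ y b, DegTwo t S F v y b) : ∀ v ∈ S, ∀ i e, F i e v = 1 := by
  have hF : ∀ u ∈ S, ∀ v ∈ S, Adj t u v → ∀ i e, F i e v = t e u v := by
    intro u hu v hv huv i e
    obtain ⟨y, b, hyb⟩ := hd v hv
    rcases hyb.of_adj u hu huv with rfl | rfl
    exacts [hyb.left_eq i e, hyb.right_eq i e]
  have hFi : ∀ v ∈ S, ∀ i e, F i e v = F true e v := by
    intro v hv i e
    obtain ⟨y, b, hyb⟩ := hd v hv
    rw [hyb.left_eq, hyb.left_eq]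
  have hFle : ∀ v ∈ S, ∀ i e, F i e v ≤ 1 := by
    intro v hv i e
    obtain ⟨y, b, hyb⟩ := hd v hv
    rw [hyb.left_eq]
    exact ht.le_one _ _ _
  suffices hall : (S.filter fun v => ∀ e, F true e v = 1) = S by
    intro v hv i e
    rw [← hall, Finset.mem_filter] at hv
    rw [hFi v hv.1]
    exact hv.2 e
  by_contra hne
  by_cases hemp : (S.filter fun v => ∀ e, F true e v = 1).Nonempty
  · obtain ⟨u, hu, v, hv, hvT, huv⟩ := h.bicon.2.1 _ (Finset.filter_subset _ _) hemp hne
    rw [Finset.mem_filter] at hu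
    refine hvT (Finset.mem_filter.2 ⟨hv, fun e => ?_⟩)
    rw [hF u hu.1 v hv huv, ← ht.flip, ← hF v hv u hu.1 (ht.adj_symm huv) true]
    exact hu.2 _
  · rw [Finset.not_nonempty_iff_eq_empty, Finset.filter_eq_empty_iff] at hemp
    refine h.bad.not_col (fun v => decide (F true true v = 1)) ?_
    intro i U hU hUne hcol
    obtain ⟨v, hv⟩ := hUne
    obtain ⟨e, he⟩ := h.pos i v (hU hv)
    refine ⟨v, hv, e, ?_⟩
    rw [deg_eq_zero]
    · omega
    · intro u hu huv
      have h1 := (hcol u hu).trans (hcol v hv).symm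
      rw [decide_eq_decide] at h1
      have h2 : F true true u = F true false v := by
        rw [hF v (hU hv) u (hU hu) (ht.adj_symm huv), hF u (hU hu) v (hU hv) huv]
        exact ht.flip false u v
      have h3 := hemp (hU hv)
      rw [Bool.forall_bool] at h3
      have h4 : F true e v ≠ 0 := by rwa [← hFi v (hU hv) i]
      have h5 := hFle v (hU hv) true true
      have h6 := hFle v (hU hv) true false
      cases e <;> omega

theorem Rich.oddCycle (ht : ArcWeight t) (h : Rich t S F)
    (hd : ∀ v ∈ S, ∃ y b, DegTwo t S F v y b) :
    OddCycle t S ∧ ∀ v ∈ S, ∀ i e, F i e v = 1 := by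
  have hone := h.eq_one_of_forall_degTwo ht hd
  have hadj1 : ∀ u ∈ S, ∀ v ∈ S, Adj t u v → ∀ e, t e u v = 1 := by
    intro u hu v hv huv e
    obtain ⟨y, b, hyb⟩ := hd v hv
    rw [← hone v hv true e]
    rcases hyb.of_adj u hu huv with rfl | rfl
    exacts [(hyb.left_eq true e).symm, (hyb.right_eq true e).symm]
  have hbidir : Bidir t S := by
    intro u hu v hv e
    by_cases huv : Adj t u v
    · rw [hadj1 u hu v hv huv, hadj1 u hu v hv huv]
    · unfold Adj at huv
      push Not at huv
      rw [huv, huv]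
  refine ⟨⟨hbidir, ?_, ?_⟩, hone⟩
  · intro v hv
    obtain ⟨y, b, hyb⟩ := hd v hv
    rw [Finset.card_eq_two]
    refine ⟨y, b, hyb.left_ne_right, ?_⟩
    ext u
    simp only [Finset.mem_filter, Finset.mem_insert, Finset.mem_singleton]
    refine ⟨fun hu => hyb.of_adj u hu.1 hu.2, ?_⟩
    rintro (rfl | rfl)
    · exact ⟨hyb.left_mem, true, by rw [← hyb.left_eq true, hone v hv]; exact one_ne_zero⟩
    · exact ⟨hyb.right_mem, true, by rw [← hyb.right_eq true, hone v hv]; exact one_ne_zero⟩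
  · obtain ⟨x, hx⟩ : S.Nonempty := Finset.card_pos.1 (by have := h.bicon.1; omega)
    obtain ⟨α, hα⟩ := h.bad.exists_col_of_notMem ht (T := S.erase x) (Finset.erase_subset _ _)
      hx (Finset.notMem_erase x S)
    set C : Bool → Finset ℕ := fun k => (S.erase x).filter fun u => α u = k with hC
    have hCS : ∀ k, C k ⊆ S := fun k =>
      (Finset.filter_subset _ _).trans (Finset.erase_subset _ _)
    have hproper : ∀ k, ∀ u ∈ C k, ∀ v ∈ C k, ¬ Adj t u v := by
      intro k u hu v hv huv
      have hu' := (Finset.mem_filter.1 hu).2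
      have hv' := (Finset.mem_filter.1 hv).2
      have hne := ht.ne_of_adj huv
      obtain ⟨w, hw, e, he⟩ := hα k {u, v} (by
        intro z hz
        rcases Finset.mem_insert.1 hz with rfl | hz
        · exact (Finset.mem_filter.1 hu).1
        · rw [Finset.mem_singleton.1 hz]; exact (Finset.mem_filter.1 hv).1) (by simp) (by
        intro z hz
        rcases Finset.mem_insert.1 hz with rfl | hz
        · exact hu'
        · rw [Finset.mem_singleton.1 hz]; exact hv')
      rw [deg, Finset.sum_pair hne] at he
      rcases Finset.mem_insert.1 hw with rfl | hw
      · rw [hone w (hCS k hu), hadj1 v (hCS k hv) w (hCS k hu) (ht.adj_symm huv)] at he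
        omega
      · rw [Finset.mem_singleton.1 hw, hone v (hCS k hv), hadj1 u (hCS k hu) v (hCS k hv) huv] at he
        omega
    have hsplit : ∀ (f : ℕ → ℕ) (k : Bool),
        ∑ u ∈ S, f u = ∑ u ∈ C k, f u + ∑ u ∈ C (!k), f u + f x := by
      intro f k
      rw [← Finset.sum_erase_add _ _ hx, ← Finset.sum_fiberwise (S.erase x) α, Fintype.sum_bool]
      cases k
      · simp only [hC, Bool.not_false]
        omega
      · simp only [hC, Bool.not_true]
    have hcount : ∀ k, 2 * (C k).card =
        ∑ v ∈ C k, ∑ u ∈ C (!k), t true u v + 1 := by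
      intro k
      have h1 : ∀ v ∈ C k, 2 = ∑ u ∈ C (!k), t true u v + t true x v := by
        intro v hv
        have h2 := h.tight ht (hCS k hv) true true
        rw [hone v (hCS k hv), hone v (hCS k hv), deg, hsplit _ k] at h2
        have h3 : ∑ u ∈ C k, t true u v = 0 :=
          deg_eq_zero (fun u hu => hproper k u hu v hv) true
        omega
      have h4 := Finset.sum_congr (rfl : C k = C k) h1
      rw [Finset.sum_const, smul_eq_mul, mul_comm, Finset.sum_add_distrib] at h4
      have h5 := h.bad.deg_class_eq ht hx hα k false
      rw [hone x hx] at h5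
      have h6 : ∑ v ∈ C k, t true x v = 1 := by
        rw [← h5]
        exact Finset.sum_congr rfl fun v _ => (ht.flip true x v).symm
      omega
    have hsym : ∑ v ∈ C true, ∑ u ∈ C false, t true u v =
        ∑ v ∈ C false, ∑ u ∈ C true, t true u v := by
      rw [Finset.sum_comm]
      refine Finset.sum_congr rfl fun u hu => Finset.sum_congr rfl fun v hv => ?_
      rw [hbidir u (hCS _ hu) v (hCS _ hv)]
      exact ht.flip true v u
    have h1 := hcount true
    have h2 := hcount false
    have h3 := hsplit (fun _ => 1) true
    simp only [Finset.sum_const, smul_eq_mul, mul_one, Bool.not_true, Bool.not_false] at h1 h2 h3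
    exact ⟨(C true).card, by omega⟩

/-- `S` induces a bidirected complete digraph. -/
def Complete (t : Bool → ℕ → ℕ → ℕ) (S : Finset ℕ) : Prop :=
  ∀ u ∈ S, ∀ v ∈ S, u ≠ v → ∀ e, t e u v = 1

theorem Rich.complete_or_degTwo (ht : ArcWeight t) (h : Rich t S F)
    (ih : ClassifiedBelow t S.card) (hbi : ∀ x ∈ S, Bicon t (S.erase x)) :
    (Complete t S ∧ ∃ p : Bool → ℕ, ∀ v ∈ S, ∀ i e, F i e v = p i) ∨
      ∀ v ∈ S, ∃ y b, DegTwo t S F v y b := by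
  have h3 := h.three_le_card ht
  have hcases := fun x (hx : x ∈ S) =>
    h.leaf_cases ht ih hx (Leaf.of_bicon (hbi x hx)) (h.exists_adj hx)
  have hadj : ∀ u ∈ S, ∀ v ∈ S, v ≠ u → Adj t u v := fun u hu v hv hne =>
    h.adj_of_bicon_erase ht ih hu (hbi u hu) hv hne
  by_cases hfull : ∃ y ∈ S, Bidir t (S.erase y) ∧ ∀ v ∈ S.erase y, ∀ e, t e y v = 1
  · left
    obtain ⟨y, hy, hbd, hy1⟩ := hfull
    have hcomplete : Complete t S := by
      intro u hu v hv huv e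
      by_cases huy : u = y
      · subst huy
        exact hy1 v (Finset.mem_erase.2 ⟨huv.symm, hv⟩) e
      by_cases hvy : v = y
      · subst hvy
        rw [← ht.flip]
        exact hy1 u (Finset.mem_erase.2 ⟨huy, hu⟩) _
      obtain ⟨e', he'⟩ := hadj u hu v hv huv.symm
      have h1 := hbd u (Finset.mem_erase.2 ⟨huy, hu⟩) v (Finset.mem_erase.2 ⟨hvy, hv⟩) e'
      refine ht.eq_one ?_
      cases e <;> cases e' <;> simp only [Bool.not_true, Bool.not_false] at h1 <;> omega
    have hconst : ∀ x ∈ S, ∃ p : Bool → ℕ, ∀ v ∈ S.erase x, ∀ i e, F i e v = p i := by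
      intro x hx
      rcases hcases x hx with h1 | ⟨-, -, h1⟩
      · refine ⟨fun _ => 1, fun v hv i e => ?_⟩
        rw [(h1 v hv i e).1]
        exact hcomplete x hx v (Finset.mem_of_mem_erase hv) (Finset.ne_of_mem_erase hv).symm e
      · exact h1
    refine ⟨hcomplete, fun i => F i true y, fun v hv i e => ?_⟩
    obtain ⟨x, hx, hxv⟩ := Finset.exists_mem_notMem_of_card_lt_card
      (s := {v, y}) (t := S) (Finset.card_le_two.trans_lt h3)
    simp only [Finset.mem_insert, Finset.mem_singleton, not_or] at hxv
    obtain ⟨p, hp⟩ := hconst x hx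
    beta_reduce
    rw [hp v (Finset.mem_erase.2 ⟨Ne.symm hxv.1, hv⟩),
      hp y (Finset.mem_erase.2 ⟨Ne.symm hxv.2, hy⟩)]
  · right
    have heq : ∀ x ∈ S, ∀ v ∈ S, v ≠ x → ∀ i e, F i e v = t e x v := by
      intro x hx v hv hvx i e
      rcases hcases x hx with h1 | ⟨h1, h2, -⟩
      · exact (h1 v (Finset.mem_erase.2 ⟨hvx, hv⟩) i e).1
      · exact absurd ⟨x, hx, h1, h2⟩ hfull
    intro v hv
    obtain ⟨e, he⟩ := h.pos true v hv
    have hcard : (S.erase v).card = 2 := by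
      have h1 := h.tight ht hv true e
      rw [← ht.deg_erase_self, deg, Finset.sum_congr rfl (fun u hu =>
        (heq u (Finset.mem_of_mem_erase hu) v hv (Finset.ne_of_mem_erase hu).symm true e).symm),
        Finset.sum_const, smul_eq_mul] at h1
      obtain ⟨u, hu⟩ : (S.erase v).Nonempty := Finset.card_pos.1 (by
        rw [Finset.card_erase_of_mem hv]; omega)
      rw [Finset.mem_erase] at hu
      have h2 := heq u hu.2 v hv hu.1.symm
      have h4 := ht.le_one e u v
      rw [Bool.not_true, h2 false e, h2 true e] at h1
      rw [h2 true e] at he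
      have h5 : t e u v = 1 := by omega
      rw [h5] at h1
      omega
    obtain ⟨y, b, hyb, hS⟩ := Finset.card_eq_two.1 hcard
    have hy : y ∈ S.erase v := by simp [hS]
    have hb : b ∈ S.erase v := by simp [hS]
    rw [Finset.mem_erase] at hy hb
    refine ⟨y, b, hy.2, hb.2, hyb, fun u hu huv => ?_, heq y hy.2 v hv hy.1.symm,
      heq b hb.2 v hv hb.1.symm⟩
    have : u ∈ S.erase v := Finset.mem_erase.2 ⟨ht.ne_of_adj huv, hu⟩
    simpa [hS] using this

/-- Uncolourable pairs with two colours on a biconnected digraph. -/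
theorem classification (ht : ArcWeight t) (hS : Bicon t S) (h : Bad t S F) :
    Mono S F ∨ (OddCycle t S ∧ ∀ v ∈ S, ∀ i e, F i e v = 1) ∨
      (Complete t S ∧ ∃ p : Bool → ℕ, ∀ v ∈ S, ∀ i e, F i e v = p i) := by
  induction hn : S.card using Nat.strong_induction_on generalizing S F with
  | _ n ih =>
    by_cases hm : Mono S F
    · exact Or.inl hm
    right
    have hrich := Rich.of_not_mono ht hS h hm
    have hbelow : ClassifiedBelow t S.card := by
      intro P F' hP hbi hbad
      by_cases hm' : Mono P F'
      · exact Or.inl hm'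
      right
      have hrich' := Rich.of_not_mono ht hbi hbad hm'
      rcases ih P.card (hn ▸ hP) hbi hbad rfl with h1 | ⟨h1, h2⟩ | ⟨h1, p, h2⟩
      · exact absurd h1 hm'
      · exact ⟨h1.1, fun _ => 1, fun _ => one_ne_zero, h2⟩
      · refine ⟨fun u hu v hv e => ?_, p, fun i => ?_, h2⟩
        · by_cases huv : u = v
          · subst huv
            rw [ht.irrefl, ht.irrefl]
          · rw [h1 u hu v hv huv, h1 u hu v hv huv]
        · obtain ⟨v, hv⟩ : P.Nonempty := Finset.card_pos.1 (by have := hbi.1; omega)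
          obtain ⟨e, he⟩ := hrich'.pos i v hv
          rwa [h2 v hv] at he
    by_cases hbi : ∀ x ∈ S, Bicon t (S.erase x)
    · rcases hrich.complete_or_degTwo ht hbelow hbi with h1 | h1
      · exact Or.inr h1
      · exact Or.inl (hrich.oddCycle ht h1)
    · push Not at hbi
      obtain ⟨x, hx, hnb⟩ := hbi
      exact Or.inl (hrich.oddCycle ht (hrich.forall_degTwo ht hbelow hx hnb))

end TwoColours

section ManyColours

variable [Fintype ι] [DecidableEq ι]

/-- Keep the colour `c` and merge all other colours into one. -/
def merge (F : ι → Bool → ℕ → ℕ) (c : ι) : Bool → Bool → ℕ → ℕ :=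
  fun i e v => if i then F c e v else ∑ k ∈ Finset.univ.erase c, F k e v

theorem Bad.merge (ht : ArcWeight t) (h : Bad t S F) (c : ι) : Bad t S (merge F c) := by
  refine ⟨h.conn, fun v hv e => ?_, fun α hα => ?_⟩
  · have h1 := h.valid v hv e
    rw [← Finset.add_sum_erase Finset.univ (fun k => F k e v) (Finset.mem_univ c)] at h1
    simpa [Dicolouring.merge] using h1
  · obtain ⟨β, hβmem, hβ⟩ := exists_col_of_bideg (F := F) ht c (Finset.univ.erase c)
      (S.filter fun v => α v = false) (by
        intro U hU hne
        obtain ⟨v, hv, e, he⟩ := hα false U (hU.trans (Finset.filter_subset _ _)) hne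
          fun v hv => (Finset.mem_filter.1 (hU hv)).2
        exact ⟨v, hv, e, by simpa [Dicolouring.merge] using he⟩)
    refine h.not_col (fun v => if α v then c else β v) fun i U hU hne hc => ?_
    by_cases hi : i = c
    · subst hi
      have hall : ∀ v ∈ U, α v = true := by
        intro v hv
        by_contra hα'
        have h1 := hc v hv
        simp only [hα', if_false] at h1
        have h2 := hβmem v (Finset.mem_filter.2 ⟨hU hv, by simpa using hα'⟩)
        simp [h1] at h2
      obtain ⟨v, hv, e, he⟩ := hα true U hU hne hall
      exact ⟨v, hv, e, by simpa [Dicolouring.merge] using he⟩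
    · have hall : ∀ v ∈ U, α v = false := by
        intro v hv
        by_contra hα'
        have h1 := hc v hv
        simp only [Bool.not_eq_false] at hα'
        simp only [hα', if_true] at h1
        exact hi h1.symm
      refine hβ i U (fun v hv => Finset.mem_filter.2 ⟨hU hv, hall v hv⟩) hne fun v hv => ?_
      simpa [hall v hv] using hc v hv

/-- The possible roles of a single colour in an uncolourable biconnected pair. -/
theorem Bad.colour_cases (ht : ArcWeight t) (hS : Bicon t S) (h : Bad t S F) (c : ι) :
    (∀ k, k ≠ c → ∀ v ∈ S, ∀ e, F k e v = 0) ∨ (∀ v ∈ S, ∀ e, F c e v = 0) ∨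
      (OddCycle t S ∧ ∀ v ∈ S, ∀ e, F c e v = 1 ∧ ∑ k ∈ Finset.univ.erase c, F k e v = 1) ∨
      (Complete t S ∧ ∃ q, ∀ v ∈ S, ∀ e, F c e v = q) := by
  rcases classification ht hS (h.merge ht c) with ⟨i, hi⟩ | ⟨h1, h2⟩ | ⟨h1, p, h2⟩
  · cases i
    · exact Or.inr (Or.inl fun v hv e => by simpa [Dicolouring.merge] using hi v hv e)
    · refine Or.inl fun k hk v hv e => ?_
      have h1 := hi v hv e
      simp only [Dicolouring.merge, Bool.not_true, Bool.false_eq_true, if_false,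
        Finset.sum_eq_zero_iff] at h1
      exact h1 k (by simp [hk])
  · refine Or.inr (Or.inr (Or.inl ⟨h1, fun v hv e => ⟨?_, ?_⟩⟩))
    · simpa [Dicolouring.merge] using h2 v hv true e
    · simpa only [Dicolouring.merge, Bool.false_eq_true, if_false] using h2 v hv false e
  · exact Or.inr (Or.inr (Or.inr
      ⟨h1, p true, fun v hv e => by simpa [Dicolouring.merge] using h2 v hv true e⟩))

/-- Uncolourable pairs on a biconnected digraph. -/
theorem Bad.classification [Nonempty ι] (ht : ArcWeight t) (hS : Bicon t S) (h : Bad t S F) :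
    (∃ c, ∀ k, k ≠ c → ∀ v ∈ S, ∀ e, F k e v = 0) ∨
      (∃ i j, i ≠ j ∧ OddCycle t S ∧ (∀ v ∈ S, ∀ e, F i e v = 1 ∧ F j e v = 1) ∧
        ∀ k, k ≠ i → k ≠ j → ∀ v ∈ S, ∀ e, F k e v = 0) ∨
      (Complete t S ∧ ∃ p : ι → ℕ, ∀ v ∈ S, ∀ i e, F i e v = p i) := by
  obtain ⟨v₀, hv₀⟩ : S.Nonempty := Finset.card_pos.1 (by have := hS.1; omega)
  by_cases hm : ∃ c, ∀ k, k ≠ c → ∀ v ∈ S, ∀ e, F k e v = 0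
  · exact Or.inl hm
  right
  by_cases hodd : ∃ c, OddCycle t S ∧
      ∀ v ∈ S, ∀ e, F c e v = 1 ∧ ∑ k ∈ Finset.univ.erase c, F k e v = 1
  · left
    obtain ⟨c, hcyc, hc⟩ := hodd
    obtain ⟨j, hj, hj0⟩ := Finset.exists_ne_zero_of_sum_ne_zero
      ((hc v₀ hv₀ true).2.trans_ne one_ne_zero)
    have hjc := Finset.ne_of_mem_erase hj
    have hle : ∀ v ∈ S, ∀ e, F j e v ≤ 1 := fun v hv e =>
      (Finset.single_le_sum (f := fun k => F k e v) (fun _ _ => Nat.zero_le _) hj).trans_eq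
        (hc v hv e).2
    have hj1 : ∀ v ∈ S, ∀ e, F j e v = 1 := by
      rcases h.colour_cases ht hS j with h1 | h1 | ⟨-, h1⟩ | ⟨-, q, h1⟩
      · exact absurd ⟨j, h1⟩ hm
      · exact absurd (h1 v₀ hv₀ true) hj0
      · exact fun v hv e => (h1 v hv e).1
      · intro v hv e
        have h2 := hle v₀ hv₀ true
        rw [h1 v₀ hv₀] at h2 hj0
        rw [h1 v hv]
        omega
    refine ⟨c, j, hjc.symm, hcyc, fun v hv e => ⟨(hc v hv e).1, hj1 v hv e⟩, ?_⟩
    intro k hkc hkj v hv e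
    have h1 := (hc v hv e).2
    rw [← Finset.add_sum_erase _ _ hj, hj1 v hv e, Nat.add_eq_left, Finset.sum_eq_zero_iff] at h1
    exact h1 k (by simp [hkc, hkj])
  · right
    have hconst : ∀ c, (∀ v ∈ S, ∀ e, F c e v = 0) ∨
        (Complete t S ∧ ∃ q, ∀ v ∈ S, ∀ e, F c e v = q) := by
      intro c
      rcases h.colour_cases ht hS c with h1 | h1 | h1 | h1
      · exact absurd ⟨c, h1⟩ hm
      · exact Or.inl h1
      · exact absurd ⟨c, h1⟩ hodd
      · exact Or.inr h1
    refine ⟨?_, ?_⟩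
    · by_contra hcomp
      refine hm ⟨Classical.arbitrary ι, fun k _ => ?_⟩
      exact (hconst k).resolve_right fun h1 => hcomp h1.1
    · have hq : ∀ c, ∃ q, ∀ v ∈ S, ∀ e, F c e v = q := fun c =>
        (hconst c).elim (fun h1 => ⟨0, h1⟩) fun h1 => h1.2
      choose p hp using hq
      exact ⟨p, fun v hv i e => hp i v hv e⟩

end ManyColours

section Bridge

/-- The arc multiplicities of a digraph. -/
def wt (D : Digraph') : Bool → ℕ → ℕ → ℕ
  | true, u, v => if (u, v) ∈ D.arcs then 1 else 0
  | false, u, v => if (v, u) ∈ D.arcs then 1 else 0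

/-- The two coordinates of a sequence of functions, indexed by `Bool`. -/
def coord {ι : Type} (F : ι → ℕ → ℕ × ℕ) : ι → Bool → ℕ → ℕ
  | k, true, v => (F k v).1
  | k, false, v => (F k v).2

/-- The inverse of `coord`. -/
def uncoord {ι : Type} (G : ι → Bool → ℕ → ℕ) : ι → ℕ → ℕ × ℕ :=
  fun k v => (G k true v, G k false v)

theorem coord_uncoord {ι : Type} (G : ι → Bool → ℕ → ℕ) : coord (uncoord G) = G := by
  funext k e v
  cases e <;> rfl

theorem arcWeight_wt (D : Digraph') : ArcWeight (wt D) where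
  le_one e u v := by cases e <;> simp only [wt] <;> split_ifs <;> omega
  flip e u v := by cases e <;> rfl
  irrefl e v := by
    have : (v, v) ∉ D.arcs := fun h => D.no_loops _ h rfl
    cases e <;> simp [wt, this]

theorem adj_wt {D : Digraph'} {u v : ℕ} : Adj (wt D) u v ↔ (u, v) ∈ D.arcs ∨ (v, u) ∈ D.arcs := by
  simp [Adj, wt, or_comm]

theorem ugAdj_iff {D : Digraph'} {u v : ℕ} :
    D.ugAdj u v ↔ u ∈ D.verts ∧ v ∈ D.verts ∧ Adj (wt D) u v := by
  rw [adj_wt]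
  rfl

theorem inDeg_eq (D : Digraph') (v : ℕ) : D.inDeg v = deg (wt D) D.verts true v := by
  simp only [inDeg, deg, wt, Finset.sum_boole, Nat.cast_id]
  refine Finset.card_nbij Prod.fst ?_ ?_ ?_
  · rintro ⟨a, b⟩ h
    obtain ⟨harc, rfl⟩ := Finset.mem_filter.1 h
    exact Finset.mem_filter.2 ⟨D.mem_fst _ harc, harc⟩
  · rintro ⟨a, b⟩ h ⟨a', b'⟩ h' hab
    simp_all
  · intro u hu
    exact ⟨(u, v), by simp [(Finset.mem_filter.1 hu).2], rfl⟩

theorem outDeg_eq (D : Digraph') (v : ℕ) : D.outDeg v = deg (wt D) D.verts false v := by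
  simp only [outDeg, deg, wt, Finset.sum_boole, Nat.cast_id]
  refine Finset.card_nbij Prod.snd ?_ ?_ ?_
  · rintro ⟨a, b⟩ h
    obtain ⟨harc, rfl⟩ := Finset.mem_filter.1 h
    exact Finset.mem_filter.2 ⟨D.mem_snd _ harc, harc⟩
  · rintro ⟨a, b⟩ h ⟨a', b'⟩ h' hab
    simp_all
  · intro u hu
    exact ⟨(v, u), by simp [(Finset.mem_filter.1 hu).2], rfl⟩

theorem ugNbrs_eq (D : Digraph') (v : ℕ) :
    D.ugNbrs v = D.verts.filter fun u => Adj (wt D) u v := by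
  ext u
  simp only [ugNbrs, inNbrs, outNbrs, Finset.mem_union, Finset.mem_image, Finset.mem_filter,
    adj_wt, Prod.exists]
  constructor
  · rintro (⟨a, b, ⟨h, rfl⟩, rfl⟩ | ⟨a, b, ⟨h, rfl⟩, rfl⟩)
    · exact ⟨D.mem_fst _ h, Or.inl h⟩
    · exact ⟨D.mem_snd _ h, Or.inr h⟩
  · rintro ⟨-, h | h⟩
    · exact Or.inl ⟨u, v, ⟨h, rfl⟩, rfl⟩
    · exact Or.inr ⟨v, u, ⟨h, rfl⟩, rfl⟩

theorem bidirected_iff (D : Digraph') : D.Bidirected ↔ Bidir (wt D) D.verts := by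
  constructor
  · intro h u _ v _ e
    have h1 : (u, v) ∈ D.arcs ↔ (v, u) ∈ D.arcs := ⟨fun h' => h _ h', fun h' => h _ h'⟩
    cases e <;> simp [wt, h1]
  · rintro h ⟨u, v⟩ ha
    have h1 := h u (D.mem_fst _ ha) v (D.mem_snd _ ha) true
    by_contra hn
    simp [wt, ha, hn] at h1

theorem bidirectedComplete_iff (D : Digraph') :
    D.BidirectedComplete ↔ Complete (wt D) D.verts := by
  constructor
  · intro h u hu v hv huv e
    cases e <;> simp [wt, h u hu v hv huv, h v hv u hu huv.symm]
  · intro h u hu v hv huv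
    by_contra hn
    have h1 := h u hu v hv huv true
    simp [wt, hn] at h1

theorem connected_iff (D : Digraph') :
    D.Connected ↔ D.verts.Nonempty ∧ Conn (wt D) D.verts := by
  refine and_congr_right fun hne => ⟨fun h T hT hTne hTS => ?_, fun h u hu v hv => ?_⟩
  · obtain ⟨u, hu⟩ := hTne
    obtain ⟨v, hv, hvT⟩ : ∃ v ∈ D.verts, v ∉ T := by
      by_contra! hcon
      exact hTS (Finset.Subset.antisymm hT hcon)
    by_contra! hcon
    refine hvT ?_
    have hreach := h u (hT hu) v hv
    clear hvT hv
    induction hreach with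
    | refl => exact hu
    | @tail a b _ hab ih =>
      rw [ugAdj_iff] at hab
      by_contra hb
      exact hcon a ih b hab.2.1 hb hab.2.2
  · by_contra hn
    obtain ⟨a, ha, b, hb, hbT, hab⟩ := h
      (D.verts.filter fun w => Relation.ReflTransGen D.ugAdj u w) (Finset.filter_subset _ _)
      ⟨u, Finset.mem_filter.2 ⟨hu, Relation.ReflTransGen.refl⟩⟩
      fun heq => hn (Finset.mem_filter.1 (heq ▸ hv)).2
    rw [Finset.mem_filter] at ha hbT
    exact hbT ⟨hb, ha.2.tail (ugAdj_iff.2 ⟨ha.1, hb, hab⟩)⟩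

theorem deg_congr {t' : Bool → ℕ → ℕ → ℕ} (h : ∀ e, ∀ u ∈ S, t' e u v = t e u v) (e : Bool) :
    deg t' S e v = deg t S e v :=
  Finset.sum_congr rfl fun u hu => h e u hu

theorem Conn.congr {t' : Bool → ℕ → ℕ → ℕ}
    (h : ∀ e, ∀ u ∈ S, ∀ v ∈ S, t' e u v = t e u v) (hS : Conn t S) : Conn t' S := by
  intro T hT hne hTS
  obtain ⟨u, hu, v, hv, hvT, e, he⟩ := hS T hT hne hTS
  exact ⟨u, hu, v, hv, hvT, e, by rwa [h e u (hT hu) v hv]⟩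

theorem Bad.congr [Fintype ι] {t' : Bool → ℕ → ℕ → ℕ}
    (h : ∀ e, ∀ u ∈ S, ∀ v ∈ S, t' e u v = t e u v) (hS : Bad t S F) : Bad t' S F := by
  refine ⟨hS.conn.congr h, fun v hv e => ?_, fun α hα => hS.not_col α fun i U hU hne hc => ?_⟩
  · rw [deg_congr fun e u hu => h e u hu v hv]
    exact hS.valid v hv e
  · obtain ⟨v, hv, e, he⟩ := hα i U hU hne hc
    rw [deg_congr fun e u hu => h e u (hU hu) v (hU hv)] at he
    exact ⟨v, hv, e, he⟩

theorem wt_induce {D : Digraph'} {P : Finset ℕ} (e : Bool) (u : ℕ) (hu : u ∈ P) (v : ℕ)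
    (hv : v ∈ P) : wt (D.induce P) e u v = wt D e u v := by
  cases e <;> simp [wt, induce, hu, hv]

theorem verts_induce {D : Digraph'} {P : Finset ℕ} (hP : P ⊆ D.verts) :
    (D.induce P).verts = P :=
  Finset.inter_eq_right.2 hP

theorem biconnected_of_bicon {D : Digraph'} (h : Bicon (wt D) D.verts) : D.Biconnected := by
  refine ⟨h.1, (connected_iff D).2 ⟨Finset.card_pos.1 (by have := h.1; omega), h.2.1⟩, ?_⟩
  intro x hx
  have hverts : (D.del {x}).verts = D.verts.erase x := by
    rw [del, verts_induce Finset.sdiff_subset, Finset.sdiff_singleton_eq_erase]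
  rw [connected_iff, hverts]
  refine ⟨Finset.card_pos.1 ?_, (h.2.2 x hx).congr fun e u hu v hv => wt_induce e u ?_ v ?_⟩
  · have := h.1
    rw [Finset.card_erase_of_mem hx]
    omega
  · rwa [Finset.sdiff_singleton_eq_erase]
  · rwa [Finset.sdiff_singleton_eq_erase]

theorem wt_le_of_isSubdigraph {H D : Digraph'} (h : H.IsSubdigraph D) (e : Bool) (u v : ℕ) :
    wt H e u v ≤ wt D e u v := by
  have h1 : (u, v) ∈ H.arcs → (u, v) ∈ D.arcs := fun h' => h.2 h'
  have h2 : (v, u) ∈ H.arcs → (v, u) ∈ D.arcs := fun h' => h.2 h'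
  cases e <;> simp only [wt] <;> split_ifs <;> simp_all

theorem isDicolouring_iff {D : Digraph'} {s : ℕ} {F : Fin s → ℕ → ℕ × ℕ} {α : ℕ → Fin s} :
    D.IsDicolouring s F α ↔ Col (wt D) D.verts (coord F) α := by
  constructor
  · intro h i U hU hne hc
    have hUC : U ⊆ D.verts.filter fun v => α v = i := fun v hv =>
      Finset.mem_filter.2 ⟨hU hv, hc v hv⟩
    obtain ⟨v, hv, hdeg⟩ := h i (D.induce U)
      ⟨Finset.inter_subset_inter_left hUC, Finset.monotone_filter_right _ fun a _ ha =>
        ⟨hUC ha.1, hUC ha.2⟩⟩ (by rwa [verts_induce hU])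
    rw [inDeg_eq, outDeg_eq, verts_induce hU] at hdeg
    rw [verts_induce hU] at hv
    rw [deg_congr fun e u hu => wt_induce e u hu v hv,
      deg_congr fun e u hu => wt_induce e u hu v hv] at hdeg
    exact hdeg.elim (fun h1 => ⟨v, hv, true, h1⟩) fun h1 => ⟨v, hv, false, h1⟩
  · intro h i H hH hne
    have hsub : ∀ v ∈ H.verts, v ∈ D.verts ∧ α v = i := by
      intro v hv
      have h1 := hH.1 hv
      rw [verts_induce (Finset.filter_subset _ _), Finset.mem_filter] at h1
      exact h1
    have hHD : H.IsSubdigraph D :=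
      ⟨fun v hv => (hsub v hv).1, hH.2.trans (Finset.filter_subset _ _)⟩
    obtain ⟨v, hv, e, he⟩ := h i H.verts hHD.1 hne fun v hv => (hsub v hv).2
    have h1 : deg (wt H) H.verts e v < coord F i e v :=
      (Finset.sum_le_sum fun u _ => wt_le_of_isSubdigraph hHD e u v).trans_lt he
    refine ⟨v, hv, ?_⟩
    rw [inDeg_eq, outDeg_eq]
    cases e
    · exact Or.inr h1
    · exact Or.inl h1

end Bridge

section Hard

variable {s : ℕ}

theorem bidirectedOddCycle_of_oddCycle {D : Digraph'} (hne : D.verts.Nonempty)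
    (hconn : Conn (wt D) D.verts) (h : OddCycle (wt D) D.verts) : D.BidirectedOddCycle := by
  refine ⟨(bidirected_iff D).2 h.1, ⟨(connected_iff D).2 ⟨hne, hconn⟩, fun v hv => ?_⟩, h.2.2⟩
  rw [ugNbrs_eq]
  convert h.2.1 v hv

theorem Complete.deg_eq (ht : ArcWeight t) (h : Complete t S) (hT : T ⊆ S) (hv : v ∈ T) (e : Bool) :
    deg t T e v = T.card - 1 := by
  rw [← ht.deg_erase_self, deg, Finset.sum_congr rfl fun u hu =>
    h u (hT (Finset.mem_of_mem_erase hu)) v (hT hv) (Finset.ne_of_mem_erase hu) e]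
  simp [hv]

/-- Uncolourable valid pairs are hard. -/
theorem isHardPair_of_bad (D : Digraph') (F : Fin s → ℕ → ℕ × ℕ) (hne : D.verts.Nonempty)
    (h : Bad (wt D) D.verts (coord F)) : IsHardPair s D F := by
  induction hn : D.verts.card using Nat.strong_induction_on generalizing D F with
  | _ n ih =>
    have ht := arcWeight_wt D
    by_cases hcard : D.verts.card = 1
    · obtain ⟨v, hv⟩ := Finset.card_eq_one.1 hcard
      have hdeg : ∀ e, deg (wt D) D.verts e v = 0 := fun e => by simp [hv, deg, ht.irrefl]
      have hzero : ∀ k e, coord F k e v = 0 := by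
        intro k e
        have : Nonempty (Fin s) := ⟨k⟩
        have h1 := h.tight ht (v := v) (by simp [hv]) e
        rw [hdeg, Finset.sum_eq_zero_iff] at h1
        exact h1 k (Finset.mem_univ k)
      have h1 : ∀ k, (F k v).1 = 0 := fun k => hzero k true
      have h2 : ∀ k, (F k v).2 = 0 := fun k => hzero k false
      refine IsHardPair.complete ?_ ?_ ?_ ?_ <;> simp [hv, BidirectedComplete, h1, h2]
    have hcard : 2 ≤ D.verts.card := by
      have := Finset.card_pos.2 hne
      omega
    have hs : Nonempty (Fin s) := by
      obtain ⟨x, hx⟩ := hne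
      obtain ⟨u, hu, v, hv, -, e, he⟩ := h.conn {x} (by simpa using hx) (by simp) (by
        intro heq
        rw [← heq] at hcard
        simp at hcard)
      by_contra hemp
      rw [not_nonempty_iff] at hemp
      have h1 := h.valid v hv e
      rw [Finset.univ_eq_empty, Finset.sum_empty, ← deg_erase_add (x := u) (by
        rw [Finset.mem_singleton] at hu
        rwa [hu])] at h1
      omega
    by_cases hbi : Bicon (wt D) D.verts
    · rcases h.classification ht hbi with ⟨c, hc⟩ | ⟨i, j, hij, hcyc, h1, h0⟩ | ⟨hcomp, p, hp⟩
      · have hdeg : ∀ v ∈ D.verts, ∀ e, coord F c e v = deg (wt D) D.verts e v := by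
          intro v hv e
          rw [← h.tight ht hv e]
          exact (Finset.sum_eq_single c (fun k _ hk => hc k hk v hv e) (by simp)).symm
        refine IsHardPair.mono c (biconnected_of_bicon hbi) (fun v hv => ?_) fun k hk v hv => ?_
        · rw [inDeg_eq, outDeg_eq]
          exact Prod.ext (hdeg v hv true) (hdeg v hv false)
        · exact Prod.ext (hc k hk v hv true) (hc k hk v hv false)
      · exact IsHardPair.bicycle i j hij (bidirectedOddCycle_of_oddCycle hne h.conn hcyc)
          (fun v hv => Prod.ext (h1 v hv true).1 (h1 v hv false).1)
          (fun v hv => Prod.ext (h1 v hv true).2 (h1 v hv false).2)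
          fun k hi hj v hv => Prod.ext (h0 k hi hj v hv true) (h0 k hi hj v hv false)
      · refine IsHardPair.complete ((bidirectedComplete_iff D).2 hcomp) ?_ ?_ ?_
        · intro k u hu v hv
          exact Prod.ext ((hp u hu k true).trans (hp v hv k true).symm)
            ((hp u hu k false).trans (hp v hv k false).symm)
        · exact fun k v hv => (hp v hv k true).trans (hp v hv k false).symm
        · intro v hv
          rw [← hcomp.deg_eq ht (Finset.Subset.refl _) hv false]
          exact h.tight ht hv false
    · obtain ⟨b, M, hsep⟩ := exists_sep_of_not_bicon h.conn hcard hbi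
      obtain ⟨N, N', hN, hb, hb'⟩ := h.split ht hsep
      have hpart : ∀ {M : Finset ℕ} {N : Fin s → Bool → ℕ}, Sep (wt D) D.verts b M →
          Bad (wt D) (insert b M) (setAt (coord F) b N) → insert b M ⊆ D.verts ∧
            IsHardPair s (D.induce (insert b M)) (uncoord (setAt (coord F) b N)) := by
        intro M N hsep hbad
        have hsub : insert b M ⊆ D.verts := Finset.insert_subset hsep.mem hsep.sub
        refine ⟨hsub, ih _ ?_ _ _ ?_ ?_ rfl⟩
        · obtain ⟨w, hw, hwb, hwM⟩ := hsep.rest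
          rw [verts_induce hsub, ← hn]
          exact Finset.card_lt_card (Finset.ssubset_iff_subset_ne.2 ⟨hsub, fun heq => by
            rw [← heq] at hw
            simp [hwb, hwM] at hw⟩)
        · rw [verts_induce hsub]
          simp
        · rw [verts_induce hsub, coord_uncoord]
          exact hbad.congr wt_induce
      obtain ⟨hsub₁, hard₁⟩ := hpart hsep hb
      obtain ⟨hsub₂, hard₂⟩ := hpart (hsep.compl ht) hb'
      refine IsHardPair.join _ _ _ _ b hard₁ hard₂ ?_ ?_ ?_ ?_ ?_ ?_
      · rw [verts_induce hsub₁, verts_induce hsub₂]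
        ext v
        have := hsep.notMem
        simp only [Finset.mem_inter, Finset.mem_insert, Finset.mem_sdiff, Finset.mem_erase,
          Finset.mem_singleton]
        tauto
      · rw [verts_induce hsub₁, verts_induce hsub₂]
        ext v
        have h1 := hsep.mem
        have h2 := @hsep.sub v
        by_cases hvb : v = b
        · simp [hvb, h1]
        · simp only [Finset.mem_union, Finset.mem_insert, Finset.mem_sdiff, Finset.mem_erase]
          tauto
      · ext ⟨u, v⟩
        simp only [induce, Finset.mem_union, Finset.mem_filter, Finset.mem_insert,
          Finset.mem_sdiff, Finset.mem_erase]
        constructor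
        · intro ha
          have hu := D.mem_fst _ ha
          have hv := D.mem_snd _ ha
          have h1 : u ∈ M → v ≠ b → v ∈ M := fun hu' hvb => by
            by_contra hvM
            exact hsep.not_adj u hu' v hv hvb hvM (adj_wt.2 (Or.inl ha))
          have h2 : v ∈ M → u ≠ b → u ∈ M := fun hv' hub => by
            by_contra huM
            exact hsep.not_adj v hv' u hu hub huM (adj_wt.2 (Or.inr ha))
          simp only at hu hv
          tauto
        · tauto
      · intro k v _ hvb
        simp [uncoord, setAt, hvb, coord]
      · intro k v _ hvb
        simp [uncoord, setAt, hvb, coord]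
      · intro k
        simp [uncoord, setAt, hN, coord]

end Hard

section NotColourable

variable {s : ℕ}

theorem Col.ne_zero {α : ℕ → ι} (hα : Col t S F α) (hv : v ∈ S) :
    ∃ e, F (α v) e v ≠ 0 := by
  obtain ⟨w, hw, e, he⟩ := hα (α v) {v} (by simpa using hv) (by simp) (by simp)
  rw [Finset.mem_singleton] at hw
  subst hw
  exact ⟨e, by omega⟩

theorem not_col_of_mono (hne : S.Nonempty) {i : ι}
    (hi : ∀ v ∈ S, ∀ e, F i e v = deg t S e v) (hk : ∀ k, k ≠ i → ∀ v ∈ S, ∀ e, F k e v = 0)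
    (α : ℕ → ι) : ¬ Col t S F α := by
  intro hα
  have hall : ∀ v ∈ S, α v = i := by
    intro v hv
    obtain ⟨e, he⟩ := hα.ne_zero hv
    by_contra hvi
    exact he (hk _ hvi v hv e)
  obtain ⟨v, hv, e, he⟩ := hα i S (Finset.Subset.refl _) hne hall
  rw [hi v hv] at he
  exact lt_irrefl _ he

theorem not_col_of_complete [Fintype ι] [DecidableEq ι] (ht : ArcWeight t) (hne : S.Nonempty)
    (hS : Complete t S) {p : ι → ℕ} (hp : ∀ v ∈ S, ∀ k e, F k e v = p k)
    (hsum : ∑ k, p k = S.card - 1) (α : ℕ → ι) : ¬ Col t S F α := by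
  intro hα
  have hclass : ∀ k ∈ Finset.univ, (S.filter fun v => α v = k).card ≤ p k := by
    intro k _
    rcases (S.filter fun v => α v = k).eq_empty_or_nonempty with h | h
    · simp [h]
    · obtain ⟨v, hv, e, he⟩ := hα k _ (Finset.filter_subset _ _) h
        fun v hv => (Finset.mem_filter.1 hv).2
      rw [hS.deg_eq ht (Finset.filter_subset _ _) hv, hp v (Finset.mem_filter.1 hv).1] at he
      omega
  have h1 := Finset.sum_le_sum hclass
  rw [← Finset.card_eq_sum_card_fiberwise fun v _ => Finset.mem_coe.2 (Finset.mem_univ _),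
    hsum] at h1
  have := Finset.card_pos.2 hne
  omega

theorem not_col_of_oddCycle [DecidableEq ι] (ht : ArcWeight t) (hS : OddCycle t S) {i j : ι}
    (hi : ∀ v ∈ S, ∀ e, F i e v = 1) (hj : ∀ v ∈ S, ∀ e, F j e v = 1)
    (hij : i ≠ j) (hk : ∀ k, k ≠ i → k ≠ j → ∀ v ∈ S, ∀ e, F k e v = 0)
    (α : ℕ → ι) : ¬ Col t S F α := by
  intro hα
  obtain ⟨hbidir, hdeg, hodd⟩ := hS
  have hcol : ∀ v ∈ S, α v = i ∨ α v = j := by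
    intro v hv
    obtain ⟨e, he⟩ := hα.ne_zero hv
    by_contra! hvi
    exact he (hk _ hvi.1 hvi.2 v hv e)
  have hone : ∀ v ∈ S, ∀ w ∈ S, ∀ e, F (α w) e v = 1 := by
    intro v hv w hw e
    rcases hcol w hw with h | h <;> rw [h]
    · exact hi v hv e
    · exact hj v hv e
  have hval : ∀ u ∈ S, ∀ v ∈ S, ∀ e, t e u v = if Adj t u v then 1 else 0 := by
    intro u hu v hv e
    split_ifs with h
    · obtain ⟨e', he'⟩ := h
      have h1 := hbidir u hu v hv e
      have h2 := ht.eq_one he'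
      cases e <;> cases e' <;> simp_all
    · by_contra h0
      exact h ⟨e, h0⟩
  have hproper : ∀ u ∈ S, ∀ v ∈ S, Adj t u v → α u ≠ α v := by
    intro u hu v hv huv heq
    have hne := ht.ne_of_adj huv
    obtain ⟨w, hw, e, he⟩ := hα (α u) {u, v} (by
      intro w hw
      rw [Finset.mem_insert, Finset.mem_singleton] at hw
      rcases hw with rfl | rfl <;> assumption) (by simp) (by simp [heq])
    have hvu := ht.adj_symm huv
    have hw' : w = u ∨ w = v := by simpa using hw
    rcases hw' with rfl | rfl
    · rw [hone w hu w hu, deg, Finset.sum_pair hne, hval v hv w hu, if_pos hvu] at he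
      omega
    · rw [hone w hv u hu, deg, Finset.sum_pair hne, hval u hu w hv, if_pos huv] at he
      omega
  have hcount : ∀ a b : ι, (∀ v ∈ S, α v = a ∨ α v = b) →
      ∀ v ∈ S.filter fun v => α v = a, ∑ u ∈ S.filter fun u => α u = b, t true u v = 2 := by
    intro a b hab v hv
    rw [Finset.mem_filter] at hv
    rw [← hdeg v hv.1, Finset.sum_congr rfl fun u hu =>
      hval u (Finset.mem_filter.1 hu).1 v hv.1 true, Finset.sum_boole, Finset.filter_filter,
      Nat.cast_id]
    congr 1
    refine Finset.filter_congr fun u hu => ⟨fun h => h.2, fun h => ⟨?_, h⟩⟩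
    have h1 := hproper u hu v hv.1 h
    rw [hv.2] at h1
    exact (hab u hu).resolve_left h1
  have h1 := Finset.sum_congr rfl (hcount i j hcol)
  have h2 := Finset.sum_congr rfl (hcount j i fun v hv => (hcol v hv).symm)
  rw [Finset.sum_comm] at h2
  have h3 : ∑ v ∈ S.filter fun v => α v = i, ∑ u ∈ S.filter fun u => α u = j, t true u v =
      ∑ v ∈ S.filter fun v => α v = i, ∑ u ∈ S.filter fun u => α u = j, t true v u := by
    refine Finset.sum_congr rfl fun v hv => Finset.sum_congr rfl fun u hu => ?_
    rw [Finset.mem_filter] at hu hv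
    rw [hbidir u hu.1 v hv.1, ht.flip]
  rw [h1, h2, Finset.sum_const, Finset.sum_const, smul_eq_mul, smul_eq_mul] at h3
  have h4 : S.card = (S.filter fun v => α v = i).card + (S.filter fun v => α v = j).card := by
    rw [← Finset.card_filter_add_card_filter_not (s := S) fun v => α v = i]
    congr 2
    refine Finset.filter_congr fun v hv => ⟨(hcol v hv).resolve_left, fun h => ?_⟩
    rw [h]
    exact hij.symm
  obtain ⟨m, hm⟩ := hodd
  omega

theorem not_col_join {t₁ t₂ : Bool → ℕ → ℕ → ℕ} {S₁ S₂ : Finset ℕ} {F₁ F₂ : ι → Bool → ℕ → ℕ}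
    (ht : ∀ e u v, t e u v = t₁ e u v + t₂ e u v)
    (hF₁ : ∀ k e, ∀ v ∈ S₁, v ≠ x → F k e v = F₁ k e v)
    (hF₂ : ∀ k e, ∀ v ∈ S₂, v ≠ x → F k e v = F₂ k e v)
    (hFx : ∀ k e, F k e x = F₁ k e x + F₂ k e x) {α : ℕ → ι}
    (h₁ : ¬ Col t₁ S₁ F₁ α) (h₂ : ¬ Col t₂ S₂ F₂ α) : ¬ Col t (S₁ ∪ S₂) F α := by
  intro hα
  have hle₁ : ∀ {U W : Finset ℕ} e v, U ⊆ W → deg t₁ U e v ≤ deg t W e v := fun e v hUW =>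
    (deg_mono hUW e v).trans (Finset.sum_le_sum fun u _ => by rw [ht]; omega)
  have hle₂ : ∀ {U W : Finset ℕ} e v, U ⊆ W → deg t₂ U e v ≤ deg t W e v := fun e v hUW =>
    (deg_mono hUW e v).trans (Finset.sum_le_sum fun u _ => by rw [ht]; omega)
  unfold Col at h₁ h₂
  push Not at h₁ h₂
  obtain ⟨i, U₁, hU₁, hne₁, hc₁, hd₁⟩ := h₁
  obtain ⟨j, U₂, hU₂, hne₂, hc₂, hd₂⟩ := h₂
  have hx₁ : x ∈ U₁ := by
    by_contra hx
    obtain ⟨v, hv, e, he⟩ := hα i U₁ (hU₁.trans Finset.subset_union_left) hne₁ hc₁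
    rw [hF₁ i e v (hU₁ hv) fun h => hx (h ▸ hv)] at he
    exact absurd he (not_lt.2 ((hd₁ v hv e).trans (hle₁ e v (Finset.Subset.refl _))))
  have hx₂ : x ∈ U₂ := by
    by_contra hx
    obtain ⟨v, hv, e, he⟩ := hα j U₂ (hU₂.trans Finset.subset_union_right) hne₂ hc₂
    rw [hF₂ j e v (hU₂ hv) fun h => hx (h ▸ hv)] at he
    exact absurd he (not_lt.2 ((hd₂ v hv e).trans (hle₂ e v (Finset.Subset.refl _))))
  obtain rfl : i = j := (hc₁ x hx₁).symm.trans (hc₂ x hx₂)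
  obtain ⟨v, hv, e, he⟩ := hα i (U₁ ∪ U₂) (Finset.union_subset_union hU₁ hU₂)
    (hne₁.mono Finset.subset_union_left)
    fun v hv => (Finset.mem_union.1 hv).elim (hc₁ v) (hc₂ v)
  by_cases hvx : v = x
  · subst hvx
    have h1 := (hd₁ v hx₁ e).trans (deg_mono (Finset.subset_union_left (s₂ := U₂)) e v)
    have h2 := (hd₂ v hx₂ e).trans (deg_mono (Finset.subset_union_right (s₁ := U₁)) e v)
    have h3 : deg t (U₁ ∪ U₂) e v = deg t₁ (U₁ ∪ U₂) e v + deg t₂ (U₁ ∪ U₂) e v := by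
      simp only [deg, ht, Finset.sum_add_distrib]
    rw [hFx] at he
    omega
  · rcases Finset.mem_union.1 hv with h | h
    · rw [hF₁ i e v (hU₁ h) hvx] at he
      exact absurd he (not_lt.2 ((hd₁ v h e).trans (hle₁ e v Finset.subset_union_left)))
    · rw [hF₂ i e v (hU₂ h) hvx] at he
      exact absurd he (not_lt.2 ((hd₂ v h e).trans (hle₂ e v Finset.subset_union_right)))

theorem wt_join {D D₁ D₂ : Digraph'} (hx : D₁.verts ∩ D₂.verts = {x})
    (hA : D.arcs = D₁.arcs ∪ D₂.arcs) (e : Bool) (u v : ℕ) :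
    wt D e u v = wt D₁ e u v + wt D₂ e u v := by
  have hdisj : ∀ a ∈ D₁.arcs, a ∉ D₂.arcs := by
    intro a ha ha'
    have h1 : a.1 ∈ D₁.verts ∩ D₂.verts := Finset.mem_inter.2 ⟨D₁.mem_fst a ha, D₂.mem_fst a ha'⟩
    have h2 : a.2 ∈ D₁.verts ∩ D₂.verts := Finset.mem_inter.2 ⟨D₁.mem_snd a ha, D₂.mem_snd a ha'⟩
    rw [hx, Finset.mem_singleton] at h1 h2
    exact D₁.no_loops a ha (h1.trans h2.symm)
  have h1 := hdisj (u, v)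
  have h2 := hdisj (v, u)
  cases e <;> simp only [wt, hA, Finset.mem_union] <;> split_ifs <;> simp_all

/-- Hard pairs are not dicolourable. -/
theorem not_col_of_isHardPair {D : Digraph'} {F : Fin s → ℕ → ℕ × ℕ} (h : IsHardPair s D F)
    (hne : D.verts.Nonempty) (α : ℕ → Fin s) : ¬ Col (wt D) D.verts (coord F) α := by
  induction h with
  | @mono D F i hbi hi hk =>
    refine not_col_of_mono hne (i := i) (fun v hv e => ?_)
      (fun k hki v hv e => ?_) α
    · cases e <;> simp [coord, hi v hv, inDeg_eq, outDeg_eq]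
    · cases e <;> simp [coord, hk k hki v hv]
  | @bicycle D F i j hij hD hi hj hk =>
    refine not_col_of_oddCycle (arcWeight_wt D)
      ⟨(bidirected_iff D).1 hD.1, fun v hv => ?_, hD.2.2⟩ (i := i) (j := j) (fun v hv e => ?_)
      (fun v hv e => ?_) hij (fun k hki hkj v hv e => ?_) α
    · have h1 := hD.2.1.2 v hv
      rw [ugNbrs_eq] at h1
      convert h1
    · cases e <;> simp [coord, hi v hv]
    · cases e <;> simp [coord, hj v hv]
    · cases e <;> simp [coord, hk k hki hkj v hv]
  | @complete D F hD hconst hsym hsum =>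
    obtain ⟨v₀, hv₀⟩ := id hne
    refine not_col_of_complete (arcWeight_wt D) hne ((bidirectedComplete_iff D).1 hD)
      (p := fun k => (F k v₀).2) (fun v hv k e => ?_) (hsum v₀ hv₀) α
    have h1 := hsym k v₀ hv₀
    cases e <;> simp [coord, hconst k v hv v₀ hv₀, h1]
  | @join D F D₁ D₂ F₁ F₂ x _ _ hx hV hA hF₁ hF₂ hFx ih₁ ih₂ =>
    have hmem : x ∈ D₁.verts ∩ D₂.verts := by simp [hx]
    rw [Finset.mem_inter] at hmem
    rw [hV]
    refine not_col_join (x := x) (wt_join hx hA) (fun k e v hv hvx => ?_) (fun k e v hv hvx => ?_)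
      (fun k e => ?_) (ih₁ ⟨x, hmem.1⟩) (ih₂ ⟨x, hmem.2⟩)
    · cases e <;> simp [coord, hF₁ k v hv hvx]
    · cases e <;> simp [coord, hF₂ k v hv hvx]
    · cases e <;> simp [coord, hFx k]

end NotColourable

end Dicolouring

/-- **Theorem (Brooks-type for F-dicolouring).** Let `(D,F)` be a valid pair. Then `D` is
`F`-dicolourable if and only if `(D,F)` is not a hard pair. -/
theorem valid_pair_dicolourable_iff_not_hard
    (D : Digraph') (s : ℕ) (F : Fin s → ℕ → ℕ × ℕ)
    (hvalid : D.ValidPair s F) :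
    D.Dicolourable s F ↔ ¬ IsHardPair s D F := by
  obtain ⟨hne, hconn⟩ := (Dicolouring.connected_iff D).1 hvalid.1
  constructor
  · rintro ⟨α, hα⟩ hhard
    exact Dicolouring.not_col_of_isHardPair hhard hne α (Dicolouring.isDicolouring_iff.1 hα)
  · intro hhard
    by_contra hcol
    refine hhard (Dicolouring.isHardPair_of_bad D F hne ⟨hconn, fun v hv e => ?_, fun α hα =>
      hcol ⟨α, Dicolouring.isDicolouring_iff.2 hα⟩⟩)
    have h1 := hvalid.2 v hv
    rw [Dicolouring.inDeg_eq, Dicolouring.outDeg_eq] at h1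
    cases e
    · exact h1.2
    · exact h1.1
end

section
/- Let (D,F = (f₁,f₂)) be a valid tight pair that is not a hard pair, and suppose there is a vertex v ∈ V(D) such that the underlying graph UG(D − v) is a cycle. Then D is F-dicolourable. -/
open scoped Classical

open Digraph'

namespace Digraph'

/-! ### Neighbourhoods, degrees and vertex deletion -/

variable {D H : Digraph'}

lemma mem_inNbrs {u w : ℕ} : w ∈ D.inNbrs u ↔ (w, u) ∈ D.arcs := by
  simp [inNbrs]

lemma mem_outNbrs {u w : ℕ} : w ∈ D.outNbrs u ↔ (u, w) ∈ D.arcs := by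
  simp [outNbrs]

lemma mem_ugNbrs {u w : ℕ} : w ∈ D.ugNbrs u ↔ (w, u) ∈ D.arcs ∨ (u, w) ∈ D.arcs := by
  simp [ugNbrs, mem_inNbrs, mem_outNbrs]

lemma mem_ugNbrs_iff_ugAdj {u w : ℕ} : w ∈ D.ugNbrs u ↔ D.ugAdj u w := by
  rw [mem_ugNbrs, ugAdj]
  constructor
  · rintro (h | h)
    · exact ⟨D.mem_snd _ h, D.mem_fst _ h, Or.inr h⟩
    · exact ⟨D.mem_fst _ h, D.mem_snd _ h, Or.inl h⟩
  · tauto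

lemma ugAdj_of_arc {u w : ℕ} (h : (u, w) ∈ D.arcs) : D.ugAdj u w :=
  ⟨D.mem_fst _ h, D.mem_snd _ h, Or.inl h⟩

lemma ugAdj_symm {u w : ℕ} (h : D.ugAdj u w) : D.ugAdj w u :=
  ⟨h.2.1, h.1, h.2.2.symm⟩

lemma ugAdj_ne {u w : ℕ} (h : D.ugAdj u w) : u ≠ w := by
  rcases h.2.2 with h | h
  · exact D.no_loops _ h
  · exact (D.no_loops _ h).symm

lemma card_inNbrs (u : ℕ) : (D.inNbrs u).card = D.inDeg u := by
  unfold inNbrs inDeg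
  apply Finset.card_image_of_injOn
  rintro ⟨a, b⟩ ha ⟨c, d⟩ hc h
  simp only [Finset.coe_filter, Set.mem_ofPred_eq] at ha hc
  simp_all

lemma card_outNbrs (u : ℕ) : (D.outNbrs u).card = D.outDeg u := by
  unfold outNbrs outDeg
  apply Finset.card_image_of_injOn
  rintro ⟨a, b⟩ ha ⟨c, d⟩ hc h
  simp only [Finset.coe_filter, Set.mem_ofPred_eq] at ha hc
  simp_all

lemma mem_verts_del {x u : ℕ} : u ∈ (D.del {x}).verts ↔ u ∈ D.verts ∧ u ≠ x := by
  simp [del, induce]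

lemma mem_arcs_del {x a b : ℕ} :
    (a, b) ∈ (D.del {x}).arcs ↔ (a, b) ∈ D.arcs ∧ a ≠ x ∧ b ≠ x := by
  simp only [del, induce, Finset.mem_filter, Finset.mem_sdiff, Finset.mem_singleton]
  constructor
  · tauto
  · intro h
    exact ⟨h.1, ⟨D.mem_fst _ h.1, h.2.1⟩, ⟨D.mem_snd _ h.1, h.2.2⟩⟩

lemma ugAdj_del {x a b : ℕ} : (D.del {x}).ugAdj a b ↔ D.ugAdj a b ∧ a ≠ x ∧ b ≠ x := by
  simp only [ugAdj, mem_verts_del, mem_arcs_del]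
  tauto

lemma del_comm (D : Digraph') (x y : ℕ) : (D.del {x}).del {y} = (D.del {y}).del {x} := by
  have ext : ∀ A B : Digraph', A.verts = B.verts → A.arcs = B.arcs → A = B := by
    rintro ⟨⟩ ⟨⟩ h h'
    simp_all
  apply ext
  · ext u
    simp only [mem_verts_del]
    tauto
  · ext ⟨a, b⟩
    simp only [mem_arcs_del]
    tauto

/-- `1` if `(a,b)` is an arc of `D`, and `0` otherwise. -/
noncomputable def arcCount (D : Digraph') (a b : ℕ) : ℕ := if (a, b) ∈ D.arcs then 1 else 0

lemma arcCount_of_mem {a b : ℕ} (h : (a, b) ∈ D.arcs) : D.arcCount a b = 1 := if_pos h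

lemma arcCount_of_notMem {a b : ℕ} (h : (a, b) ∉ D.arcs) : D.arcCount a b = 0 := if_neg h

lemma arcCount_le_one (a b : ℕ) : D.arcCount a b ≤ 1 := by
  unfold arcCount
  split_ifs <;> simp

lemma arcCount_pos_iff {a b : ℕ} : 1 ≤ D.arcCount a b ↔ (a, b) ∈ D.arcs := by
  unfold arcCount
  split_ifs <;> simp_all

lemma inDeg_eq_del {x u : ℕ} (hu : u ≠ x) :
    D.inDeg u = (D.del {x}).inDeg u + D.arcCount x u := by
  rw [← card_inNbrs, ← card_inNbrs]
  have h : (D.del {x}).inNbrs u = (D.inNbrs u).erase x := by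
    ext w
    simp only [mem_inNbrs, mem_arcs_del, Finset.mem_erase]
    tauto
  by_cases hx : (x, u) ∈ D.arcs
  · rw [h, arcCount_of_mem hx, Finset.card_erase_add_one (mem_inNbrs.2 hx)]
  · rw [h, arcCount_of_notMem hx, Finset.erase_eq_of_notMem (mt mem_inNbrs.1 hx), add_zero]

lemma outDeg_eq_del {x u : ℕ} (hu : u ≠ x) :
    D.outDeg u = (D.del {x}).outDeg u + D.arcCount u x := by
  rw [← card_outNbrs, ← card_outNbrs]
  have h : (D.del {x}).outNbrs u = (D.outNbrs u).erase x := by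
    ext w
    simp only [mem_outNbrs, mem_arcs_del, Finset.mem_erase]
    tauto
  by_cases hx : (u, x) ∈ D.arcs
  · rw [h, arcCount_of_mem hx, Finset.card_erase_add_one (mem_outNbrs.2 hx)]
  · rw [h, arcCount_of_notMem hx, Finset.erase_eq_of_notMem (mt mem_outNbrs.1 hx), add_zero]

lemma inDeg_pos {a b : ℕ} (h : (a, b) ∈ D.arcs) : 0 < D.inDeg b := by
  rw [← card_inNbrs]
  exact Finset.card_pos.2 ⟨a, mem_inNbrs.2 h⟩

lemma outDeg_pos {a b : ℕ} (h : (a, b) ∈ D.arcs) : 0 < D.outDeg a := by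
  rw [← card_outNbrs]
  exact Finset.card_pos.2 ⟨b, mem_outNbrs.2 h⟩

lemma arcCount_le_of_subset (h : H.arcs ⊆ D.arcs) (a b : ℕ) : H.arcCount a b ≤ D.arcCount a b := by
  by_cases hab : (a, b) ∈ H.arcs
  · rw [arcCount_of_mem hab, arcCount_of_mem (h hab)]
  · rw [arcCount_of_notMem hab]
    exact Nat.zero_le _

lemma mem_verts_class {s : ℕ} {α : ℕ → Fin s} {i : Fin s} {u : ℕ} :
    u ∈ (D.induce (D.verts.filter fun v => α v = i)).verts ↔ u ∈ D.verts ∧ α u = i := by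
  simp [induce]

lemma mem_arcs_class {s : ℕ} {α : ℕ → Fin s} {i : Fin s} {a b : ℕ} :
    (a, b) ∈ (D.induce (D.verts.filter fun v => α v = i)).arcs ↔
      (a, b) ∈ D.arcs ∧ α a = i ∧ α b = i := by
  simp only [induce, Finset.mem_filter]
  constructor
  · tauto
  · intro h
    exact ⟨h.1, ⟨D.mem_fst _ h.1, h.2.1⟩, ⟨D.mem_snd _ h.1, h.2.2⟩⟩

/-! ### Connectivity -/

lemma reflTransGen_symm {u w : ℕ} (h : Relation.ReflTransGen D.ugAdj u w) :
    Relation.ReflTransGen D.ugAdj w u := by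
  induction h with
  | refl => exact .refl
  | tail _ hab ih => exact .head (ugAdj_symm hab) ih

lemma connected_of_reach {c : ℕ} (hc : c ∈ D.verts)
    (h : ∀ u ∈ D.verts, Relation.ReflTransGen D.ugAdj c u) : D.Connected :=
  ⟨⟨c, hc⟩, fun u hu w hw => (reflTransGen_symm (h u hu)).trans (h w hw)⟩

lemma connected_of_dominating {c : ℕ} (hc : c ∈ D.verts)
    (h : ∀ u ∈ D.verts, u ≠ c → D.ugAdj c u) : D.Connected := by
  refine connected_of_reach hc fun u hu => ?_
  by_cases huc : u = c
  · rw [huc]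
  · exact .single (h u hu huc)

lemma connected_of_del {x w : ℕ} (hxw : D.ugAdj x w) (h : (D.del {x}).Connected) :
    D.Connected := by
  refine connected_of_reach hxw.1 fun u hu => ?_
  by_cases hux : u = x
  · rw [hux]
  · have hwu := h.2 w (mem_verts_del.2 ⟨hxw.2.1, (ugAdj_ne hxw).symm⟩) u (mem_verts_del.2 ⟨hu, hux⟩)
    exact .head hxw (hwu.lift id fun a b hab => (ugAdj_del.1 hab).1)

lemma Connected.exists_ugAdj (h : D.Connected) {x y : ℕ} (hx : x ∈ D.verts) (hy : y ∈ D.verts)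
    (hxy : x ≠ y) : ∃ w, D.ugAdj x w := by
  rcases Relation.ReflTransGen.cases_head (h.2 x hx y hy) with h | ⟨w, hw, _⟩
  · exact absurd h hxy
  · exact ⟨w, hw⟩

lemma Connected.forall_of_closed (h : D.Connected) {P : ℕ → Prop} {x : ℕ} (hx : x ∈ D.verts)
    (hP : P x) (hstep : ∀ a b, D.ugAdj a b → P a → P b) : ∀ u ∈ D.verts, P u := by
  intro u hu
  have := h.2 x hx u hu
  induction this with
  | refl => exact hP
  | tail _ hab ih => exact hstep _ _ hab (ih hab.1)

/-! ### Cycles -/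

/-- A closed enumeration `p 0, …, p n = p 0` of a digraph whose underlying graph is a cycle. -/
lemma IsCycleUG.exists_enum (hC : D.IsCycleUG) {x : ℕ} (hx : x ∈ D.verts) :
    ∃ (n : ℕ) (p : ℕ → ℕ), 0 < n ∧ p 0 = x ∧ p n = x ∧ Set.InjOn p {i | i < n} ∧
      (∀ u, u ∈ D.verts ↔ ∃ i < n, p i = u) ∧ (∀ i < n, D.ugAdj (p i) (p (i + 1))) ∧
      ∀ a b, D.ugAdj a b → ∃ i < n, (p i = a ∧ p (i + 1) = b) ∨ (p i = b ∧ p (i + 1) = a) := by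
  let G : SimpleGraph {u // u ∈ D.verts} :=
    { Adj := fun a b => D.ugAdj a b
      symm := ⟨fun a b h => ugAdj_symm h⟩
      loopless := ⟨fun a h => ugAdj_ne h rfl⟩ }
  have hGadj : ∀ a b, G.Adj a b ↔ D.ugAdj a b := fun a b => Iff.rfl
  have hcard : ∀ a, (G.neighborSet a).ncard = 2 := by
    intro a
    rw [← hC.2 a a.2, ← Set.ncard_coe_finset,
      ← Set.ncard_image_of_injective _ Subtype.val_injective]
    congr 1
    ext w
    simp only [Set.mem_image, SimpleGraph.mem_neighborSet, Finset.mem_coe, mem_ugNbrs_iff_ugAdj]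
    constructor
    · rintro ⟨b, hb, rfl⟩
      exact hb
    · intro h
      exact ⟨⟨w, h.2.1⟩, h, rfl⟩
  have hcyc : G.IsCycles := fun a _ => hcard a
  have hreach : ∀ u (hu : u ∈ D.verts), G.Reachable ⟨x, hx⟩ ⟨u, hu⟩ := by
    intro u hu
    have h := hC.1.2 x hx u hu
    induction h with
    | refl => exact .refl _
    | @tail b c _ hbc ih =>
      exact (ih hbc.1).trans (SimpleGraph.Adj.reachable ((hGadj ⟨b, _⟩ ⟨c, _⟩).2 hbc))
  have hne : (G.neighborSet ⟨x, hx⟩).Nonempty := by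
    rw [← Set.ncard_pos, hcard]
    norm_num
  obtain ⟨p, hp, hverts⟩ := hcyc.exists_cycle_toSubgraph_verts_eq_connectedComponentSupp
    (c := G.connectedComponentMk ⟨x, hx⟩) rfl hne
  have hall : ∀ u, u ∈ p.toSubgraph.verts := by
    intro u
    rw [hverts, SimpleGraph.ConnectedComponent.mem_supp_iff, SimpleGraph.ConnectedComponent.eq]
    exact (hreach u u.2).symm
  have hlen := hp.three_le_length
  refine ⟨p.length, fun i => p.getVert i, by omega, by simp, by simp, ?_, ?_, ?_, ?_⟩
  · intro i hi j hj hij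
    simp only [Set.mem_ofPred_eq] at hi hj
    exact hp.getVert_injOn' (by simp only [Set.mem_ofPred_eq]; omega)
      (by simp only [Set.mem_ofPred_eq]; omega) (Subtype.ext hij)
  · intro u
    constructor
    · intro hu
      have h := hall ⟨u, hu⟩
      rw [SimpleGraph.Walk.mem_verts_toSubgraph, SimpleGraph.Walk.mem_support_iff_exists_getVert]
        at h
      obtain ⟨i, hi, hle⟩ := h
      rcases hle.lt_or_eq with hlt | rfl
      · exact ⟨i, hlt, congrArg Subtype.val hi⟩
      · refine ⟨0, by omega, ?_⟩
        rw [SimpleGraph.Walk.getVert_length] at hi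
        simpa using congrArg Subtype.val hi
    · rintro ⟨i, _, rfl⟩
      exact (p.getVert i).2
  · intro i hi
    exact p.adj_getVert_succ hi
  · intro a b hab
    have : G.LocallyFinite := fun _ => Fintype.ofFinite _
    have h := (hp.adj_toSubgraph_iff_of_isCycles hcyc (hall ⟨a, hab.1⟩) ⟨b, hab.2.1⟩).2 hab
    rw [SimpleGraph.Walk.toSubgraph_adj_iff] at h
    obtain ⟨i, hi, hlt⟩ := h
    refine ⟨i, hlt, ?_⟩
    rw [Sym2.eq_iff] at hi
    rcases hi with ⟨h1, h2⟩ | ⟨h1, h2⟩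
    · exact Or.inl ⟨congrArg Subtype.val h1, congrArg Subtype.val h2⟩
    · exact Or.inr ⟨congrArg Subtype.val h1, congrArg Subtype.val h2⟩

lemma IsCycleUG.del_connected (hC : D.IsCycleUG) {x : ℕ} (hx : x ∈ D.verts) :
    (D.del {x}).Connected := by
  obtain ⟨n, p, hn, h0, hpn, hinj, hverts, hadj, -⟩ := hC.exists_enum hx
  have hne : ∀ i, 1 ≤ i → i < n → p i ≠ x := by
    intro i hi hin h
    have := hinj (show i < n from hin) (show 0 < n from hn) (by rw [h, h0])
    omega
  have hn1 : 1 < n := by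
    by_contra h
    have h1 : n = 1 := by omega
    subst h1
    have := hadj 0 hn
    rw [h0, zero_add, hpn] at this
    exact ugAdj_ne this rfl
  refine connected_of_reach (c := p 1)
    (mem_verts_del.2 ⟨(hverts _).2 ⟨1, hn1, rfl⟩, hne 1 le_rfl hn1⟩) ?_
  have key : ∀ i, 1 ≤ i → i < n → Relation.ReflTransGen (D.del {x}).ugAdj (p 1) (p i) := by
    intro i hi
    induction i, hi using Nat.le_induction with
    | base => exact fun _ => .refl
    | succ i hi ih =>
      intro h
      exact .tail (ih (by omega))
        (ugAdj_del.2 ⟨hadj i (by omega), hne i hi (by omega), hne (i + 1) (by omega) h⟩)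
  intro u hu
  rw [mem_verts_del] at hu
  obtain ⟨i, hi, rfl⟩ := (hverts u).1 hu.1
  refine key i ?_ hi
  rcases Nat.eq_zero_or_pos i with rfl | h
  · exact absurd h0 hu.2
  · exact h

lemma IsCycleUG.exists_two_colouring (hC : D.IsCycleUG) (heven : Even D.verts.card) :
    ∃ α : ℕ → Fin 2, ∀ a b, D.ugAdj a b → α a ≠ α b := by
  obtain ⟨x, hx⟩ := hC.1.1
  obtain ⟨n, p, hn, h0, hpn, hinj, hverts, -, hadj⟩ := hC.exists_enum hx
  have hcard : D.verts.card = n := by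
    have : D.verts = (Finset.range n).image p := by
      ext u
      simp [hverts]
    rw [this, Finset.card_image_of_injOn (by simpa [Set.InjOn] using hinj), Finset.card_range]
  rw [hcard] at heven
  let α : ℕ → Fin 2 := fun u => if ∃ i < n, p i = u ∧ Even i then 0 else 1
  have hα : ∀ i, i < n → (α (p i) = 0 ↔ Even i) := by
    intro i hi
    have : (∃ j < n, p j = p i ∧ Even j) ↔ Even i := by
      constructor
      · rintro ⟨j, hj, hji, he⟩
        rwa [← hinj (show j < n from hj) (show i < n from hi) hji]
      · exact fun h => ⟨i, hi, rfl, h⟩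
    simp [α, this]
  have hα' : ∀ i, i ≤ n → (α (p i) = 0 ↔ Even i) := by
    intro i hi
    rcases hi.lt_or_eq with h | rfl
    · exact hα i h
    · rw [hpn, ← h0, hα 0 hn]
      simp [heven]
  have hstep : ∀ i < n, α (p i) ≠ α (p (i + 1)) := by
    intro i hi h
    have h1 := hα' i hi.le
    have h2 := hα' (i + 1) hi
    rw [h, h2, Nat.even_add_one] at h1
    tauto
  refine ⟨α, fun a b hab => ?_⟩
  obtain ⟨i, hi, ⟨rfl, rfl⟩ | ⟨rfl, rfl⟩⟩ := hadj a b hab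
  · exact hstep i hi
  · exact (hstep i hi).symm

/-! ### Greedy colouring -/

/-- The budget at `u` strictly exceeds the in-degree or the out-degree. -/
def Excess (D : Digraph') {s : ℕ} (F : Fin s → ℕ → ℕ × ℕ) (u : ℕ) : Prop :=
  u ∈ D.verts ∧ (D.inDeg u < ∑ i, (F i u).1 ∨ D.outDeg u < ∑ i, (F i u).2)

variable {s : ℕ} {F : Fin s → ℕ → ℕ × ℕ}

lemma excess_del_of_ugAdj {y u : ℕ} (hadj : D.ugAdj u y)
    (hle : D.inDeg u ≤ ∑ i, (F i u).1 ∧ D.outDeg u ≤ ∑ i, (F i u).2) :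
    (D.del {y}).Excess F u := by
  have huy := ugAdj_ne hadj
  refine ⟨mem_verts_del.2 ⟨hadj.1, huy⟩, ?_⟩
  rw [inDeg_eq_del huy, outDeg_eq_del huy] at hle
  rcases hadj.2.2 with h | h
  · rw [arcCount_of_mem h] at hle
    omega
  · rw [arcCount_of_mem h] at hle
    omega

lemma Excess.del {y u : ℕ} (h : D.Excess F u) (huy : u ≠ y) : (D.del {y}).Excess F u := by
  refine ⟨mem_verts_del.2 ⟨h.1, huy⟩, ?_⟩
  have h2 := h.2
  rw [inDeg_eq_del huy, outDeg_eq_del huy] at h2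
  omega

/-- A dicolouring of `D − y` extends to a vertex `y` with excess budget. -/
lemma dicolourable_of_del_of_excess {y : ℕ} (hy : D.Excess F y)
    (h : (D.del {y}).Dicolourable s F) : D.Dicolourable s F := by
  obtain ⟨α, hα⟩ := h
  have hfib : ∀ S : Finset ℕ, S.card = ∑ i, (S.filter fun w => α w = i).card := fun S =>
    Finset.card_eq_sum_card_fiberwise fun _ _ => Finset.mem_coe.2 (Finset.mem_univ _)
  have hcol : ∃ i, ((D.inNbrs y).filter fun w => α w = i).card < (F i y).1 ∨
      ((D.outNbrs y).filter fun w => α w = i).card < (F i y).2 := by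
    by_contra! hcon
    rcases hy.2 with hlt | hlt
    · rw [← card_inNbrs, hfib] at hlt
      exact absurd (Finset.sum_le_sum fun i _ => (hcon i).1) (not_le.2 hlt)
    · rw [← card_outNbrs, hfib] at hlt
      exact absurd (Finset.sum_le_sum fun i _ => (hcon i).2) (not_le.2 hlt)
  obtain ⟨i, hi⟩ := hcol
  refine ⟨Function.update α y i, fun k H hH hne => ?_⟩
  have hcl : ∀ w ∈ H.verts, w ∈ D.verts ∧ Function.update α y i w = k := fun w hw =>
    mem_verts_class.1 (hH.1 hw)
  have harc : ∀ a b, (a, b) ∈ H.arcs → (a, b) ∈ D.arcs := fun a b hab =>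
    (mem_arcs_class.1 (hH.2 hab)).1
  by_cases hyH : y ∈ H.verts
  · have hk : i = k := by simpa using (hcl y hyH).2
    subst hk
    have hα' : ∀ w ∈ H.verts, w ≠ y → α w = i := fun w hw hwy => by
      simpa [hwy] using (hcl w hw).2
    refine ⟨y, hyH, hi.imp (fun h => lt_of_le_of_lt ?_ h) (fun h => lt_of_le_of_lt ?_ h)⟩
    · rw [← card_inNbrs]
      refine Finset.card_le_card fun w hw => ?_
      rw [mem_inNbrs] at hw
      exact Finset.mem_filter.2 ⟨mem_inNbrs.2 (harc _ _ hw),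
        hα' w (H.mem_fst _ hw) (H.no_loops _ hw)⟩
    · rw [← card_outNbrs]
      refine Finset.card_le_card fun w hw => ?_
      rw [mem_outNbrs] at hw
      exact Finset.mem_filter.2 ⟨mem_outNbrs.2 (harc _ _ hw),
        hα' w (H.mem_snd _ hw) (H.no_loops _ hw).symm⟩
  · have hα' : ∀ w ∈ H.verts, α w = k := fun w hw => by
      have hwy : w ≠ y := fun h => hyH (h ▸ hw)
      simpa [hwy] using (hcl w hw).2
    refine hα k H ⟨fun w hw => ?_, ?_⟩ hne
    · exact mem_verts_class.2
        ⟨mem_verts_del.2 ⟨(hcl w hw).1, fun h => hyH (h ▸ hw)⟩, hα' w hw⟩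
    · rintro ⟨a, b⟩ hab
      have ha := H.mem_fst _ hab
      have hb := H.mem_snd _ hab
      exact mem_arcs_class.2 ⟨mem_arcs_del.2
        ⟨harc _ _ hab, fun h => hyH (h ▸ ha), fun h => hyH (h ▸ hb)⟩, hα' _ ha, hα' _ hb⟩

lemma dicolourable_of_reach_excess (D : Digraph')
    (hle : ∀ u ∈ D.verts, D.inDeg u ≤ ∑ i, (F i u).1 ∧ D.outDeg u ≤ ∑ i, (F i u).2)
    (hreach : ∀ u ∈ D.verts, ∃ z, D.Excess F z ∧ Relation.ReflTransGen D.ugAdj u z)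
    (hs : 0 < s) : D.Dicolourable s F := by
  induction hn : D.verts.card generalizing D with
  | zero =>
    refine ⟨fun _ => ⟨0, hs⟩, fun k H hH hne => ?_⟩
    obtain ⟨u, hu⟩ := hne
    have := (mem_verts_class.1 (hH.1 hu)).1
    rw [Finset.card_eq_zero] at hn
    simp [hn] at this
  | succ n ih =>
    obtain ⟨u, hu⟩ : D.verts.Nonempty := Finset.card_pos.1 (by omega)
    obtain ⟨y, hy, -⟩ := hreach u hu
    refine dicolourable_of_del_of_excess hy (ih _ ?_ ?_ ?_)
    · intro w hw
      have hwy := (mem_verts_del.1 hw).2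
      have := hle w (mem_verts_del.1 hw).1
      rw [inDeg_eq_del hwy, outDeg_eq_del hwy] at this
      omega
    · intro w hw
      have hwy := (mem_verts_del.1 hw).2
      obtain ⟨z, hz, hwz⟩ := hreach w (mem_verts_del.1 hw).1
      clear hw
      induction hwz using Relation.ReflTransGen.head_induction_on with
      | refl => exact ⟨z, hz.del hwy, .refl⟩
      | @head a b hab _ ihb =>
        by_cases hby : b = y
        · subst hby
          exact ⟨a, excess_del_of_ugAdj hab (hle a hab.1), .refl⟩
        · obtain ⟨z', hz', hbz⟩ := ihb hby
          exact ⟨z', hz', .head (ugAdj_del.2 ⟨hab, hwy, hby⟩) hbz⟩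
    · have : (D.del {y}).verts = D.verts.erase y := by
        ext w
        rw [mem_verts_del, Finset.mem_erase, and_comm]
      rw [this, Finset.card_erase_of_mem hy.1, hn, Nat.add_sub_cancel]

lemma ValidPair.dicolourable_of_excess (h : D.ValidPair s F) (hs : 0 < s) {y : ℕ}
    (hy : D.Excess F y) : D.Dicolourable s F :=
  dicolourable_of_reach_excess D h.2 (fun u hu => ⟨y, hy, h.1.2 u hu y hy.1⟩) hs

/-! ### Colouring one vertex first -/

/-- The budgets left on `D − x` once `x` has received colour `i`. -/
noncomputable def reduceAt (D : Digraph') (F : Fin s → ℕ → ℕ × ℕ) (x : ℕ) (i : Fin s) :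
    Fin s → ℕ → ℕ × ℕ :=
  fun k u => if k = i then ((F k u).1 - D.arcCount x u, (F k u).2 - D.arcCount u x) else F k u

lemma reduceAt_self (x u : ℕ) (i : Fin s) : D.reduceAt F x i i u =
    ((F i u).1 - D.arcCount x u, (F i u).2 - D.arcCount u x) := if_pos rfl

lemma reduceAt_of_ne {i k : Fin s} (h : k ≠ i) (x : ℕ) : D.reduceAt F x i k = F k := by
  funext u
  exact if_neg h

lemma dicolourable_of_reduceAt {x : ℕ} {i : Fin s} (hi : F i x ≠ (0, 0))
    (h : (D.del {x}).Dicolourable s (D.reduceAt F x i)) : D.Dicolourable s F := by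
  obtain ⟨α, hα⟩ := h
  refine ⟨Function.update α x i, fun k H hH hne => ?_⟩
  have hcl : ∀ w ∈ H.verts, w ∈ D.verts ∧ Function.update α x i w = k := fun w hw =>
    mem_verts_class.1 (hH.1 hw)
  have harc : ∀ a b, (a, b) ∈ H.arcs → (a, b) ∈ D.arcs := fun a b hab =>
    (mem_arcs_class.1 (hH.2 hab)).1
  have hα' : ∀ w ∈ H.verts, w ≠ x → α w = k := fun w hw hwx => by
    simpa [hwx] using (hcl w hw).2
  have hsub : (H.del {x}).IsSubdigraph
      ((D.del {x}).induce ((D.del {x}).verts.filter fun v => α v = k)) := by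
    refine ⟨fun w hw => ?_, ?_⟩
    · rw [mem_verts_del] at hw
      exact mem_verts_class.2 ⟨mem_verts_del.2 ⟨(hcl w hw.1).1, hw.2⟩, hα' w hw.1 hw.2⟩
    · rintro ⟨a, b⟩ hab
      rw [mem_arcs_del] at hab
      exact mem_arcs_class.2 ⟨mem_arcs_del.2 ⟨harc _ _ hab.1, hab.2⟩,
        hα' _ (H.mem_fst _ hab.1) hab.2.1, hα' _ (H.mem_snd _ hab.1) hab.2.2⟩
  by_cases hne' : (H.del {x}).verts.Nonempty
  · obtain ⟨u, hu, hlt⟩ := hα k _ hsub hne'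
    rw [mem_verts_del] at hu
    refine ⟨u, hu.1, ?_⟩
    rw [inDeg_eq_del hu.2, outDeg_eq_del hu.2]
    have hin := arcCount_le_of_subset (fun a ha => harc a.1 a.2 ha) (D := D) x u
    have hout := arcCount_le_of_subset (fun a ha => harc a.1 a.2 ha) (D := D) u x
    by_cases hk : k = i
    · subst hk
      rw [reduceAt_self] at hlt
      simp only at hlt
      omega
    · have hxH : x ∉ H.verts := fun hx => hk (by simpa using (hcl x hx).2.symm)
      rw [reduceAt_of_ne hk] at hlt
      rw [arcCount_of_notMem fun h => hxH (H.mem_fst _ h),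
        arcCount_of_notMem fun h => hxH (H.mem_snd _ h)]
      simpa using hlt
  · have honly : ∀ w ∈ H.verts, w = x := fun w hw => by
      by_contra hwx
      exact hne' ⟨w, mem_verts_del.2 ⟨hw, hwx⟩⟩
    obtain ⟨w, hw⟩ := hne
    obtain rfl := honly w hw
    have hk : i = k := by simpa using (hcl w hw).2
    subst hk
    have hnoarc : H.arcs = ∅ := by
      rw [Finset.eq_empty_iff_forall_notMem]
      intro a ha
      exact H.no_loops a ha
        ((honly _ (H.mem_fst a ha)).trans (honly _ (H.mem_snd a ha)).symm)
    refine ⟨w, hw, ?_⟩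
    have h0 : H.inDeg w = 0 ∧ H.outDeg w = 0 := by simp [inDeg, outDeg, hnoarc]
    rw [h0.1, h0.2]
    by_contra! hcon
    exact hi (Prod.ext (by simpa using hcon.1) (by simpa using hcon.2))

lemma dicolourable_of_proper {α : ℕ → Fin s} (hα : ∀ a b, D.ugAdj a b → α a ≠ α b)
    (hF : ∀ i, ∀ u ∈ D.verts, F i u ≠ (0, 0)) : D.Dicolourable s F := by
  refine ⟨α, fun k H hH hne => ?_⟩
  obtain ⟨u, hu⟩ := hne
  have hnoarc : H.arcs = ∅ := by
    rw [Finset.eq_empty_iff_forall_notMem]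
    rintro ⟨a, b⟩ hab
    have h := mem_arcs_class.1 (hH.2 hab)
    exact hα a b (ugAdj_of_arc h.1) (h.2.1.trans h.2.2.symm)
  refine ⟨u, hu, ?_⟩
  have h0 : H.inDeg u = 0 ∧ H.outDeg u = 0 := by simp [inDeg, outDeg, hnoarc]
  rw [h0.1, h0.2]
  by_contra! hcon
  exact hF k u (mem_verts_class.1 (hH.1 hu)).1
    (Prod.ext (by simpa using hcon.1) (by simpa using hcon.2))

/-! ### Valid pairs with two colours that are not dicolourable -/

/-- A valid pair with two colours that is not dicolourable. -/
structure Obstruction (D : Digraph') (F : Fin 2 → ℕ → ℕ × ℕ) : Prop where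
  valid : D.ValidPair 2 F
  not_dicolourable : ¬ D.Dicolourable 2 F

namespace Obstruction

variable {F : Fin 2 → ℕ → ℕ × ℕ} {i j : Fin 2}

lemma sum_two (hij : i ≠ j) (g : Fin 2 → ℕ) : ∑ k, g k = g i + g j := by
  rw [Fin.sum_univ_two]
  fin_cases i <;> fin_cases j <;> simp_all [add_comm]

lemma eq_or_eq (hij : i ≠ j) (k : Fin 2) : k = i ∨ k = j := by
  omega

lemma tight (h : D.Obstruction F) (hij : i ≠ j) {u : ℕ} (hu : u ∈ D.verts) :
    (F i u).1 + (F j u).1 = D.inDeg u ∧ (F i u).2 + (F j u).2 = D.outDeg u := by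
  have hle := h.valid.2 u hu
  by_contra hcon
  refine h.not_dicolourable (h.valid.dicolourable_of_excess (by norm_num) (y := u) ⟨hu, ?_⟩)
  rw [sum_two hij, sum_two hij] at *
  omega

/-- Colouring a non-cut vertex first with an available colour leaves an obstruction, and the
budgets of its neighbours are large enough for this not to be a truncated subtraction. -/
lemma reduce (h : D.Obstruction F) {x : ℕ} (hi : F i x ≠ (0, 0))
    (hconn : (D.del {x}).Connected) :
    (D.del {x}).Obstruction (D.reduceAt F x i) ∧
      ∀ u ∈ D.verts, u ≠ x → D.arcCount x u ≤ (F i u).1 ∧ D.arcCount u x ≤ (F i u).2 := by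
  obtain ⟨j, hj⟩ := exists_ne i
  have hred : (D.del {x}).Obstruction (D.reduceAt F x i) := by
    refine ⟨⟨hconn, fun u hu => ?_⟩, fun hcol => h.not_dicolourable
      (dicolourable_of_reduceAt hi hcol)⟩
    rw [mem_verts_del] at hu
    have ht := h.tight hj.symm hu.1
    rw [inDeg_eq_del hu.2, outDeg_eq_del hu.2] at ht
    rw [sum_two hj.symm, sum_two hj.symm, reduceAt_self, reduceAt_of_ne hj]
    simp only
    omega
  refine ⟨hred, fun u hu hux => ?_⟩
  have ht := h.tight hj.symm hu
  have ht' := hred.tight hj.symm (mem_verts_del.2 ⟨hu, hux⟩)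
  rw [reduceAt_self, reduceAt_of_ne hj] at ht'
  rw [inDeg_eq_del hux, outDeg_eq_del hux] at ht
  simp only at ht'
  omega

lemma ne_zero_of_ugAdj (h : D.Obstruction F) {x u : ℕ} (hi : F i x ≠ (0, 0))
    (hconn : (D.del {x}).Connected) (hadj : D.ugAdj x u) : F i u ≠ (0, 0) := by
  intro h0
  have hle := (h.reduce hi hconn).2 u hadj.2.1 (ugAdj_ne hadj).symm
  rw [h0] at hle
  rcases hadj.2.2 with h | h
  · rw [arcCount_of_mem h] at hle
    simp at hle
  · rw [arcCount_of_mem h] at hle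
    simp at hle

lemma forall_ne_zero (h : D.Obstruction F) (hconn : ∀ x ∈ D.verts, (D.del {x}).Connected)
    (hne : ¬ ∀ x ∈ D.verts, F i x = (0, 0)) : ∀ u ∈ D.verts, F i u ≠ (0, 0) := by
  push Not at hne
  obtain ⟨x, hx, hix⟩ := hne
  exact h.valid.1.forall_of_closed hx hix fun a b hab ha =>
    h.ne_zero_of_ugAdj ha (hconn a hab.1) hab

lemma one_le_of_arc (h : D.Obstruction F) (hconn : ∀ x ∈ D.verts, (D.del {x}).Connected)
    (hne : ∀ u ∈ D.verts, F i u ≠ (0, 0)) {a b : ℕ} (hab : (a, b) ∈ D.arcs) :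
    1 ≤ (F i b).1 ∧ 1 ≤ (F i a).2 := by
  have ha := D.mem_fst _ hab
  have hb := D.mem_snd _ hab
  have h1 := ((h.reduce (hne a ha) (hconn a ha)).2 b hb (D.no_loops _ hab).symm).1
  have h2 := ((h.reduce (hne b hb) (hconn b hb)).2 a ha (D.no_loops _ hab)).2
  rw [arcCount_of_mem hab] at h1 h2
  exact ⟨h1, h2⟩

/-- If one of the two functions vanishes, the other one gives the degrees. -/
lemma eq_deg_of_eq_zero (h : D.Obstruction F) (hij : i ≠ j) {u : ℕ} (hu : u ∈ D.verts)
    (h0 : F j u = (0, 0)) : F i u = (D.inDeg u, D.outDeg u) := by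
  have ht := h.tight hij hu
  rw [h0] at ht
  exact Prod.ext (by simpa using ht.1) (by simpa using ht.2)

/-- An obstruction on a cycle is either monochromatic or a bidirected odd cycle. -/
lemma cycle (h : D.Obstruction F) (hC : D.IsCycleUG) :
    (∃ j, ∀ u ∈ D.verts, F j u = (0, 0)) ∨
      (D.Bidirected ∧ Odd D.verts.card ∧ ∀ k, ∀ u ∈ D.verts, F k u = (1, 1)) := by
  by_cases hmono : ∃ j, ∀ u ∈ D.verts, F j u = (0, 0)
  · exact Or.inl hmono
  right
  have hconn : ∀ x ∈ D.verts, (D.del {x}).Connected := fun x hx => hC.del_connected hx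
  have hne : ∀ k, ∀ u ∈ D.verts, F k u ≠ (0, 0) := fun k =>
    h.forall_ne_zero hconn fun h0 => hmono ⟨k, h0⟩
  have hnoprop : ¬ ∃ α : ℕ → Fin 2, ∀ a b, D.ugAdj a b → α a ≠ α b := fun ⟨α, hα⟩ =>
    h.not_dicolourable (dicolourable_of_proper hα hne)
  have hin : ∀ u, D.inNbrs u ⊆ D.ugNbrs u := fun u => Finset.subset_union_left
  have hout : ∀ u, D.outNbrs u ⊆ D.ugNbrs u := fun u => Finset.subset_union_right
  have harc : ∀ a b, (a, b) ∈ D.arcs → D.inNbrs b = D.ugNbrs b ∧ D.outNbrs a = D.ugNbrs a := by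
    intro a b hab
    have ha : a ∈ D.verts := D.mem_fst _ hab
    have hb : b ∈ D.verts := D.mem_snd _ hab
    have h0 := h.one_le_of_arc hconn (hne 0) hab
    have h1 := h.one_le_of_arc hconn (hne 1) hab
    have ta := (h.tight (i := 0) (j := 1) (by decide) ha).2
    have tb := (h.tight (i := 0) (j := 1) (by decide) hb).1
    constructor
    · refine Finset.eq_of_subset_of_card_le (hin b) ?_
      rw [hC.2 b hb, card_inNbrs]
      omega
    · refine Finset.eq_of_subset_of_card_le (hout a) ?_
      rw [hC.2 a ha, card_outNbrs]
      omega
  have hboth : ∃ a b c, (a, b) ∈ D.arcs ∧ (b, c) ∈ D.arcs := by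
    by_contra! hcon
    refine hnoprop ⟨fun u => if D.inNbrs u = ∅ then 0 else 1, ?_⟩
    have key : ∀ a b, (a, b) ∈ D.arcs → D.inNbrs a = ∅ ∧ D.inNbrs b ≠ ∅ := by
      intro a b hab
      constructor
      · rw [Finset.eq_empty_iff_forall_notMem]
        exact fun c hc => hcon c a b (mem_inNbrs.1 hc) hab
      · exact Finset.ne_empty_of_mem (mem_inNbrs.2 hab)
    intro a b hab
    rcases hab.2.2 with hab | hab
    · simp [key _ _ hab]
    · simp [key _ _ hab]
  have hfull : ∀ u ∈ D.verts, D.inNbrs u = D.ugNbrs u ∧ D.outNbrs u = D.ugNbrs u := by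
    obtain ⟨a, b, c, hab, hbc⟩ := hboth
    refine h.valid.1.forall_of_closed (D.mem_snd _ hab) ⟨(harc _ _ hab).1, (harc _ _ hbc).2⟩ ?_
    rintro x y hxy ⟨hxin, hxout⟩
    have hy := mem_ugNbrs_iff_ugAdj.2 hxy
    exact ⟨(harc x y (mem_outNbrs.1 (hxout ▸ hy))).1, (harc y x (mem_inNbrs.1 (hxin ▸ hy))).2⟩
  refine ⟨?_, ?_, ?_⟩
  · rintro ⟨a, b⟩ hab
    have hb : b ∈ D.ugNbrs a := mem_ugNbrs.2 (Or.inr hab)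
    rw [← (hfull a (D.mem_fst _ hab)).1] at hb
    exact mem_inNbrs.1 hb
  · by_contra hodd
    exact hnoprop (hC.exists_two_colouring (Nat.not_odd_iff_even.1 hodd))
  · intro k u hu
    obtain ⟨l, hl⟩ := exists_ne k
    have ht := h.tight hl.symm hu
    obtain ⟨hui, huo⟩ := hfull u hu
    rw [← card_inNbrs, ← card_outNbrs, hui, huo, hC.2 u hu] at ht
    obtain ⟨w, hw⟩ : (D.ugNbrs u).Nonempty := Finset.card_pos.1 (by rw [hC.2 u hu]; norm_num)
    have hwu : (w, u) ∈ D.arcs := mem_inNbrs.1 (hui ▸ hw)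
    have huw : (u, w) ∈ D.arcs := mem_outNbrs.1 (huo ▸ hw)
    have hk1 := (h.one_le_of_arc hconn (hne k) hwu).1
    have hk2 := (h.one_le_of_arc hconn (hne k) huw).2
    have hl1 := (h.one_le_of_arc hconn (hne l) hwu).1
    have hl2 := (h.one_le_of_arc hconn (hne l) huw).2
    exact Prod.ext (show (F k u).1 = 1 by omega) (show (F k u).2 = 1 by omega)

lemma biconnected_cycle (hC : D.IsCycleUG) : D.Biconnected := by
  refine ⟨?_, hC.1, fun x hx => hC.del_connected hx⟩
  obtain ⟨x, hx⟩ := hC.1.1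
  rw [← hC.2 x hx]
  exact Finset.card_le_card fun w hw => (mem_ugNbrs_iff_ugAdj.1 hw).2.1

lemma hard_of_cycle (h : D.Obstruction F) (hC : D.IsCycleUG) : IsHardPair 2 D F := by
  rcases h.cycle hC with ⟨j, hj⟩ | ⟨hbi, hodd, hF⟩
  · obtain ⟨i, hi⟩ := exists_ne j
    refine .mono i (biconnected_cycle hC) (fun u hu => h.eq_deg_of_eq_zero hi hu (hj u hu)) ?_
    intro k hk u hu
    rw [(eq_or_eq hi k).resolve_left hk, hj u hu]
  · refine .bicycle 0 1 (by decide) ⟨hbi, hC, hodd⟩ (hF 0) (hF 1) ?_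
    intro k h0 h1
    omega

/-! ### A cycle with a pendant vertex -/

lemma inDeg_eq_arcCount {u w : ℕ} (h : ∀ a, (a, u) ∈ D.arcs → a = w) :
    D.inDeg u = D.arcCount w u := by
  by_cases hw : (w, u) ∈ D.arcs
  · rw [arcCount_of_mem hw, ← card_inNbrs, Finset.card_eq_one]
    refine ⟨w, Finset.eq_singleton_iff_unique_mem.2 ⟨mem_inNbrs.2 hw, fun a ha => ?_⟩⟩
    exact h a (mem_inNbrs.1 ha)
  · rw [arcCount_of_notMem hw, ← card_inNbrs, Finset.card_eq_zero,
      Finset.eq_empty_iff_forall_notMem]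
    intro a ha
    rw [mem_inNbrs] at ha
    exact hw (h a ha ▸ ha)

lemma outDeg_eq_arcCount {u w : ℕ} (h : ∀ a, (u, a) ∈ D.arcs → a = w) :
    D.outDeg u = D.arcCount u w := by
  by_cases hw : (u, w) ∈ D.arcs
  · rw [arcCount_of_mem hw, ← card_outNbrs, Finset.card_eq_one]
    refine ⟨w, Finset.eq_singleton_iff_unique_mem.2 ⟨mem_outNbrs.2 hw, fun a ha => ?_⟩⟩
    exact h a (mem_outNbrs.1 ha)
  · rw [arcCount_of_notMem hw, ← card_outNbrs, Finset.card_eq_zero,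
      Finset.eq_empty_iff_forall_notMem]
    intro a ha
    rw [mem_outNbrs] at ha
    exact hw (h a ha ▸ ha)

lemma mem_arcs_induce_pair {v w a b : ℕ} : (a, b) ∈ (D.induce {v, w}).arcs ↔
    (a, b) ∈ D.arcs ∧ (a = v ∨ a = w) ∧ (b = v ∨ b = w) := by
  simp [induce]

lemma mem_verts_induce_pair {v w u : ℕ} : u ∈ (D.induce {v, w}).verts ↔
    u ∈ D.verts ∧ (u = v ∨ u = w) := by
  simp [induce]

lemma biconnected_induce_pair {v w : ℕ} (hvw : D.ugAdj v w) : (D.induce {v, w}).Biconnected := by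
  have hv : v ∈ (D.induce {v, w}).verts := mem_verts_induce_pair.2 ⟨hvw.1, Or.inl rfl⟩
  have hw : w ∈ (D.induce {v, w}).verts := mem_verts_induce_pair.2 ⟨hvw.2.1, Or.inr rfl⟩
  have hne := ugAdj_ne hvw
  refine ⟨?_, connected_of_dominating hv ?_, ?_⟩
  · exact Finset.one_lt_card.2 ⟨v, hv, w, hw, hne⟩
  · intro u hu huv
    obtain rfl := (mem_verts_induce_pair.1 hu).2.resolve_left huv
    refine ⟨hv, hw, hvw.2.2.imp (fun h => ?_) (fun h => ?_)⟩ <;>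
      simp [mem_arcs_induce_pair, h]
  · intro x hx
    rcases (mem_verts_induce_pair.1 hx).2 with rfl | rfl
    · refine connected_of_dominating (mem_verts_del.2 ⟨hw, hne.symm⟩) fun u hu huw => ?_
      rw [mem_verts_del, mem_verts_induce_pair] at hu
      tauto
    · refine connected_of_dominating (mem_verts_del.2 ⟨hv, hne⟩) fun u hu huv => ?_
      rw [mem_verts_del, mem_verts_induce_pair] at hu
      tauto

/-- A pendant vertex whose budget has a single colour is a monochromatic block, so the pair is a
join as soon as the rest is hard. -/
lemma hard_of_pendant (h : D.Obstruction F) {v w : ℕ} (hvw : D.ugAdj v w)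
    (hpend : ∀ u, D.ugAdj v u → u = w) (hij : i ≠ j) (hj : F j v = (0, 0))
    (hconn : (D.del {v}).Connected)
    (hred : F i v ≠ (0, 0) → IsHardPair 2 (D.del {v}) (D.reduceAt F v i)) : IsHardPair 2 D F := by
  have hne := ugAdj_ne hvw
  have hin : ∀ a, (a, v) ∈ D.arcs → a = w := fun a ha => hpend a (ugAdj_symm (ugAdj_of_arc ha))
  have hout : ∀ a, (v, a) ∈ D.arcs → a = w := fun a ha => hpend a (ugAdj_of_arc ha)
  have hiv : F i v = (D.arcCount w v, D.arcCount v w) := by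
    rw [h.eq_deg_of_eq_zero hij hvw.1 hj, inDeg_eq_arcCount hin, outDeg_eq_arcCount hout]
  have hiv0 : F i v ≠ (0, 0) := by
    rw [hiv]
    rcases hvw.2.2 with h | h <;> simp [arcCount_of_mem h]
  have hle := (h.reduce hiv0 hconn).2 w hvw.2.1 hne.symm
  let K := D.induce {v, w}
  have hKcount : ∀ a b, (a = v ∨ a = w) → (b = v ∨ b = w) → K.arcCount a b = D.arcCount a b := by
    intro a b ha hb
    simp [arcCount, K, mem_arcs_induce_pair, ha, hb]
  have hKv : (K.inDeg v, K.outDeg v) = (D.arcCount w v, D.arcCount v w) := by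
    rw [inDeg_eq_arcCount (w := w) fun a ha => hin a (mem_arcs_induce_pair.1 ha).1,
      outDeg_eq_arcCount (w := w) fun a ha => hout a (mem_arcs_induce_pair.1 ha).1,
      hKcount _ _ (Or.inr rfl) (Or.inl rfl), hKcount _ _ (Or.inl rfl) (Or.inr rfl)]
  have hKw : (K.inDeg w, K.outDeg w) = (D.arcCount v w, D.arcCount w v) := by
    rw [inDeg_eq_arcCount (w := v), outDeg_eq_arcCount (w := v),
      hKcount _ _ (Or.inl rfl) (Or.inr rfl), hKcount _ _ (Or.inr rfl) (Or.inl rfl)]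
    · exact fun a ha => (mem_arcs_induce_pair.1 ha).2.2.resolve_right fun h =>
        K.no_loops _ ha h.symm
    · exact fun a ha => (mem_arcs_induce_pair.1 ha).2.1.resolve_right (K.no_loops _ ha)
  refine .join (D.del {v}) K (D.reduceAt F v i)
    (fun k u => if k = i then (K.inDeg u, K.outDeg u) else (0, 0)) w (hred hiv0)
    (.mono i (biconnected_induce_pair hvw) (fun u _ => if_pos rfl) fun k hk u _ => if_neg hk)
    ?_ ?_ ?_ ?_ ?_ ?_
  · ext u
    simp only [K, Finset.mem_inter, mem_verts_del, mem_verts_induce_pair, Finset.mem_singleton]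
    constructor
    · tauto
    · rintro rfl
      exact ⟨⟨hvw.2.1, hne.symm⟩, hvw.2.1, Or.inr rfl⟩
  · ext u
    simp only [K, Finset.mem_union, mem_verts_del, mem_verts_induce_pair]
    tauto
  · ext ⟨a, b⟩
    simp only [K, Finset.mem_union, mem_arcs_del, mem_arcs_induce_pair]
    constructor
    · intro hab
      by_cases ha : a = v
      · subst ha
        exact Or.inr ⟨hab, Or.inl rfl, Or.inr (hout b hab)⟩
      · by_cases hb : b = v
        · subst hb
          exact Or.inr ⟨hab, Or.inr (hin a hab), Or.inl rfl⟩
        · exact Or.inl ⟨hab, ha, hb⟩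
    · tauto
  · intro k u _ huw
    by_cases hk : k = i
    · subst hk
      rw [reduceAt_self, arcCount_of_notMem fun h => huw (hout u h),
        arcCount_of_notMem fun h => huw (hin u h)]
      rfl
    · rw [reduceAt_of_ne hk]
  · intro k u hu huw
    obtain rfl := (mem_verts_induce_pair.1 hu).2.resolve_right huw
    by_cases hk : k = i
    · subst hk
      rw [if_pos rfl, hKv, hiv]
    · rw [if_neg hk, (eq_or_eq hij k).resolve_left hk, hj]
  · intro k
    by_cases hk : k = i
    · subst hk
      rw [if_pos rfl, hKw, reduceAt_self]
      refine Prod.ext ?_ ?_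
      · simp only
        omega
      · simp only
        omega
    · rw [if_neg hk, reduceAt_of_ne hk]
      rfl

/-- On a cycle with a pendant vertex, only one colour is available at the pendant vertex. -/
lemma exists_eq_zero_of_pendant (h : D.Obstruction F) {v w : ℕ} (hC : (D.del {v}).IsCycleUG)
    (hvw : D.ugAdj v w) (hpend : ∀ u, D.ugAdj v u → u = w) : ∃ j, F j v = (0, 0) := by
  by_contra! hne
  have hwv := (ugAdj_ne hvw).symm
  have hin : ∀ a, (a, v) ∈ D.arcs → a = w := fun a ha => hpend a (ugAdj_symm (ugAdj_of_arc ha))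
  have hout : ∀ a, (v, a) ∈ D.arcs → a = w := fun a ha => hpend a (ugAdj_of_arc ha)
  have ht := h.tight (i := 0) (j := 1) (by decide) hvw.1
  rw [inDeg_eq_arcCount hin, outDeg_eq_arcCount hout] at ht
  have hne' : ∀ k, (F k v).1 = 0 → (F k v).2 ≠ 0 := fun k h1 h2 => hne k (Prod.ext h1 h2)
  have h0 := hne' 0
  have h1 := hne' 1
  have c1 := D.arcCount_le_one w v
  have c2 := D.arcCount_le_one v w
  have e1 : D.arcCount w v = 1 := by omega
  have e2 : D.arcCount v w = 1 := by omega
  have hwC : w ∈ (D.del {v}).verts := mem_verts_del.2 ⟨hvw.2.1, hwv⟩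
  obtain ⟨u, hu⟩ : ((D.del {v}).ugNbrs w).Nonempty :=
    Finset.card_pos.1 (by rw [hC.2 w hwC]; norm_num)
  rw [mem_ugNbrs_iff_ugAdj] at hu
  have huw := (ugAdj_ne hu).symm
  have huC := hu.2.1
  have hredu : ∀ i k, D.reduceAt F v i k u = F k u := by
    intro i k
    by_cases hk : k = i
    · subst hk
      rw [reduceAt_self, arcCount_of_notMem fun h => huw (hout u h),
        arcCount_of_notMem fun h => huw (hin u h)]
      rfl
    · rw [reduceAt_of_ne hk]
  have hle : ∀ k, 1 ≤ (F k w).1 := fun k => by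
    have := ((h.reduce (hne k) hC.1).2 w hvw.2.1 hwv).1
    omega
  have hmono : ∀ i l, (∀ x ∈ (D.del {v}).verts, D.reduceAt F v i l x = (0, 0)) →
      l = i ∧ F l u = (0, 0) := by
    intro i l hl
    refine ⟨?_, hredu i l ▸ hl u huC⟩
    by_contra hli
    have hlw := hl w hwC
    rw [reduceAt_of_ne hli] at hlw
    have hlw' := hle l
    rw [hlw] at hlw'
    simp at hlw'
  rcases (h.reduce (hne 0) hC.1).1.cycle hC with ⟨l, hl⟩ | ⟨-, -, hF0⟩ <;>
    rcases (h.reduce (hne 1) hC.1).1.cycle hC with ⟨m, hm⟩ | ⟨-, -, hF1⟩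
  · obtain ⟨rfl, hl0⟩ := hmono 0 l hl
    obtain ⟨rfl, hm0⟩ := hmono 1 m hm
    have ht := h.tight (i := 0) (j := 1) (by decide) (mem_verts_del.1 huC).1
    rw [hl0, hm0] at ht
    rcases (ugAdj_del.1 hu).1.2.2 with h | h
    · have := inDeg_pos h
      simp only [Nat.add_zero] at ht
      omega
    · have := outDeg_pos h
      simp only [Nat.add_zero] at ht
      omega
  · have := hF1 l u huC
    rw [hredu, (hmono 0 l hl).2] at this
    simp at this
  · have := hF0 m u huC
    rw [hredu, (hmono 1 m hm).2] at this
    simp at this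
  · have a := hF0 1 w hwC
    have b := hF1 1 w hwC
    rw [reduceAt_of_ne (by decide)] at a
    rw [reduceAt_self, a, e2] at b
    simp at b

/-! ### Wheels -/

lemma del_connected_of_two_nbrs {v w₁ w₂ : ℕ} (hC : (D.del {v}).IsCycleUG) (h₁ : D.ugAdj v w₁)
    (h₂ : D.ugAdj v w₂) (hw : w₁ ≠ w₂) : ∀ x ∈ D.verts, (D.del {x}).Connected := by
  intro x hx
  by_cases hxv : x = v
  · rw [hxv]
    exact hC.1
  · obtain ⟨w, hvw, hwx⟩ : ∃ w, D.ugAdj v w ∧ w ≠ x := by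
      by_cases h : w₁ = x
      · exact ⟨w₂, h₂, fun h' => hw (h.trans h'.symm)⟩
      · exact ⟨w₁, h₁, h⟩
    refine connected_of_del (x := v) (w := w) (ugAdj_del.2 ⟨hvw, Ne.symm hxv, hwx⟩) ?_
    rw [del_comm]
    exact hC.del_connected (mem_verts_del.2 ⟨hx, hxv⟩)

/-- A bidirected wheel with budgets `(2,2)` and `(1,1)` on the rim is an obstruction only if it is
a complete hard pair. -/
lemma hard_of_bidirected_wheel (h : D.Obstruction F) {v : ℕ} (hv : v ∈ D.verts)
    (hC : (D.del {v}).IsCycleUG) (hij : i ≠ j) (hbi : (D.del {v}).Bidirected)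
    (hspoke : ∀ u ∈ (D.del {v}).verts, (v, u) ∈ D.arcs ∧ (u, v) ∈ D.arcs)
    (hFi : ∀ u ∈ (D.del {v}).verts, F i u = (2, 2))
    (hFj : ∀ u ∈ (D.del {v}).verts, F j u = (1, 1)) : IsHardPair 2 D F := by
  have hdom : ∀ x ≠ v, ∀ u ∈ (D.del {x}).verts, u ≠ v → (D.del {x}).ugAdj v u := by
    intro x hx u hu huv
    rw [mem_verts_del] at hu
    exact ugAdj_del.2 ⟨ugAdj_of_arc (hspoke u (mem_verts_del.2 ⟨hu.1, huv⟩)).1, hx.symm, hu.2⟩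
  have hkey : ∀ x ∈ (D.del {v}).verts, F j v = (1, 1) ∧
      ∀ w ∈ (D.del {v}).verts, w ≠ x → (D.del {v}).ugAdj x w := by
    intro x hx
    have hxv := (mem_verts_del.1 hx).2
    have hjx : F j x ≠ (0, 0) := by simp [hFj x hx]
    have hvD : v ∈ (D.del {x}).verts := mem_verts_del.2 ⟨hv, hxv.symm⟩
    obtain ⟨hred, hle⟩ := h.reduce hjx (connected_of_dominating hvD (hdom x hxv))
    have hlev := hle v hv hxv.symm
    rw [arcCount_of_mem (hspoke x hx).1, arcCount_of_mem (hspoke x hx).2] at hlev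
    obtain ⟨y, hy⟩ : ((D.del {v}).ugNbrs x).Nonempty :=
      Finset.card_pos.1 (by rw [hC.2 x hx]; norm_num)
    rw [mem_ugNbrs_iff_ugAdj] at hy
    have hxy : (x, y) ∈ D.arcs ∧ (y, x) ∈ D.arcs := by
      rcases hy.2.2 with hxy | hyx
      · exact ⟨(mem_arcs_del.1 hxy).1, (mem_arcs_del.1 (hbi _ hxy)).1⟩
      · exact ⟨(mem_arcs_del.1 (hbi _ hyx)).1, (mem_arcs_del.1 hyx).1⟩
    have hyred : D.reduceAt F x j j y = (0, 0) := by
      rw [reduceAt_self, hFj y hy.2.1, arcCount_of_mem hxy.1, arcCount_of_mem hxy.2]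
      rfl
    have hyD : y ∈ (D.del {x}).verts :=
      mem_verts_del.2 ⟨(mem_verts_del.1 hy.2.1).1, (ugAdj_ne hy).symm⟩
    have hvred : D.reduceAt F x j j v = (0, 0) := by
      by_contra hcon
      refine hred.ne_zero_of_ugAdj hcon ?_
        (hdom x hxv y hyD (mem_verts_del.1 hy.2.1).2) hyred
      rw [del_comm]
      exact hC.del_connected hx
    constructor
    · rw [reduceAt_self, arcCount_of_mem (hspoke x hx).1, arcCount_of_mem (hspoke x hx).2,
        Prod.mk.injEq] at hvred
      exact Prod.ext (show (F j v).1 = 1 by omega) (show (F j v).2 = 1 by omega)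
    · intro w hw hwx
      by_contra hnadj
      have hwv := (mem_verts_del.1 hw).2
      have hwD : w ∈ (D.del {x}).verts := mem_verts_del.2 ⟨(mem_verts_del.1 hw).1, hwx⟩
      have hnot : (x, w) ∉ D.arcs ∧ (w, x) ∉ D.arcs := by
        constructor
        · exact fun h => hnadj (ugAdj_of_arc (mem_arcs_del.2 ⟨h, hxv, hwv⟩))
        · exact fun h => hnadj (ugAdj_symm (ugAdj_of_arc (mem_arcs_del.2 ⟨h, hwv, hxv⟩)))
      refine hred.ne_zero_of_ugAdj (x := w) ?_ ?_ (ugAdj_symm (hdom x hxv w hwD hwv)) hvred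
      · rw [reduceAt_self, hFj w hw, arcCount_of_notMem hnot.1, arcCount_of_notMem hnot.2]
        simp
      · refine connected_of_dominating (mem_verts_del.2 ⟨hvD, hwv.symm⟩) fun u hu huv => ?_
        rw [mem_verts_del] at hu
        exact ugAdj_del.2 ⟨hdom x hxv u hu.1 huv, hwv.symm, hu.2⟩
  obtain ⟨x, hx⟩ := hC.1.1
  have hcardC : (D.del {v}).verts.card = 3 := by
    have heq : (D.del {v}).verts = insert x ((D.del {v}).ugNbrs x) := by
      ext u
      rw [Finset.mem_insert, mem_ugNbrs_iff_ugAdj]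
      constructor
      · intro hu
        by_cases hux : u = x
        · exact Or.inl hux
        · exact Or.inr ((hkey x hx).2 u hu hux)
      · rintro (rfl | hu)
        · exact hx
        · exact hu.2.1
    rw [heq, Finset.card_insert_of_notMem, hC.2 x hx]
    exact fun hxx => ugAdj_ne (mem_ugNbrs_iff_ugAdj.1 hxx) rfl
  have hCerase : (D.del {v}).verts = D.verts.erase v := by
    ext w
    rw [mem_verts_del, Finset.mem_erase, and_comm]
  have hcardD : D.verts.card = 4 := by
    rw [← Finset.card_erase_add_one hv, ← hCerase, hcardC]
  have hin : D.inNbrs v = (D.del {v}).verts := by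
    ext u
    rw [mem_inNbrs]
    exact ⟨fun hu => mem_verts_del.2 ⟨D.mem_fst _ hu, D.no_loops _ hu⟩, fun hu => (hspoke u hu).2⟩
  have hout : D.outNbrs v = (D.del {v}).verts := by
    ext u
    rw [mem_outNbrs]
    exact ⟨fun hu => mem_verts_del.2 ⟨D.mem_snd _ hu, (D.no_loops _ hu).symm⟩,
      fun hu => (hspoke u hu).1⟩
  have hjall : ∀ u ∈ D.verts, F j u = (1, 1) := by
    intro u hu
    by_cases huv : u = v
    · rw [huv, (hkey x hx).1]
    · exact hFj u (mem_verts_del.2 ⟨hu, huv⟩)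
  have hiall : ∀ u ∈ D.verts, F i u = (2, 2) := by
    intro u hu
    by_cases huv : u = v
    · have ht := h.tight hij hv
      rw [(hkey x hx).1, ← card_inNbrs, ← card_outNbrs, hin, hout, hcardC] at ht
      rw [huv]
      exact Prod.ext (show (F i v).1 = 2 by omega) (show (F i v).2 = 2 by omega)
    · exact hFi u (mem_verts_del.2 ⟨hu, huv⟩)
  refine .complete ?_ ?_ ?_ ?_
  · intro a ha b hb hab
    by_cases hav : a = v
    · subst hav
      exact (hspoke b (mem_verts_del.2 ⟨hb, hab.symm⟩)).1
    by_cases hbv : b = v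
    · subst hbv
      exact (hspoke a (mem_verts_del.2 ⟨ha, hab⟩)).2
    have haC := mem_verts_del.2 ⟨ha, hav⟩
    have hbC := mem_verts_del.2 ⟨hb, hbv⟩
    rcases ((hkey a haC).2 b hbC hab.symm).2.2 with h | h
    · exact (mem_arcs_del.1 h).1
    · exact (mem_arcs_del.1 (hbi _ h)).1
  · intro k a ha b hb
    rcases eq_or_eq hij k with rfl | rfl
    · rw [hiall a ha, hiall b hb]
    · rw [hjall a ha, hjall b hb]
  · intro k a ha
    rcases eq_or_eq hij k with rfl | rfl
    · rw [hiall a ha]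
    · rw [hjall a ha]
  · intro a ha
    rw [sum_two hij, hiall a ha, hjall a ha, hcardD]
    rfl

/-- A wheel with directed rim, bidirected spokes and budgets `(1,1)` on the rim is not an
obstruction. -/
lemma false_of_directed_wheel (h : D.Obstruction F) {v : ℕ} (hv : v ∈ D.verts)
    (hC : (D.del {v}).IsCycleUG)
    (hdeg : ∀ u ∈ (D.del {v}).verts, (D.del {v}).outDeg u = 1)
    (hspoke : ∀ u ∈ (D.del {v}).verts, (v, u) ∈ D.arcs ∧ (u, v) ∈ D.arcs)
    (hF : ∀ k, ∀ u ∈ (D.del {v}).verts, F k u = (1, 1)) : False := by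
  obtain ⟨x, hx⟩ := hC.1.1
  have hxv := (mem_verts_del.1 hx).2
  have hin : (D.del {v}).verts ⊆ D.inNbrs v := fun u hu => mem_inNbrs.2 (hspoke u hu).2
  have hcard : 3 ≤ D.inDeg v := by
    have hsub : insert x ((D.del {v}).ugNbrs x) ⊆ D.inNbrs v := by
      intro u hu
      rw [Finset.mem_insert, mem_ugNbrs_iff_ugAdj] at hu
      rcases hu with rfl | hu
      · exact hin hx
      · exact hin hu.2.1
    have hle := Finset.card_le_card hsub
    rw [Finset.card_insert_of_notMem, hC.2 x hx, card_inNbrs] at hle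
    · exact hle
    · exact fun hxx => ugAdj_ne (mem_ugNbrs_iff_ugAdj.1 hxx) rfl
  obtain ⟨i, hi⟩ : ∃ i, 2 ≤ (F i v).1 := by
    by_contra! hcon
    have ht := (h.tight (i := 0) (j := 1) (by decide) hv).1
    have h0 := hcon 0
    have h1 := hcon 1
    omega
  have hconn : (D.del {x}).Connected := by
    refine connected_of_dominating (mem_verts_del.2 ⟨hv, hxv.symm⟩) fun u hu huv => ?_
    rw [mem_verts_del] at hu
    exact ugAdj_del.2 ⟨ugAdj_of_arc (hspoke u (mem_verts_del.2 ⟨hu.1, huv⟩)).1, hxv.symm, hu.2⟩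
  obtain ⟨y, hy⟩ : ((D.del {v}).outNbrs x).Nonempty :=
    Finset.card_pos.1 (by rw [card_outNbrs, hdeg x hx]; norm_num)
  rw [mem_outNbrs] at hy
  have hyC : y ∈ (D.del {v}).verts := (D.del {v}).mem_snd _ hy
  have hxy := mem_arcs_del.1 hy
  have hyx : y ≠ x := (D.no_loops _ hxy.1).symm
  have hred := (h.reduce (i := i) (by simp [hF i x hx]) hconn).1
  have hvne : D.reduceAt F x i i v ≠ (0, 0) := by
    rw [reduceAt_self, arcCount_of_mem (hspoke x hx).2, Ne, Prod.mk.injEq]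
    omega
  have hle := ((hred.reduce hvne (by rw [del_comm]; exact hC.del_connected hx)).2 y
    (mem_verts_del.2 ⟨(mem_verts_del.1 hyC).1, hyx⟩) hxy.2.2).1
  rw [reduceAt_self, hF i y hyC, arcCount_of_mem hxy.1,
    arcCount_of_mem (mem_arcs_del.2 ⟨(hspoke y hyC).1, hxv.symm, hyx⟩)] at hle
  simp at hle

lemma hard_of_wheel (h : D.Obstruction F) {v w₁ w₂ : ℕ} (hC : (D.del {v}).IsCycleUG)
    (h₁ : D.ugAdj v w₁) (h₂ : D.ugAdj v w₂) (hw : w₁ ≠ w₂) : IsHardPair 2 D F := by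
  have hv := h₁.1
  have hconn := del_connected_of_two_nbrs hC h₁ h₂ hw
  by_cases hmono : ∃ j, ∀ u ∈ D.verts, F j u = (0, 0)
  · obtain ⟨j, hj⟩ := hmono
    obtain ⟨i, hi⟩ := exists_ne j
    refine .mono i ⟨Finset.one_lt_card.2 ⟨v, hv, w₁, h₁.2.1, ugAdj_ne h₁⟩, h.valid.1, hconn⟩
      (fun u hu => h.eq_deg_of_eq_zero hi hu (hj u hu)) fun k hk u hu => ?_
    rw [(eq_or_eq hi k).resolve_left hk, hj u hu]
  have hne : ∀ k, ∀ u ∈ D.verts, F k u ≠ (0, 0) := fun k =>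
    h.forall_ne_zero hconn fun h0 => hmono ⟨k, h0⟩
  have hneC : ∀ k, ∀ u ∈ (D.del {v}).verts, F k u ≠ (0, 0) := fun k u hu =>
    hne k u (mem_verts_del.1 hu).1
  have hle := fun k u (hu : u ∈ (D.del {v}).verts) =>
    (h.reduce (hne k v hv) hC.1).2 u (mem_verts_del.1 hu).1 (mem_verts_del.1 hu).2
  have houtcome : ∀ i j, i ≠ j →
      (∀ u ∈ (D.del {v}).verts, F i u = (D.arcCount v u, D.arcCount u v) ∧
        F j u = ((D.del {v}).inDeg u, (D.del {v}).outDeg u)) ∨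
      ((D.del {v}).Bidirected ∧ ∀ u ∈ (D.del {v}).verts,
        F i u = (1 + D.arcCount v u, 1 + D.arcCount u v) ∧ F j u = (1, 1)) := by
    intro i j hij
    have hred := (h.reduce (hne i v hv) hC.1).1
    rcases hred.cycle hC with ⟨l, hl⟩ | ⟨hbi, -, hF⟩
    · left
      obtain rfl : l = i := by
        by_contra hli
        obtain ⟨u, hu⟩ := hC.1.1
        have := hl u hu
        rw [reduceAt_of_ne hli] at this
        exact hneC l u hu this
      intro u hu
      have hj := hred.eq_deg_of_eq_zero hij.symm hu (hl u hu)
      rw [reduceAt_of_ne hij.symm] at hj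
      refine ⟨?_, hj⟩
      have hl0 := hl u hu
      have hlu := hle l u hu
      rw [reduceAt_self, Prod.mk.injEq] at hl0
      exact Prod.ext (show (F l u).1 = D.arcCount v u by omega)
        (show (F l u).2 = D.arcCount u v by omega)
    · right
      refine ⟨hbi, fun u hu => ⟨?_, ?_⟩⟩
      · have hi := hF i u hu
        have hlu := hle i u hu
        rw [reduceAt_self, Prod.mk.injEq] at hi
        exact Prod.ext (show (F i u).1 = 1 + D.arcCount v u by omega)
          (show (F i u).2 = 1 + D.arcCount u v by omega)
      · have hj := hF j u hu
        rwa [reduceAt_of_ne hij.symm] at hj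
  by_cases hbw : ∃ i j, i ≠ j ∧ (D.del {v}).Bidirected ∧ ∀ u ∈ (D.del {v}).verts,
        F i u = (1 + D.arcCount v u, 1 + D.arcCount u v) ∧ F j u = (1, 1)
  · obtain ⟨i, j, hij, hbi, hF⟩ := hbw
    have hcount : ∀ u ∈ (D.del {v}).verts, D.arcCount v u = 1 ∧ D.arcCount u v = 1 := by
      rcases houtcome j i hij.symm with hj | ⟨-, hj⟩
      · intro u hu
        have := (hj u hu).1
        rw [(hF u hu).2, Prod.mk.injEq] at this
        exact ⟨this.1.symm, this.2.symm⟩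
      · exfalso
        have hw₁ := mem_verts_del.2 ⟨h₁.2.1, (ugAdj_ne h₁).symm⟩
        have hcon := (hj w₁ hw₁).2
        rw [(hF w₁ hw₁).1, Prod.mk.injEq] at hcon
        rcases h₁.2.2 with ha | ha
        · rw [arcCount_of_mem ha] at hcon
          omega
        · rw [arcCount_of_mem ha] at hcon
          omega
    refine h.hard_of_bidirected_wheel hv hC hij hbi (fun u hu => ?_) (fun u hu => ?_)
      fun u hu => (hF u hu).2
    · exact ⟨arcCount_pos_iff.1 (hcount u hu).1.ge, arcCount_pos_iff.1 (hcount u hu).2.ge⟩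
    · rw [(hF u hu).1, (hcount u hu).1, (hcount u hu).2]
  · exfalso
    have hA : ∀ i j, i ≠ j → ∀ u ∈ (D.del {v}).verts,
        F i u = (D.arcCount v u, D.arcCount u v) ∧
          F j u = ((D.del {v}).inDeg u, (D.del {v}).outDeg u) := fun i j hij =>
      (houtcome i j hij).resolve_right fun hB => hbw ⟨i, j, hij, hB⟩
    have hone : ∀ u ∈ (D.del {v}).verts, D.arcCount v u = 1 ∧ D.arcCount u v = 1 ∧
        (D.del {v}).outDeg u = 1 := by
      intro u hu
      have hdeg := (hA 1 0 (by decide) u hu).2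
      rw [(hA 0 1 (by decide) u hu).1, Prod.mk.injEq] at hdeg
      have hcard := Finset.card_union_le ((D.del {v}).inNbrs u) ((D.del {v}).outNbrs u)
      have htwo : ((D.del {v}).inNbrs u ∪ (D.del {v}).outNbrs u).card = 2 := hC.2 u hu
      rw [htwo, card_inNbrs, card_outNbrs] at hcard
      have c1 := D.arcCount_le_one v u
      have c2 := D.arcCount_le_one u v
      omega
    refine h.false_of_directed_wheel hv hC (fun u hu => (hone u hu).2.2)
      (fun u hu => ⟨arcCount_pos_iff.1 (hone u hu).1.ge, arcCount_pos_iff.1 (hone u hu).2.1.ge⟩)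
      fun k u hu => ?_
    obtain ⟨l, hl⟩ := exists_ne k
    rw [(hA k l hl.symm u hu).1, (hone u hu).1, (hone u hu).2.1]

end Obstruction

end Digraph'

/-- **Lemma (subwheels).** Let `(D,F=(f₁,f₂))` be a valid tight non-hard pair, and suppose
there is a vertex `v` such that `UG(D − v)` is a cycle. Then `D` is `F`-dicolourable. -/
theorem subwheel_dicolourable
    (D : Digraph') (F : Fin 2 → ℕ → ℕ × ℕ)
    (hvalid : D.ValidPair 2 F) (htight : D.Tight 2 F)
    (hnothard : ¬ IsHardPair 2 D F)
    (v : ℕ) (hv : v ∈ D.verts)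
    (hcyc : (D.del {v}).IsCycleUG) :
    D.Dicolourable 2 F := by
  by_contra hnot
  have h : D.Obstruction F := ⟨hvalid, hnot⟩
  apply hnothard
  obtain ⟨y, hy⟩ := hcyc.1.1
  rw [mem_verts_del] at hy
  obtain ⟨w, hvw⟩ := hvalid.1.exists_ugAdj hv hy.1 hy.2.symm
  by_cases hpend : ∀ u, D.ugAdj v u → u = w
  · obtain ⟨j, hj⟩ := h.exists_eq_zero_of_pendant hcyc hvw hpend
    obtain ⟨i, hij⟩ := exists_ne j
    exact h.hard_of_pendant hvw hpend hij hj hcyc.1 fun hi =>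
      (h.reduce hi hcyc.1).1.hard_of_cycle hcyc
  · push Not at hpend
    obtain ⟨u, hvu, huw⟩ := hpend
    exact h.hard_of_wheel hcyc hvu hvw huw
end
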